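/- Let h < h_star. There exists a constant c_h > 0 such that simultaneously: (i) liminf_{n→∞} (1/N_n)·E^{G_n}[ ∑_{x ∈ G_n} 1_{A_x^{G_n,h,c_h}} ] ≥ η^+(h) > 0, and (ii) lim_{n→∞} (1/N_n²)·Var_{P^{G_n}}( ∑_{x ∈ G_n} 1_{A_x^{G_n,h,c_h}} ) = 0. -/

import Mathlib

open MeasureTheory ProbabilityTheory Filter Set
open scoped ENNReal NNReal ENat Classical

namespace GFF

variable {V : Type*} {T : Type*}

/-- Number of ordered adjacent pairs inside `U` (twice the number of edges of the induced
subgraph). -/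
noncomputable def adjPairs (G : SimpleGraph V) (U : Set V) : ℕ :=
  Set.ncard {p : V × V | p.1 ∈ U ∧ p.2 ∈ U ∧ G.Adj p.1 p.2}

/-- `U` (assumed connected) induces a tree, i.e. has tree excess zero. -/
def TxZero (G : SimpleGraph V) (U : Set V) : Prop :=
  adjPairs G U = 2 * (Set.ncard U - 1)

/-- Closed ball of radius `R` for the graph distance. -/
def gball (G : SimpleGraph V) (x : V) (R : ℕ) : Set V := {y | G.dist x y ≤ R}

/-- Set of vertices within distance `R` of the set `A`. -/
def sball (G : SimpleGraph V) (A : Set V) (R : ℕ) : Set V := {y | ∃ a ∈ A, G.dist a y ≤ R}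

/-- Connected component containing `x` of the level set `{ω ≥ h}`. -/
def levelComp (G : SimpleGraph V) (h : ℝ) (ω : V → ℝ) (x : V) : Set V :=
  {y | ∃ p : G.Walk x y, ∀ v ∈ p.support, h ≤ ω v}

/-- `G` is `d`-regular. -/
def IsReg (G : SimpleGraph V) (d : ℕ) : Prop := ∀ v, Nat.card (G.neighborSet v) = d

/-- `G` is an infinite `d`-regular tree. -/
def IsRegTree (G : SimpleGraph V) (d : ℕ) : Prop :=
  G.Connected ∧ G.IsAcyclic ∧ IsReg G d

/-- Transition matrix of SRW on a `d`-regular graph. -/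
noncomputable def transP [Fintype V] (G : SimpleGraph V) (d : ℕ) : Matrix V V ℝ :=
  Matrix.of fun u v => if G.Adj u v then ((d : ℝ))⁻¹ else 0

/-- All non-zero eigenvalues of `I - P` are at least `β`. -/
def SpectralGapLB [Fintype V] (G : SimpleGraph V) (d : ℕ) (β : ℝ) : Prop :=
  ∀ (f : V → ℝ) (lam : ℝ),
    Matrix.mulVec ((1 : Matrix V V ℝ) - transP G d) f = lam • f → f ≠ 0 → lam = 0 ∨ β ≤ lam

/-- `P_x[X̄_t = y]` for the continuous-time SRW with i.i.d. mean-one exponential holding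
times (Poissonized jump chain). -/
noncomputable def heatK [Fintype V] (G : SimpleGraph V) (d : ℕ) (t : ℝ) (x y : V) : ℝ :=
  ∑' k : ℕ, Real.exp (-t) * t ^ k / (Nat.factorial k) * ((transP G d) ^ k) x y

/-- The zero-average Green function. -/
noncomputable def zGreen [Fintype V] (G : SimpleGraph V) (d Nn : ℕ) (x y : V) : ℝ :=
  ∫ t in Set.Ioi (0 : ℝ), (heatK G d t x y - 1 / (Nn : ℝ))

/-- Green function of SRW on the `d`-regular tree. -/
noncomputable def treeGreen (G : SimpleGraph V) (d : ℕ) (x y : V) : ℝ :=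
  (((d : ℝ) - 1) / ((d : ℝ) - 2)) * (((d : ℝ) - 1)⁻¹) ^ (G.dist x y)

/-- `μ` is the law of the centred Gaussian field with covariance `K`. -/
def IsGaussianField {I : Type*} (μ : Measure (I → ℝ)) (K : I → I → ℝ) : Prop :=
  IsProbabilityMeasure μ ∧
    ∀ c : I →₀ ℝ,
      μ.map (fun ω => ∑ i ∈ c.support, c i * ω i) =
        gaussianReal 0 (Real.toNNReal (∑ i ∈ c.support, ∑ j ∈ c.support, c i * c j * K i j))

/-- One-step transition probability of SRW. -/
noncomputable def srwStep (G : SimpleGraph V) (d : ℕ) (u v : V) : ℝ≥0∞ :=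
  if G.Adj u v then (d : ℝ≥0∞)⁻¹ else 0

/-- `W x` is the law of discrete-time SRW on `G` started at `x`. -/
def IsSRW [MeasurableSpace V] (G : SimpleGraph V) (d : ℕ) (W : V → Measure (ℕ → V)) : Prop :=
  (∀ x, IsProbabilityMeasure (W x)) ∧
    ∀ (x : V) (k : ℕ) (p : ℕ → V),
      W x {ω | ∀ i ≤ k, ω i = p i} =
        (if p 0 = x then 1 else 0) * ∏ i ∈ Finset.range k, srwStep G d (p i) (p (i + 1))

/-- Entrance time of the set `A` (`⊤` if never entered). -/
noncomputable def hitTime (A : Set V) (ω : ℕ → V) : ℕ∞ :=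
  sInf ((Nat.cast : ℕ → ℕ∞) '' {k | ω k ∈ A})

/-- Exit time of the set `U`. -/
noncomputable def exitTime (U : Set V) (ω : ℕ → V) : ℕ∞ := hitTime Uᶜ ω

/-- Position of the walk at the entrance time of `A`. -/
noncomputable def stopAt (A : Set V) (ω : ℕ → V) : V := ω (hitTime A ω).toNat

/-- `π` is a cover tree of `G` at `x`. -/
def IsCoverMap (Gt : SimpleGraph T) (G : SimpleGraph V) (o : T) (x : V) (π : T → V) : Prop :=
  π o = x ∧ Function.Surjective π ∧ ∀ y : T, π '' (Gt.neighborSet y) = G.neighborSet (π y)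

/-- `T_d^+`: the vertices of the tree whose geodesic to `o` avoids the fixed neighbour
`obar` of `o`. -/
def treePlus (Gt : SimpleGraph T) (o obar : T) : Set T :=
  {z | Gt.dist z obar = Gt.dist z o + 1}

/-- `S^+_{T_d}(o,R)`. -/
def spherePlus (Gt : SimpleGraph T) (o obar : T) (R : ℕ) : Set T :=
  {z | z ∈ treePlus Gt o obar ∧ Gt.dist o z = R}

/-- The critical value for level-set percolation on the tree (w.r.t. the law `μT`). -/
noncomputable def hstar (Gt : SimpleGraph T) (o : T) (μT : Measure (T → ℝ)) : ℝ :=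
  sInf {h : ℝ | μT {ω | (levelComp Gt h ω o).Infinite} = 0}

/-- The forward percolation probability `η⁺(h)`. -/
noncomputable def etaPlus (Gt : SimpleGraph T) (o obar : T) (μT : Measure (T → ℝ)) (h : ℝ) :
    ℝ :=
  (μT {ω | (levelComp Gt h ω o ∩ treePlus Gt o obar).Infinite}).toReal

/-- `s_n`. -/
noncomputable def sn (d Nn : ℕ) : ℕ :=
  max 1 ⌊(8 : ℝ) * Real.logb ((d : ℝ) - 1) (Real.logb ((d : ℝ) - 1) (Nn : ℝ))⌋₊

/-- `c₀ = αβ/(d-1)`. -/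
noncomputable def c0 (d : ℕ) (α β : ℝ) : ℝ := α * β / ((d : ℝ) - 1)

/-- `r_n`. -/
noncomputable def rn (d : ℕ) (α β : ℝ) (Nn : ℕ) : ℕ :=
  max 1 ⌊(c0 d α β / 18) * Real.logb ((d : ℝ) - 1) (Nn : ℝ)⌋₊

/-- `R_n`. -/
noncomputable def Rn (d : ℕ) (α β : ℝ) (Nn : ℕ) : ℕ :=
  max 1 ⌊(c0 d α β / 6) * Real.logb ((d : ℝ) - 1) (Nn : ℝ)⌋₊

/-- `F_A(x,s)`: the vertices of `B(A,s) ∖ A` connected to `x` within `B(A,s) ∖ A`. -/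
def Fset (G : SimpleGraph V) (A : Set V) (s : ℕ) (x : V) : Set V :=
  {z | ∃ p : G.Walk x z, ∀ v ∈ p.support, v ∈ sball G A s ∧ v ∉ A}

/-- Good vertex at the boundary of `A`. -/
def GoodVertex (G : SimpleGraph V) (A : Set V) (s : ℕ) (x : V) : Prop :=
  x ∉ A ∧ (∃! y, y ∈ A ∧ G.Adj x y) ∧
    TxZero G (Fset G A s x) ∧
    ∀ y : V, y ∉ A → (∃ a ∈ A, G.Adj y a) → y ≠ x →
      ∀ p : G.Walk y x, (∀ v ∈ p.support, v ∉ A) → ∃ v ∈ p.support, v ∉ sball G A s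

end GFF

section
open WithLp (toLp ofLp)
open MeasureTheory.Measure (isProbabilityMeasure_map ext_of_charFun map_apply)
open Finset (sum_mul mul_sum sum_comm sum_congr sum_div sum_mul_sum sum_filter sum_const sum_add_distrib sum_eq_zero_iff_of_nonneg sum_nonneg sum_sub_distrib abs_sum_le_sum_abs sum_le_sum sum_eq_zero sum_ite_mem card_le_univ sum_neg_distrib prod_congr prod_coe_sort prod_const mem_filter card_univ card_filter measurable_sum exists_ne_zero_of_sum_ne_zero sum_le_sum_of_subset_of_nonneg card_nsmul_le_sum)
open Fintype (sum_sum_type card_pos_iff)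
open Complex (exp_sum)
open Matrix (mulVec of_apply)
open Real (exp_le_one_iff norm_eq_abs volume_Ico logb exp_le_exp add_one_le_exp exp_nat_mul)
open Function (Injective comp iterate_succ_apply')
open SimpleGraph (dist_eq_one_iff_adj dist_le Walk mem_neighborSet)

namespace GFF
set_option linter.all false

noncomputable def QF {I : Type*} [Fintype I] (K : I → I → ℝ) (c : I → ℝ) : ℝ :=
  ∑ i, ∑ j, c i * c j * K i j

def GF {I : Type*} [Fintype I] (μ : Measure (I → ℝ)) (K : I → I → ℝ) : Prop :=
  IsProbabilityMeasure μ ∧ ∀ c : I → ℝ,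
    ∫ ω, Complex.exp (((∑ i, c i * ω i : ℝ) : ℂ) * Complex.I) ∂μ =
      Complex.exp (((-(QF K c) / 2 : ℝ) : ℂ))

lemma GF.charFun {I : Type*} [Fintype I] {μ : Measure (I → ℝ)} {K : I → I → ℝ} (h : GF μ K)
    (t : EuclideanSpace ℝ I) :
    charFun (μ.map (toLp 2)) t = Complex.exp (((-(QF K t) / 2 : ℝ) : ℂ)) := by
  rw [← h.2 t, charFun_apply, integral_map (Measurable.aemeasurable (by fun_prop)) (Measurable.aestronglyMeasurable (by fun_prop))]
  simp [PiLp.inner_apply]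

lemma GF.unique {I : Type*} [Fintype I] {μ ν : Measure (I → ℝ)} {K : I → I → ℝ}
    (h : GF μ K) (h' : GF ν K) : μ = ν := by
  have := h.1
  have := h'.1
  have e : μ.map (toLp 2) = ν.map (toLp 2) := by
    have := isProbabilityMeasure_map (μ := μ) (f := toLp 2) (by fun_prop)
    have := isProbabilityMeasure_map (μ := ν) (f := toLp 2) (by fun_prop)
    apply ext_of_charFun
    funext t
    rw [h.charFun, h'.charFun]
  have e2 := congrArg (Measure.map (ofLp (p := 2) (V := I → ℝ))) e
  rw [Measure.map_map (by fun_prop) (by fun_prop), Measure.map_map (by fun_prop) (by fun_prop)] at e2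
  have : (ofLp (p := 2) (V := I → ℝ)) ∘ (toLp 2) = id := rfl
  simp_all

lemma GF.lin {I J : Type*} [Fintype I] [Fintype J] {μ : Measure (I → ℝ)} {K : I → I → ℝ}
    (h : GF μ K) (A : J → I → ℝ) :
    GF (μ.map (fun ω j => ∑ i, A j i * ω i))
      (fun j j' => ∑ i, ∑ i', A j i * A j' i' * K i i') := by
  have := h.1
  refine ⟨isProbabilityMeasure_map (Measurable.aemeasurable (by fun_prop)), fun c => ?_⟩
  rw [integral_map (Measurable.aemeasurable (by fun_prop)) (Measurable.aestronglyMeasurable (by fun_prop))]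
  have e := h.2 (fun i => ∑ j, c j * A j i)
  have e1 : ∀ ω : I → ℝ, ∑ i, (∑ j, c j * A j i) * ω i = ∑ j, c j * ∑ i, A j i * ω i := by
    intro ω
    simp_rw [sum_mul, mul_sum]
    rw [sum_comm]
    grind
  simp_rw [e1] at e
  rw [e]
  congr 3
  congr 1
  unfold QF
  simp_rw [sum_mul, mul_sum, sum_mul]
  rw [show ∀ f : I → I → J → J → ℝ, (∑ i, ∑ i', ∑ j, ∑ j', f i i' j j') =
    ∑ j, ∑ j', ∑ i, ∑ i', f i i' j j' from ?_]
  · refine sum_congr rfl fun j _ => ?_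
    grind
  · intro f
    calc _ = ∑ i, ∑ j, ∑ i', ∑ j', f i i' j j' := by
            refine sum_congr rfl fun i _ => sum_comm
      _ = ∑ i, ∑ j, ∑ j', ∑ i', f i i' j j' := by
            refine sum_congr rfl fun i _ => sum_congr rfl fun j _ => sum_comm
      _ = ∑ j, ∑ i, ∑ j', ∑ i', f i i' j j' := sum_comm
      _ = _ := by
            refine sum_congr rfl fun j _ => sum_comm

lemma GF.comp {I J : Type*} [Fintype I] [Fintype J] {μ : Measure (I → ℝ)} {K : I → I → ℝ}
    (h : GF μ K) (f : J → I) :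
    GF (μ.map (fun ω => ω ∘ f)) (fun j j' => K (f j) (f j')) := by
  have := h.lin (fun j i => if i = f j then (1 : ℝ) else 0)
  simpa [Function.comp_def] using this

lemma GF.congr {I : Type*} [Fintype I] {μ : Measure (I → ℝ)} {K K' : I → I → ℝ}
    (h : GF μ K) (hK : ∀ i j, K i j = K' i j) : GF μ K' := by
  have : K = K' := by grind
  grind

lemma GF.prod {I J : Type*} [Fintype I] [Fintype J] {μ : Measure (I → ℝ)} {K : I → I → ℝ}
    {ν : Measure (J → ℝ)} {L : J → J → ℝ} (h : GF μ K) (h' : GF ν L) :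
    GF ((μ.prod ν).map (fun p : (I → ℝ) × (J → ℝ) => (Sum.elim p.1 p.2 : I ⊕ J → ℝ)))
      (fun a b => Sum.elim (fun i => Sum.elim (fun i' => K i i') (fun _ => 0) b)
        (fun j => Sum.elim (fun _ => 0) (fun j' => L j j') b) a) := by
  have := h.1
  have := h'.1
  have hm : Measurable (fun p : (I → ℝ) × (J → ℝ) => (Sum.elim p.1 p.2 : I ⊕ J → ℝ)) := by
    refine measurable_pi_iff.2 ?_
    rintro (i | j)
    · exact (measurable_pi_apply i).comp measurable_fst
    · exact (measurable_pi_apply j).comp measurable_snd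
  refine ⟨isProbabilityMeasure_map hm.aemeasurable, fun c => ?_⟩
  rw [integral_map hm.aemeasurable (Measurable.aestronglyMeasurable (by fun_prop))]
  simp only [sum_sum_type, Sum.elim_inl, Sum.elim_inr]
  push_cast
  simp_rw [add_mul, Complex.exp_add]
  rw [integral_prod_mul (μ := μ) (ν := ν)
    (f := fun x : I → ℝ => Complex.exp ((∑ i, (c (Sum.inl i) : ℂ) * (x i : ℂ)) * Complex.I))
    (g := fun y : J → ℝ => Complex.exp ((∑ i, (c (Sum.inr i) : ℂ) * (y i : ℂ)) * Complex.I))]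
  have e1 := h.2 (fun i => c (Sum.inl i))
  have e2 := h'.2 (fun i => c (Sum.inr i))
  push_cast at e1 e2
  rw [e1, e2, ← Complex.exp_add]
  unfold QF
  simp only [sum_sum_type, Sum.elim_inl, Sum.elim_inr, mul_zero, Finset.sum_const_zero]
  push_cast
  grind

lemma GF.pi {I : Type*} [Fintype I] (v : ℝ≥0) :
    GF (Measure.pi (fun _ : I => gaussianReal 0 v)) (fun i j => if i = j then (v : ℝ) else 0) := by
  refine ⟨inferInstance, fun c => ?_⟩
  push_cast
  simp_rw [sum_mul, exp_sum]
  rw [integral_fintype_prod_eq_prod (𝕜 := ℂ) (μ := fun _ : I => gaussianReal 0 v)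
    (fun i (x : ℝ) => Complex.exp ((c i : ℂ) * (x : ℂ) * Complex.I))]
  have : ∀ i, ∫ x : ℝ, Complex.exp ((c i : ℂ) * (x : ℂ) * Complex.I) ∂(gaussianReal 0 v) =
      Complex.exp (-(v * (c i) ^ 2 / 2 : ℝ)) := by
    intro i
    have := charFun_gaussianReal (μ := 0) (v := v) (c i)
    rw [charFun_apply_real] at this
    simp_all
  simp_rw [this]
  rw [← exp_sum]
  unfold QF
  simp
  rw [neg_div, sum_div]
  grind

lemma GF.exists {I : Type*} [Fintype I] (K : I → I → ℝ) (hs : ∀ i j, K i j = K j i)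
    (hp : ∀ c, 0 ≤ QF K c) : ∃ μ : Measure (I → ℝ), GF μ K := by
  have hS : (Matrix.of K).PosSemidef := by
    refine Matrix.PosSemidef.of_dotProduct_mulVec_nonneg ?_ ?_
    · ext i j
      simp [hs i j]
    · intro x
      have := hp x
      simp only [QF, dotProduct, mulVec, mul_sum, of_apply] at *
      refine this.trans_eq ?_
      refine sum_congr rfl fun i _ => sum_congr rfl fun j _ => ?_
      simp
      ring
  refine ⟨(multivariateGaussian 0 (Matrix.of K)).map ofLp,
    isProbabilityMeasure_map (Measurable.aemeasurable (by fun_prop)), fun c => ?_⟩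
  rw [integral_map (Measurable.aemeasurable (by fun_prop)) (Measurable.aestronglyMeasurable (by fun_prop))]
  have := charFun_multivariateGaussian (μ := 0) hS (toLp 2 c)
  rw [charFun_apply] at this
  simp only [PiLp.inner_apply] at this
  simp at this
  push_cast
  rw [this]
  unfold QF
  push_cast
  simp only [dotProduct, mulVec, mul_sum, of_apply]
  push_cast
  grind

lemma GF.nonneg {I : Type*} [Fintype I] {μ : Measure (I → ℝ)} {K : I → I → ℝ} (h : GF μ K)
    (c : I → ℝ) : 0 ≤ QF K c := by
  have := h.1
  have e := h.2 c
  have : ‖Complex.exp (((-(QF K c) / 2 : ℝ) : ℂ))‖ ≤ 1 := by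
    rw [← e]
    refine (norm_integral_le_integral_norm _).trans ?_
    simp_rw [Complex.norm_exp_ofReal_mul_I]
    simp
  rw [Complex.norm_exp, Complex.ofReal_re, exp_le_one_iff] at this
  linarith

lemma GF.marg {I : Type*} [Fintype I] {μ : Measure (I → ℝ)} {K : I → I → ℝ} (h : GF μ K)
    (i : I) : μ.map (fun ω => ω i) = gaussianReal 0 (Real.toNNReal (K i i)) := by
  have := h.1
  have hn : 0 ≤ K i i := by
    have := h.nonneg (fun j => if j = i then 1 else 0)
    simpa [QF] using this
  have := isProbabilityMeasure_map (μ := μ) (f := fun ω : I → ℝ => ω i) (Measurable.aemeasurable (by fun_prop))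
  apply ext_of_charFun
  funext t
  rw [charFun_gaussianReal, charFun_apply_real, integral_map (Measurable.aemeasurable (by fun_prop)) (Measurable.aestronglyMeasurable (by fun_prop))]
  have e := h.2 (fun j => if j = i then t else 0)
  simp [QF] at e
  rw [e]
  congr 1
  rw [Real.coe_toNNReal _ hn]
  simp
  ring

lemma GF.sq {I : Type*} [Fintype I] {μ : Measure (I → ℝ)} {K : I → I → ℝ} (h : GF μ K)
    (i : I) : Integrable (fun ω => ω i ^ 2) μ ∧ ∫ ω, ω i ^ 2 ∂μ = K i i := by
  have hn : 0 ≤ K i i := by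
    have := h.nonneg (fun j => if j = i then 1 else 0)
    simpa [QF] using this
  have hm := h.marg i
  have hL : MemLp (fun x : ℝ => x) 2 (gaussianReal 0 (Real.toNNReal (K i i))) := by
    exact IsGaussian.memLp_two_id
  constructor
  · have : Integrable (fun x : ℝ => x ^ 2) (μ.map (fun ω => ω i)) := by
      rw [hm]; exact hL.integrable_sq
    exact this.comp_measurable (by fun_prop)
  · have e : ∫ ω, ω i ^ 2 ∂μ = ∫ x, x ^ 2 ∂(μ.map (fun ω => ω i)) := by
      rw [integral_map (Measurable.aemeasurable (by fun_prop)) (Measurable.aestronglyMeasurable (by fun_prop))]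
    rw [e, hm]
    have hv := variance_fun_id_gaussianReal (μ := 0) (v := Real.toNNReal (K i i))
    rw [variance_eq_sub hL, integral_id_gaussianReal] at hv
    simp_all

lemma IsGaussianField.fin {I : Type*} {μ : Measure (I → ℝ)} {K : I → I → ℝ}
    (h : IsGaussianField μ K) {J : Type*} [Fintype J] (f : J → I) (hf : Injective f)
    (hp : ∀ c, 0 ≤ QF (fun i j => K (f i) (f j)) c) :
    GF (μ.map (fun ω => ω ∘ f)) (fun i j => K (f i) (f j)) := by
  have := h.1
  have hm : Measurable (fun ω : I → ℝ => ω ∘ f) :=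
    measurable_pi_iff.2 fun j => measurable_pi_apply (f j)
  refine ⟨isProbabilityMeasure_map hm.aemeasurable, fun c => ?_⟩
  rw [integral_map hm.aemeasurable (Measurable.aestronglyMeasurable (by fun_prop))]
  let c' : I →₀ ℝ := Finsupp.embDomain ⟨f, hf⟩ (Finsupp.equivFunOnFinite.symm c)
  have hsum : ∀ g : I → ℝ → ℝ, (∀ i, g i 0 = 0) →
      ∑ i ∈ c'.support, g i (c' i) = ∑ j, g (f j) (c j) := by
    intro g hg
    have := Finsupp.sum_embDomain (v := Finsupp.equivFunOnFinite.symm c) (f := ⟨f, hf⟩) (g := g)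
    rw [show (∑ i ∈ c'.support, g i (c' i)) = c'.sum g from rfl, this]
    rw [Finsupp.sum_fintype]
    · rfl
    grind
  have e := h.2 c'
  have e1 : ∀ ω : I → ℝ, ∑ i ∈ c'.support, c' i * ω i = ∑ j, c j * ω (f j) := by
    intro ω
    exact hsum (fun i x => x * ω i) (by simp)
  have e2 : (∑ i ∈ c'.support, ∑ j ∈ c'.support, c' i * c' j * K i j) =
      QF (fun i j => K (f i) (f j)) c := by
    rw [hsum (fun i x => ∑ j ∈ c'.support, x * c' j * K i j) (by simp)]
    unfold QF
    refine sum_congr rfl fun i _ => ?_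
    exact hsum (fun j y => c i * y * K (f i) j) (by simp)
  rw [e2] at e
  simp_rw [e1] at e
  have e3 := congrArg (fun ν => charFun ν 1) e
  simp only [charFun_gaussianReal] at e3
  rw [charFun_apply_real] at e3
  rw [integral_map (Measurable.aemeasurable (by fun_prop)) (Measurable.aestronglyMeasurable (by fun_prop))] at e3
  simp only [comp]
  rw [Real.coe_toNNReal _ (hp c)] at e3
  simp at e3
  push_cast
  grind

lemma IsGaussianField.nonneg_of_pos {I : Type*} {μ : Measure (I → ℝ)} {K : I → I → ℝ}
    (h : IsGaussianField μ K) (hs : ∀ i j, K i j = K j i) (h0 : ∀ i j, 0 ≤ K i j)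
    {J : Type*} [Fintype J] (f : J → I) (c : J → ℝ) :
    0 ≤ QF (fun i j => K (f i) (f j)) c := by
  have := h.1
  have hlin : ∀ (i j : I) (hij : i ≠ j), μ.map (fun ω => ω i + ω j) =
      gaussianReal 0 (Real.toNNReal (K i i + 2 * K i j + K j j)) := by
    intro i j hij
    have hf : Injective (fun b : Bool => if b then i else j) := by
      intro a b; grind
    have := h.2 (Finsupp.single i 1 + Finsupp.single j 1)
    have hsupp : (Finsupp.single i (1:ℝ) + Finsupp.single j 1).support = {i, j} := by
      ext k
      by_cases h1 : k = i
      · simp_all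
      · by_cases h2 : k = j
        · simp_all
        simp_all
    rw [hsupp] at this
    simp [Finset.sum_pair hij, hij, hij.symm] at this
    grind
  have hone : ∀ i, μ.map (fun ω => ω i) = gaussianReal 0 (Real.toNNReal (K i i)) := by
    intro i
    have := h.2 (Finsupp.single i 1)
    simp_all
  have hmem : ∀ i, MemLp (fun ω : I → ℝ => ω i) 2 μ := by
    intro i
    have hL : MemLp (fun x : ℝ => x) 2 (μ.map (fun ω => ω i)) := by
      rw [hone i]; exact IsGaussian.memLp_two_id
    exact hL.comp_of_map (Measurable.aemeasurable (by fun_prop))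
  have hvar : ∀ (X : (I → ℝ) → ℝ) (v : ℝ) (hX : Measurable X), 0 ≤ v →
      μ.map X = gaussianReal 0 v.toNNReal → ∫ ω, X ω ^ 2 ∂μ = v := by
    intro X v hX hv hm
    have e : ∫ ω, X ω ^ 2 ∂μ = ∫ x, x ^ 2 ∂(μ.map X) := by
      rw [integral_map (Measurable.aemeasurable (by fun_prop)) (Measurable.aestronglyMeasurable (by fun_prop))]
    have hL : MemLp (fun x : ℝ => x) 2 (gaussianReal 0 v.toNNReal) := by
      exact IsGaussian.memLp_two_id
    rw [e, hm]
    have hv := variance_fun_id_gaussianReal (μ := 0) (v := v.toNNReal)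
    rw [variance_eq_sub hL, integral_id_gaussianReal] at hv
    simp_all
  have hint : ∀ i j, Integrable (fun ω : I → ℝ => ω i * ω j) μ := fun i j =>
    (hmem i).integrable_mul (hmem j)
  have hcov : ∀ i j, ∫ ω, ω i * ω j ∂μ = K i j := by
    intro i j
    have hi := hvar _ _ (measurable_pi_apply i) (h0 i i) (hone i)
    have hj := hvar _ _ (measurable_pi_apply j) (h0 j j) (hone j)
    by_cases hij : i = j
    · grind
    · have h2 := hvar (fun ω => ω i + ω j) _ (by fun_prop)
        (by grind) (hlin i j hij)
      have : ∀ ω : I → ℝ, (ω i + ω j) ^ 2 = ω i ^ 2 + 2 * (ω i * ω j) + ω j ^ 2 := by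
        grind
      simp_rw [this] at h2
      have a1 : Integrable (fun ω : I → ℝ => ω i ^ 2) μ := (hmem i).integrable_sq
      have a2 : Integrable (fun ω : I → ℝ => ω j ^ 2) μ := (hmem j).integrable_sq
      have a3 : Integrable (fun ω : I → ℝ => 2 * (ω i * ω j)) μ := (hint i j).const_mul 2
      have a4 : Integrable (fun ω : I → ℝ => ω i ^ 2 + 2 * (ω i * ω j)) μ := a1.add a3
      rw [integral_add a4 a2, integral_add a1 a3, integral_const_mul] at h2
      linarith
  have : QF (fun i j => K (f i) (f j)) c = ∫ ω, (∑ j, c j * ω (f j)) ^ 2 ∂μ := by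
    unfold QF
    simp_rw [pow_two, sum_mul_sum]
    rw [integral_finsetSum]
    · refine sum_congr rfl fun i _ => ?_
      rw [integral_finsetSum]
      · refine sum_congr rfl fun j _ => ?_
        rw [← hcov, ← integral_const_mul]
        grind
      · intro j _
        refine ((hint (f i) (f j)).const_mul (c i * c j)).congr (ae_of_all _ fun ω => ?_)
        grind
    · intro i _
      refine integrable_finsetSum _ fun j _ => ?_
      refine ((hint (f i) (f j)).const_mul (c i * c j)).congr (ae_of_all _ fun ω => ?_)
      grind
  rw [this]
  positivity

end GFF

namespace GFF
set_option linter.all false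

lemma GF.cont {I : Type*} [Fintype I] {μ0 : Measure (I → ℝ)} {K0 : I → I → ℝ} (h0 : GF μ0 K0)
    (E : Set (I → ℝ)) (hE : μ0 (frontier E) = 0) {δ : ℝ} (hδ : 0 < δ) :
    ∃ η > 0, ∀ K : I → I → ℝ, (∀ i j, |K i j - K0 i j| ≤ η) → ∀ μ : Measure (I → ℝ), GF μ K →
      |μ.real E - μ0.real E| ≤ δ := by
  by_contra hcon
  push Not at hcon
  have hcon' : ∀ k : ℕ, ∃ K : I → I → ℝ, (∀ i j, |K i j - K0 i j| ≤ 1 / ((k : ℝ) + 1)) ∧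
      ∃ μ : Measure (I → ℝ), GF μ K ∧ δ < |μ.real E - μ0.real E| := fun k =>
    hcon _ (by positivity)
  choose K hK μ hμ hμE using hcon'
  have hKt : ∀ i j, Tendsto (fun k => K k i j) atTop (nhds (K0 i j)) := by
    intro i j
    rw [tendsto_iff_norm_sub_tendsto_zero]
    exact squeeze_zero (fun k => norm_nonneg _) (fun k => hK k i j)
      tendsto_one_div_add_atTop_nhds_zero_nat
  have hpr : ∀ k, IsProbabilityMeasure (μ k) := fun k => (hμ k).1
  have hpr0 := h0.1
  let ν : ℕ → ProbabilityMeasure (EuclideanSpace ℝ I) := fun k =>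
    ⟨(μ k).map (toLp 2), isProbabilityMeasure_map (by fun_prop)⟩
  let ν0 : ProbabilityMeasure (EuclideanSpace ℝ I) :=
    ⟨μ0.map (toLp 2), isProbabilityMeasure_map (by fun_prop)⟩
  have ht : Tendsto ν atTop (nhds ν0) := by
    rw [ProbabilityMeasure.tendsto_iff_tendsto_charFun]
    intro t
    change Tendsto (fun n => MeasureTheory.charFun ((μ n).map (toLp 2)) t) atTop
      (nhds (MeasureTheory.charFun (μ0.map (toLp 2)) t))
    simp_rw [(hμ _).charFun, h0.charFun]
    refine (Complex.continuous_exp.tendsto _).comp ((Complex.continuous_ofReal.tendsto _).comp ?_)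
    refine Tendsto.div_const (Tendsto.neg ?_) 2
    unfold QF
    refine tendsto_finset_sum _ fun i _ => tendsto_finset_sum _ fun j _ => ?_
    exact (hKt i j).const_mul _
  have hof : Continuous (ofLp (p := 2) (V := I → ℝ)) := by fun_prop
  have hid : (ofLp (p := 2) (V := I → ℝ)) ∘ (toLp 2) = id := rfl
  have hEE := ProbabilityMeasure.tendsto_measure_of_null_frontier_of_tendsto'
    (ProbabilityMeasure.tendsto_map_of_tendsto_of_continuous ν ν0 ht hof) (E := E) ?_
  · have e1 : ∀ k, (ν k).toMeasure.map (ofLp (p := 2) (V := I → ℝ)) = μ k := by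
      intro k
      change ((μ k).map (toLp 2)).map _ = _
      rw [Measure.map_map (by fun_prop) (by fun_prop), hid, Measure.map_id]
    have e2 : ν0.toMeasure.map (ofLp (p := 2) (V := I → ℝ)) = μ0 := by
      change ((μ0).map (toLp 2)).map _ = _
      rw [Measure.map_map (by fun_prop) (by fun_prop), hid, Measure.map_id]
    simp only [ProbabilityMeasure.toMeasure_map, e1, e2] at hEE
    have := (ENNReal.tendsto_toReal (measure_ne_top μ0 E)).comp hEE
    have h3 := (tendsto_iff_norm_sub_tendsto_zero.1 this).eventually (gt_mem_nhds hδ)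
    obtain ⟨k, hk⟩ := h3.exists
    exact absurd hk (not_lt.2 (hμE k).le)
  · rw [ProbabilityMeasure.toMeasure_map]
    change ((μ0.map (toLp 2)).map _) _ = _
    rw [Measure.map_map (by fun_prop) (by fun_prop), hid, Measure.map_id]
    exact hE

lemma frontier_thr {I : Type*} [Fintype I] (h : ℝ) (P : Set I → Prop) :
    frontier {ω : I → ℝ | P {i | h ≤ ω i}} ⊆ ⋃ i, {ω | ω i = h} := by
  intro ω hω
  by_contra hc
  simp only [mem_iUnion, mem_setOf_eq, not_exists] at hc
  have hev : ∀ᶠ ω' in nhds ω, {i | h ≤ ω' i} = {i | h ≤ ω i} := by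
    have : ∀ i, ∀ᶠ ω' in nhds ω, (h ≤ ω' i ↔ h ≤ ω i) := by
      intro i
      have hcont : Continuous (fun ω' : I → ℝ => ω' i) := continuous_apply i
      rcases lt_or_gt_of_ne (hc i) with h1 | h1
      · filter_upwards [hcont.tendsto ω (gt_mem_nhds h1)] with ω' hω'
        grind
      · filter_upwards [hcont.tendsto ω (lt_mem_nhds h1)] with ω' hω'
        grind
    filter_upwards [eventually_all.2 this] with ω' hω'
    grind
  rw [frontier_eq_closure_inter_closure] at hω
  obtain ⟨h1, h2⟩ := hω
  rw [mem_closure_iff_frequently] at h1 h2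
  obtain ⟨a, ha, ha'⟩ := (h1.and_eventually hev).exists
  obtain ⟨b, hb, hb'⟩ := (h2.and_eventually hev).exists
  grind

lemma GF.noatom {I : Type*} [Fintype I] {μ0 : Measure (I → ℝ)} {K0 : I → I → ℝ} (h0 : GF μ0 K0)
    (i : I) (hp : 0 < K0 i i) (h : ℝ) : μ0 {ω | ω i = h} = 0 := by
  have : {ω : I → ℝ | ω i = h} = (fun ω => ω i) ⁻¹' {h} := rfl
  rw [this, ← map_apply (by fun_prop) (measurableSet_singleton h), h0.marg i]
  have : NullSingletonClass (gaussianReal 0 (K0 i i).toNNReal) :=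
    noAtoms_gaussianReal (by simp_all)
  simp_all

lemma GF.contThr {I : Type*} [Fintype I] {μ0 : Measure (I → ℝ)} {K0 : I → I → ℝ} (h0 : GF μ0 K0)
    (hp : ∀ i, 0 < K0 i i) (h : ℝ) (P : Set I → Prop) {δ : ℝ} (hδ : 0 < δ) :
    ∃ η > 0, ∀ K : I → I → ℝ, (∀ i j, |K i j - K0 i j| ≤ η) → ∀ μ : Measure (I → ℝ), GF μ K →
      |μ.real {ω | P {i | h ≤ ω i}} - μ0.real {ω | P {i | h ≤ ω i}}| ≤ δ := by
  refine h0.cont _ ?_ hδ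
  refine measure_mono_null (frontier_thr h P) ?_
  rw [measure_iUnion_null_iff]
  exact fun i => h0.noatom i (hp i) h

lemma measurableSet_thr {I : Type*} [Fintype I] (h : ℝ) (P : Set I → Prop) :
    MeasurableSet {ω : I → ℝ | P {i | h ≤ ω i}} := by
  have : {ω : I → ℝ | P {i | h ≤ ω i}} =
      ⋃ S : {S : Set I // P S}, ⋂ i, {ω : I → ℝ | (h ≤ ω i ↔ i ∈ S.1)} := by
    ext ω
    simp only [mem_setOf_eq, mem_iUnion, mem_iInter]
    constructor
    · intro hP; exact ⟨⟨_, hP⟩, fun i => Iff.rfl⟩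
    simp_all
  rw [this]
  refine MeasurableSet.iUnion fun S => MeasurableSet.iInter fun i => ?_
  have hm : MeasurableSet {ω : I → ℝ | h ≤ ω i} :=
    measurableSet_le measurable_const (measurable_pi_apply i)
  by_cases hi : i ∈ S.1
  · grind
  · have : {ω : I → ℝ | (h ≤ ω i ↔ i ∈ S.1)} = {ω : I → ℝ | h ≤ ω i}ᶜ := by
      ext ω; simp [hi]
    simp_all

end GFF

namespace GFF
set_option linter.all false

structure GH {V : Type} [Fintype V] (G : SimpleGraph V) (d : ℕ) (β : ℝ) : Prop where
  hd : 3 ≤ d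
  conn : G.Connected
  reg : IsReg G d
  gap : SpectralGapLB G d β
  b0 : 0 < β
  b2 : β ≤ 2

section
variable {V : Type} [Fintype V] {G : SimpleGraph V} {d : ℕ} {β : ℝ}

lemma transP_symm (x y : V) : transP G d x y = transP G d y x := by
  simp [transP, G.adj_comm]

lemma transP_nonneg (x y : V) : 0 ≤ transP G d x y := by
  simp only [transP, of_apply]
  split_ifs <;> positivity

lemma GH.row (h : GH G d β) (x : V) : ∑ y, transP G d x y = 1 := by
  simp only [transP, of_apply]
  rw [← sum_filter, sum_const, nsmul_eq_mul]
  have : ((Finset.univ.filter fun y => G.Adj x y).card) = d := by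
    rw [← h.reg x, Nat.card_eq_fintype_card, ← Set.toFinset_card]
    congr 1
    ext y; simp
  rw [this]
  have := h.hd
  have : (d : ℝ) ≠ 0 := by positivity
  field_simp

lemma GH.quad (h : GH G d β) (f : V → ℝ) (s : ℝ) (hs : s ^ 2 = 1) :
    ∑ x, ∑ y, transP G d x y * (f x + s * f y) ^ 2 =
      2 * ∑ x, f x ^ 2 + 2 * s * ∑ x, f x * ∑ y, transP G d x y * f y := by
  have e : ∀ x y, transP G d x y * (f x + s * f y) ^ 2 =
      transP G d x y * f x ^ 2 + transP G d x y * f y ^ 2 +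
        2 * s * (f x * (transP G d x y * f y)) := by
    intro x y
    linear_combination transP G d x y * f y ^ 2 * hs
  simp_rw [e, sum_add_distrib]
  have e1 : ∑ x, ∑ y, transP G d x y * f x ^ 2 = ∑ x, f x ^ 2 := by
    simp_rw [← sum_mul, h.row, one_mul]
  have e2 : ∑ x, ∑ y, transP G d x y * f y ^ 2 = ∑ x, f x ^ 2 := by
    rw [sum_comm]
    simp_rw [← sum_mul]
    refine sum_congr rfl fun y _ => ?_
    rw [show ∑ i, transP G d i y = 1 by
      rw [← h.row y]; exact sum_congr rfl fun _ _ => transP_symm _ _, one_mul]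
  rw [e1, e2]
  simp_rw [← mul_sum]
  ring

structure Spec (G : SimpleGraph V) (d : ℕ) (β : ℝ) (lam : V → ℝ) (v : V → V → ℝ) : Prop where
  orth : ∀ i j, ∑ x, v i x * v j x = if i = j then 1 else 0
  compl : ∀ x y, ∑ i, v i x * v i y = if x = y then 1 else 0
  rep : ∀ x y, transP G d x y = ∑ i, lam i * (v i x * v i y)
  gap : ∀ i, lam i = 1 ∨ lam i ≤ 1 - β
  lo : ∀ i, -1 ≤ lam i
  one : ∀ x y, ∑ i, (if lam i = 1 then 1 else 0) * (v i x * v i y) = 1 / (Fintype.card V : ℝ)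

lemma GH.spec (h : GH G d β) : ∃ lam v, Spec G d β lam v := by
  have hH : (transP G d).IsHermitian := by
    ext x y; simp [transP_symm]
  let lam := hH.eigenvalues
  let b := hH.eigenvectorBasis
  let v : V → V → ℝ := fun i x => b i x
  have horth : ∀ i j, ∑ x, v i x * v j x = if i = j then 1 else 0 := by
    intro i j
    have := orthonormal_iff_ite.1 b.orthonormal i j
    rw [PiLp.inner_apply] at this
    rw [← this]
    refine sum_congr rfl fun x _ => ?_
    simp [v]; ring
  have hcompl : ∀ x y, ∑ i, v i x * v i y = if x = y then 1 else 0 := by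
    intro x y
    have := b.sum_inner_mul_inner (EuclideanSpace.single x (1:ℝ)) (EuclideanSpace.single y (1:ℝ))
    simpa [v, EuclideanSpace.inner_single_left, EuclideanSpace.inner_single_right, eq_comm] using this
  have hev : ∀ i x, ∑ y, transP G d x y * v i y = lam i * v i x := by
    intro i x
    have := congrFun (hH.mulVec_eigenvectorBasis i) x
    simpa [mulVec, dotProduct] using this
  have hrep : ∀ x y, transP G d x y = ∑ i, lam i * (v i x * v i y) := by
    intro x y
    simp_rw [← mul_assoc, ← hev, sum_mul]
    rw [sum_comm]
    simp_rw [mul_assoc, ← mul_sum, hcompl]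
    simp
  have hne : ∀ i, v i ≠ 0 := by
    intro i h0
    have := horth i i
    simp [h0] at this
  have hq : ∀ i, ∑ x, v i x * ∑ y, transP G d x y * v i y = lam i := by
    intro i
    simp_rw [hev]
    have := horth i i
    simp only [if_true] at this
    calc _ = lam i * ∑ x, v i x * v i x := by
            rw [mul_sum]; exact sum_congr rfl fun _ _ => by ring
      _ = _ := by rw [this, mul_one]
  have hsq : ∀ i, ∑ x, v i x ^ 2 = 1 := by
    intro i; have := horth i i; simp only [if_true] at this; simp_rw [pow_two]; exact this
  have hconst : ∀ i, lam i = 1 → ∀ x y, v i x = v i y := by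
    intro i hi
    have hz := h.quad (v i) (-1) (by norm_num)
    rw [hq, hsq, hi] at hz
    have hz0 : ∑ x, ∑ y, transP G d x y * (v i x + -1 * v i y) ^ 2 = 0 := by rw [hz]; norm_num
    have hadj : ∀ x y, G.Adj x y → v i x = v i y := by
      intro x y hxy
      rw [sum_eq_zero_iff_of_nonneg (fun x _ => sum_nonneg fun y _ =>
        mul_nonneg (transP_nonneg x y) (sq_nonneg _))] at hz0
      have h1 := hz0 x (Finset.mem_univ _)
      rw [sum_eq_zero_iff_of_nonneg (fun y _ =>
        mul_nonneg (transP_nonneg x y) (sq_nonneg _))] at h1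
      have h2 := h1 y (Finset.mem_univ _)
      have hd := h.hd
      have : transP G d x y ≠ 0 := by
        simp [transP, hxy]; omega
      have := (mul_eq_zero.1 h2).resolve_left this
      have := pow_eq_zero_iff (two_ne_zero) |>.1 this
      linarith
    intro x y
    obtain ⟨p⟩ := h.conn.preconnected x y
    induction p with
    | nil => rfl
    | cons hxy p ih => exact (hadj _ _ hxy).trans ih
  have hzero : ∀ i, lam i ≠ 1 → ∑ x, v i x = 0 := by
    intro i hi
    have : lam i * ∑ x, v i x = ∑ x, v i x := by
      rw [mul_sum]
      simp_rw [← hev]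
      rw [sum_comm]
      refine sum_congr rfl fun y _ => ?_
      rw [← sum_mul, show ∑ i, transP G d i y = 1 by
        rw [← h.row y]; exact sum_congr rfl fun _ _ => transP_symm _ _, one_mul]
    have : (lam i - 1) * ∑ x, v i x = 0 := by linarith
    exact (mul_eq_zero.1 this).resolve_left (sub_ne_zero.2 hi)
  refine ⟨lam, v, horth, hcompl, hrep, ?_, ?_, ?_⟩
  · intro i
    have := h.gap (v i) (1 - lam i) ?_ (hne i)
    · rcases this with h1 | h1
      · left; linarith
      · right; linarith
    · ext x
      rw [Matrix.sub_mulVec]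
      have := hev i x
      simp [mulVec, dotProduct] at this ⊢
      rw [this]; ring
  · intro i
    have hz := h.quad (v i) 1 (by norm_num)
    rw [hq, hsq] at hz
    have : 0 ≤ ∑ x, ∑ y, transP G d x y * (v i x + 1 * v i y) ^ 2 :=
      sum_nonneg fun x _ => sum_nonneg fun y _ =>
        mul_nonneg (transP_nonneg x y) (sq_nonneg _)
    linarith
  · intro x y
    have hne : Nonempty V := ⟨x⟩
    have h1 : ∑ i, (∑ z, v i z) * v i x = 1 := by
      simp_rw [sum_mul]
      rw [sum_comm]
      simp_rw [hcompl]
      simp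
    have h2 : ∀ i, (∑ z, v i z) * v i x = (Fintype.card V : ℝ) *
        ((if lam i = 1 then 1 else 0) * (v i x * v i y)) := by
      intro i
      by_cases hi : lam i = 1
      · have : ∑ z, v i z = (Fintype.card V : ℝ) * v i y := by
          rw [sum_congr rfl fun z _ => hconst i hi z y]
          simp
        rw [this, if_pos hi]; ring
      · rw [hzero i hi, if_neg hi]; ring
    simp_rw [h2, ← mul_sum] at h1
    have : (Fintype.card V : ℝ) ≠ 0 := by positivity
    rw [eq_div_iff this, mul_comm]; exact h1

noncomputable def MF (lam : V → ℝ) (v : V → V → ℝ) (F : ℝ → ℝ) (x y : V) : ℝ :=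
  ∑ i, F (lam i) * (v i x * v i y)

variable {lam : V → ℝ} {v : V → V → ℝ}

lemma MF_symm (F : ℝ → ℝ) (x y : V) : MF lam v F x y = MF lam v F y x := by
  unfold MF; exact sum_congr rfl fun _ _ => by ring

lemma Spec.mul (s : Spec G d β lam v) (F H : ℝ → ℝ) (x y : V) :
    ∑ z, MF lam v F x z * MF lam v H z y = MF lam v (fun t => F t * H t) x y := by
  unfold MF
  simp_rw [sum_mul_sum]
  rw [sum_comm]
  refine sum_congr rfl fun i _ => ?_
  rw [sum_comm]
  have : ∀ j, ∑ z, F (lam i) * (v i x * v i z) * (H (lam j) * (v j z * v j y)) =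
      if i = j then F (lam i) * v i x * (H (lam j) * v j y) else 0 := by
    intro j
    calc _ = F (lam i) * v i x * (H (lam j) * v j y) * ∑ z, v i z * v j z := by
            rw [mul_sum]; exact sum_congr rfl fun _ _ => by ring
      _ = _ := by rw [s.orth]; split_ifs <;> simp
  simp_rw [this]
  simp
  ring

lemma Spec.sub (F H : ℝ → ℝ) (x y : V) :
    MF lam v F x y - MF lam v H x y = MF lam v (fun t => F t - H t) x y := by
  unfold MF
  rw [← sum_sub_distrib]
  exact sum_congr rfl fun _ _ => by ring

lemma MF_congr {F H : ℝ → ℝ} (h : ∀ i, F (lam i) = H (lam i)) (x y : V) :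
    MF lam v F x y = MF lam v H x y := by
  unfold MF
  exact sum_congr rfl fun i _ => by rw [h]

lemma MF_quad (F : ℝ → ℝ) (c : V → ℝ) :
    QF (MF lam v F) c = ∑ i, F (lam i) * (∑ x, c x * v i x) ^ 2 := by
  unfold QF MF
  simp_rw [mul_sum]
  rw [sum_congr rfl fun x _ => sum_comm]
  rw [sum_comm]
  refine sum_congr rfl fun i _ => ?_
  rw [pow_two, sum_mul_sum, mul_sum]
  refine sum_congr rfl fun x _ => ?_
  rw [mul_sum]
  exact sum_congr rfl fun _ _ => by ring

lemma MF_bil (F : ℝ → ℝ) (a b : V → ℝ) :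
    ∑ x, ∑ y, a x * b y * MF lam v F x y =
      ∑ i, F (lam i) * ((∑ x, a x * v i x) * (∑ x, b x * v i x)) := by
  unfold MF
  simp_rw [mul_sum]
  rw [sum_congr rfl fun x _ => sum_comm]
  rw [sum_comm]
  refine sum_congr rfl fun i _ => ?_
  simp_rw [← mul_sum]
  rw [sum_mul_sum, mul_sum]
  refine sum_congr rfl fun x _ => ?_
  rw [mul_sum]
  exact sum_congr rfl fun _ _ => by ring

lemma Spec.parseval (s : Spec G d β lam v) (a : V → ℝ) :
    ∑ i, (∑ x, a x * v i x) ^ 2 = ∑ x, a x ^ 2 := by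
  have := MF_quad (lam := lam) (v := v) (fun _ => 1) a
  simp only [one_mul] at this
  rw [← this]
  unfold QF MF
  simp_rw [one_mul, s.compl]
  simp [pow_two]

lemma Spec.bil_le (s : Spec G d β lam v) {F : ℝ → ℝ} {C : ℝ} (hF : ∀ i, |F (lam i)| ≤ C)
    (a b : V → ℝ) :
    |∑ x, ∑ y, a x * b y * MF lam v F x y| ≤ C * ((∑ x, a x ^ 2 + ∑ x, b x ^ 2) / 2) := by
  rw [MF_bil]
  refine (abs_sum_le_sum_abs _ _).trans ?_
  rw [← s.parseval a, ← s.parseval b, ← sum_add_distrib, sum_div, mul_sum]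
  refine sum_le_sum fun i _ => ?_
  rw [abs_mul]
  have hC : 0 ≤ C := (abs_nonneg _).trans (hF i)
  refine mul_le_mul (hF i) ?_ (abs_nonneg _) hC
  rw [abs_mul]
  have h1 := sq_nonneg (|∑ x, a x * v i x| - |∑ x, b x * v i x|)
  have h2 := sq_abs (∑ x, a x * v i x)
  have h3 := sq_abs (∑ x, b x * v i x)
  nlinarith

lemma Spec.entry_le (s : Spec G d β lam v) {F : ℝ → ℝ} {C : ℝ} (hF : ∀ i, |F (lam i)| ≤ C)
    (x y : V) : |MF lam v F x y| ≤ C := by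
  have := s.bil_le hF (fun z => if z = x then 1 else 0) (fun z => if z = y then 1 else 0)
  simpa using this

lemma Spec.id_eq (s : Spec G d β lam v) (x y : V) :
    MF lam v (fun _ => 1) x y = if x = y then 1 else 0 := by
  unfold MF; simp_rw [one_mul]; exact s.compl x y

lemma Spec.J_eq (s : Spec G d β lam v) (x y : V) :
    MF lam v (fun t => if t = 1 then 1 else 0) x y = 1 / (Fintype.card V : ℝ) := s.one x y

lemma Spec.pow (s : Spec G d β lam v) (k : ℕ) (x y : V) :
    ((transP G d) ^ k) x y = MF lam v (fun t => t ^ k) x y := by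
  induction k generalizing x y with
  | zero =>
    simp only [pow_zero]
    rw [s.id_eq, Matrix.one_apply]
  | succ k ih =>
    rw [pow_succ, Matrix.mul_apply]
    simp_rw [ih, s.rep]
    exact s.mul (fun t => t ^ k) (fun t => t) x y

lemma Spec.heat (s : Spec G d β lam v) (t : ℝ) (x y : V) :
    heatK G d t x y = MF lam v (fun l => Real.exp (-(1 - l) * t)) x y := by
  unfold heatK
  simp_rw [s.pow]
  unfold MF
  have : ∀ i, HasSum (fun k : ℕ => Real.exp (-t) * t ^ k / (Nat.factorial k) *
      (lam i ^ k * (v i x * v i y))) (Real.exp (-(1 - lam i) * t) * (v i x * v i y)) := by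
    intro i
    have h1 := NormedSpace.expSeries_div_hasSum_exp (𝔸 := ℝ) (lam i * t)
    rw [← Real.exp_eq_exp_ℝ] at h1
    have h2 := h1.mul_left (Real.exp (-t) * (v i x * v i y))
    have e1 : (fun k : ℕ => Real.exp (-t) * t ^ k / (Nat.factorial k) *
      (lam i ^ k * (v i x * v i y))) = fun k : ℕ => Real.exp (-t) * (v i x * v i y) *
        ((lam i * t) ^ k / (Nat.factorial k)) := by
      funext k; rw [mul_pow]; ring
    have e2 : Real.exp (-(1 - lam i) * t) * (v i x * v i y) =
        Real.exp (-t) * (v i x * v i y) * Real.exp (lam i * t) := by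
      rw [show -(1 - lam i) * t = -t + lam i * t by ring, Real.exp_add]; ring
    rw [e1, e2]; exact h2
  simp_rw [mul_sum]
  exact (hasSum_sum fun i _ => this i).tsum_eq

noncomputable def gF (l : ℝ) : ℝ := if l = 1 then 0 else 1 / (1 - l)

lemma Spec.green (s : Spec G d β lam v) (hb : 0 < β) (x y : V) :
    zGreen G d (Fintype.card V) x y = MF lam v gF x y := by
  unfold zGreen
  simp_rw [s.heat, ← s.J_eq x y, Spec.sub]
  unfold MF
  rw [integral_finsetSum]
  · refine sum_congr rfl fun i _ => ?_
    rw [integral_mul_const]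
    congr 1
    unfold gF
    split_ifs with hi
    · simp [hi]
    · have hlt : -(1 - lam i) < 0 := by
        rcases s.gap i with h1 | h1
        · exact absurd h1 hi
        · linarith
      simp only [hi, if_false, sub_zero]
      rw [integral_exp_mul_Ioi hlt]
      simp
      rw [← neg_sub, neg_div_neg_eq, one_div]
  · intro i _
    refine Integrable.mul_const ?_ _
    by_cases hi : lam i = 1
    · simp [hi]
    · have hlt : -(1 - lam i) < 0 := by
        rcases s.gap i with h1 | h1
        · exact absurd h1 hi
        · linarith
      simp only [hi, if_false, sub_zero]
      exact integrableOn_exp_mul_Ioi hlt 0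

end
end GFF

namespace GFF
set_option linter.all false

section
variable {V : Type} [Fintype V] {G : SimpleGraph V} {d : ℕ} {β : ℝ}

noncomputable abbrev zG (G : SimpleGraph V) (d : ℕ) (x y : V) : ℝ := zGreen G d (Fintype.card V) x y

noncomputable def lazyP (G : SimpleGraph V) (d : ℕ) : Matrix V V ℝ :=
  (2⁻¹ : ℝ) • (1 + transP G d)

variable {lam : V → ℝ} {v : V → V → ℝ}

lemma Spec.mu_bd (s : Spec G d β lam v) (hb : 0 < β) (hb2 : β ≤ 2) (i : V) (hi : lam i ≠ 1) :
    0 ≤ (1 + lam i) / 2 ∧ (1 + lam i) / 2 ≤ 1 - β / 2 := by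
  have := s.lo i
  rcases s.gap i with h1 | h1
  · grind
  grind

lemma GH.green_harm (h : GH G d β) (x y : V) :
    zG G d x y - ∑ z, transP G d x z * zG G d z y =
      (if x = y then 1 else 0) - 1 / (Fintype.card V : ℝ) := by
  obtain ⟨lam, v, s⟩ := h.spec
  unfold zG
  simp_rw [s.green h.b0]
  have : ∀ x z, transP G d x z = MF lam v (fun t => t) x z := s.rep
  simp_rw [this]
  rw [s.mul, Spec.sub, ← s.id_eq, ← s.J_eq x y, Spec.sub]
  refine MF_congr (fun i => ?_) x y
  unfold gF
  grind

lemma GH.green_symm (h : GH G d β) (x y : V) : zG G d x y = zG G d y x := by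
  obtain ⟨lam, v, s⟩ := h.spec
  unfold zG
  rw [s.green h.b0, s.green h.b0, MF_symm]

lemma Spec.gF_bd (s : Spec G d β lam v) (hb : 0 < β) (i : V) :
    0 ≤ gF (lam i) ∧ gF (lam i) ≤ 1 / β := by
  unfold gF
  split_ifs with hi
  · constructor
    · exact le_rfl
    · positivity
  · rcases s.gap i with h1 | h1
    · grind
    · constructor
      · apply div_nonneg <;> linarith
      · apply one_div_le_one_div_of_le hb; linarith

lemma GH.green_abs (h : GH G d β) (x y : V) : |zG G d x y| ≤ 1 / β := by
  obtain ⟨lam, v, s⟩ := h.spec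
  unfold zG
  rw [s.green h.b0]
  refine s.entry_le (fun i => ?_) x y
  rw [abs_of_nonneg (s.gF_bd h.b0 i).1]
  exact (s.gF_bd h.b0 i).2

lemma GH.green_psd (h : GH G d β) (c : V → ℝ) : 0 ≤ QF (zG G d) c := by
  obtain ⟨lam, v, s⟩ := h.spec
  have : zG G d = MF lam v gF := by
    funext x y; exact s.green h.b0 x y
  rw [this, MF_quad]
  exact sum_nonneg fun i _ => mul_nonneg (s.gF_bd h.b0 i).1 (sq_nonneg _)

lemma GH.green_sub_psd (h : GH G d β) (c : V → ℝ) :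
    0 ≤ QF (fun x y => zG G d x y - 1 / 4 * ((if x = y then 1 else 0) -
      1 / (Fintype.card V : ℝ))) c := by
  obtain ⟨lam, v, s⟩ := h.spec
  have : (fun x y => zG G d x y - 1 / 4 * ((if x = y then 1 else 0) -
      1 / (Fintype.card V : ℝ))) =
      MF lam v (fun t => gF t - 1 / 4 * (1 - if t = 1 then 1 else 0)) := by
    funext x y
    unfold zG
    rw [s.green h.b0, ← s.id_eq, ← s.J_eq x y, Spec.sub]
    unfold MF
    rw [mul_sum, ← sum_sub_distrib]
    grind
  rw [this, MF_quad]
  refine sum_nonneg fun i _ => mul_nonneg ?_ (sq_nonneg _)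
  unfold gF
  split_ifs with hi
  · norm_num
  · have h1 := s.lo i
    have h2 : 0 < 1 - lam i := by
      rcases s.gap i with h1 | h1
      · grind
      · have := h.b0; linarith
    have : 1 / 2 ≤ 1 / (1 - lam i) := one_div_le_one_div_of_le h2 (by linarith)
    linarith

lemma lazy_apply (x y : V) : lazyP G d x y =
    ((if x = y then 1 else 0) + transP G d x y) / 2 := by
  simp [lazyP, Matrix.one_apply]; ring

lemma lazy_nonneg (k : ℕ) (x y : V) : 0 ≤ (lazyP G d ^ k) x y := by
  induction k generalizing x y with
  | zero => simp [Matrix.one_apply]; grind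
  | succ k ih =>
    rw [pow_succ, Matrix.mul_apply]
    refine sum_nonneg fun z _ => mul_nonneg (ih x z) ?_
    rw [lazy_apply]
    have := transP_nonneg (G := G) (d := d) z y
    grind

lemma Spec.lazy (s : Spec G d β lam v) (k : ℕ) (x y : V) :
    (lazyP G d ^ k) x y = MF lam v (fun t => ((1 + t) / 2) ^ k) x y := by
  induction k generalizing x y with
  | zero =>
    simp only [pow_zero]
    rw [s.id_eq, Matrix.one_apply]
  | succ k ih =>
    rw [pow_succ, Matrix.mul_apply]
    have : ∀ z y, lazyP G d z y = MF lam v (fun t => (1 + t) / 2) z y := by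
      intro z y
      rw [lazy_apply, s.rep, ← s.compl]
      unfold MF
      rw [← sum_add_distrib, sum_div]
      grind
    simp_rw [ih, this]
    rw [s.mul]
    rfl

lemma GH.lazy_symm (h : GH G d β) (k : ℕ) (x y : V) :
    (lazyP G d ^ k) x y = (lazyP G d ^ k) y x := by
  obtain ⟨lam, v, s⟩ := h.spec
  rw [s.lazy, s.lazy, MF_symm]

lemma GH.lazy_row (h : GH G d β) (k : ℕ) (x : V) : ∑ y, (lazyP G d ^ k) x y = 1 := by
  induction k generalizing x with
  | zero => simp [Matrix.one_apply]
  | succ k ih =>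
    simp_rw [pow_succ, Matrix.mul_apply]
    rw [sum_comm]
    have : ∀ z, ∑ y, (lazyP G d ^ k) x z * lazyP G d z y = (lazyP G d ^ k) x z := by
      intro z
      rw [← mul_sum]
      simp_rw [lazy_apply]
      rw [← sum_div, sum_add_distrib, h.row]
      simp
    simp_rw [this]
    exact ih x

lemma lazy_far (hc : G.Connected) (k : ℕ) (x y : V) (hk : k < G.dist x y) :
    (lazyP G d ^ k) x y = 0 := by
  induction k generalizing y with
  | zero =>
    have : x ≠ y := by grind
    simp [Matrix.one_apply, this]
  | succ k ih =>
    rw [pow_succ, Matrix.mul_apply]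
    refine sum_eq_zero fun z _ => ?_
    by_cases hz : k < G.dist x z
    · grind
    · have h1 : z ≠ y := by grind
      have h2 : ¬ G.Adj z y := by
        intro hadj
        have := hc.dist_triangle (u := x) (v := z) (w := y)
        rw [dist_eq_one_iff_adj.2 hadj] at this
        omega
      rw [lazy_apply]
      simp [h1, transP, h2]

lemma GH.lazy_sub (h : GH G d β) (s : Spec G d β lam v) (k : ℕ) (x y : V) :
    (lazyP G d ^ k) x y - 1 / (Fintype.card V : ℝ) =
      MF lam v (fun t => if t = 1 then 0 else ((1 + t) / 2) ^ k) x y := by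
  rw [s.lazy, ← s.J_eq x y, Spec.sub]
  refine MF_congr (fun i => ?_) x y
  split_ifs with hi
  · simp [hi]
  · simp

lemma GH.mult_bd (h : GH G d β) (s : Spec G d β lam v) (k : ℕ) (i : V) :
    |(if lam i = 1 then (0:ℝ) else ((1 + lam i) / 2) ^ k)| ≤ (1 - β / 2) ^ k := by
  have := h.b2
  have h0 : 0 ≤ 1 - β / 2 := by linarith
  split_ifs with hi
  · simp; positivity
  · have := s.mu_bd h.b0 h.b2 i hi
    rw [abs_of_nonneg (pow_nonneg this.1 k)]
    exact pow_le_pow_left₀ this.1 this.2 k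

lemma GH.lazy_le (h : GH G d β) (k : ℕ) (x y : V) :
    (lazyP G d ^ k) x y ≤ 1 / (Fintype.card V : ℝ) + (1 - β / 2) ^ k := by
  obtain ⟨lam, v, s⟩ := h.spec
  have h1 := s.entry_le (F := fun t => if t = 1 then 0 else ((1 + t) / 2) ^ k)
    (h.mult_bd s k) x y
  rw [← h.lazy_sub s] at h1
  grind

lemma GH.mix (h : GH G d β) (k : ℕ) (A B : Finset V) :
    (A.card : ℝ) * B.card / (Fintype.card V : ℝ) - (1 - β / 2) ^ k * (Fintype.card V : ℝ) ≤
      ∑ x ∈ A, ∑ y ∈ B, (lazyP G d ^ k) x y := by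
  obtain ⟨lam, v, s⟩ := h.spec
  have h1 := s.bil_le (F := fun t => if t = 1 then 0 else ((1 + t) / 2) ^ k)
    (h.mult_bd s k) (fun x => if x ∈ A then 1 else 0) (fun x => if x ∈ B then 1 else 0)
  simp_rw [← h.lazy_sub s] at h1
  have e : ∑ x, ∑ y, (if x ∈ A then (1:ℝ) else 0) * (if y ∈ B then (1:ℝ) else 0) *
      ((lazyP G d ^ k) x y - 1 / (Fintype.card V : ℝ)) =
      ∑ x ∈ A, ∑ y ∈ B, ((lazyP G d ^ k) x y - 1 / (Fintype.card V : ℝ)) := by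
    simp [ite_mul, sum_ite_mem, ← mul_sum]
  rw [e] at h1
  simp_rw [sum_sub_distrib] at h1
  simp only [sum_const, nsmul_eq_mul] at h1
  simp only [ite_pow, one_pow, ne_eq, OfNat.ofNat_ne_zero, not_false_eq_true, zero_pow,
    sum_ite_mem, Finset.univ_inter, sum_const, nsmul_eq_mul, mul_one] at h1
  have hA : (A.card : ℝ) ≤ Fintype.card V := by exact_mod_cast card_le_univ A
  have hB : (B.card : ℝ) ≤ Fintype.card V := by exact_mod_cast card_le_univ B
  have := h.b2
  have h0 : 0 ≤ (1 - β / 2) ^ k := pow_nonneg (by linarith) k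
  have h2 : (1 - β / 2) ^ k * (((A.card : ℝ) + B.card) / 2) ≤
      (1 - β / 2) ^ k * (Fintype.card V : ℝ) :=
    mul_le_mul_of_nonneg_left (by linarith) h0
  grind

lemma GH.green_decay (h : GH G d β) (D : ℕ) (x y : V) (hD : D ≤ G.dist x y) :
    |zG G d x y| ≤ (1 - β / 2) ^ D / β + D / (2 * (Fintype.card V : ℝ)) := by
  obtain ⟨lam, v, s⟩ := h.spec
  have hb := h.b0
  have hb2 := h.b2
  have e : zG G d x y + D / (2 * (Fintype.card V : ℝ)) =
      MF lam v (fun t => if t = 1 then 0 else ((1 + t) / 2) ^ D / (1 - t)) x y := by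
    have e1 : ∀ k ∈ Finset.range D, (lazyP G d ^ k) x y - 1 / (Fintype.card V : ℝ) =
        - (1 / (Fintype.card V : ℝ)) := by
      intro k hk
      rw [lazy_far h.conn k x y (lt_of_lt_of_le (Finset.mem_range.1 hk) hD)]; ring
    have e2 : (D : ℝ) / (2 * (Fintype.card V : ℝ)) =
        - (1 / 2 * ∑ k ∈ Finset.range D, ((lazyP G d ^ k) x y - 1 / (Fintype.card V : ℝ))) := by
      rw [sum_congr rfl e1]
      simp
      ring
    rw [e2]
    simp_rw [h.lazy_sub s]
    unfold zG
    rw [s.green hb]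
    unfold MF
    rw [sum_comm, mul_sum, ← sum_neg_distrib, ← sum_add_distrib]
    refine sum_congr rfl fun i _ => ?_
    rw [← sum_mul]
    unfold gF
    by_cases hi : lam i = 1
    · simp [hi]
    · simp only [hi, if_false]
      have h1 : (1 + lam i) / 2 ≠ 1 := by
        grind
      rw [geom_sum_eq h1]
      grind
  have h1 : |MF lam v (fun t => if t = 1 then 0 else ((1 + t) / 2) ^ D / (1 - t)) x y| ≤
      (1 - β / 2) ^ D / β := by
    refine s.entry_le (fun i => ?_) x y
    have h0 : 0 ≤ 1 - β / 2 := by linarith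
    split_ifs with hi
    · simp; positivity
    · have := s.mu_bd hb hb2 i hi
      have h2 : β ≤ 1 - lam i := by
        grind
      rw [abs_of_nonneg (div_nonneg (pow_nonneg this.1 _) (by linarith))]
      exact div_le_div₀ (by positivity) (pow_le_pow_left₀ this.1 this.2 D) hb h2
  rw [← e] at h1
  have h4 : (0:ℝ) ≤ D / (2 * (Fintype.card V : ℝ)) := by positivity
  grind

end
end GFF

namespace GFF
set_option linter.all false

section
variable {T : Type} {Gt : SimpleGraph T} {d : ℕ} {o obar : T}

lemma exists_pred {V : Type*} {G : SimpleGraph V} (hc : G.Connected) (a z : V) (h : z ≠ a) :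
    ∃ w, G.Adj z w ∧ G.dist a w + 1 = G.dist a z := by
  obtain ⟨p, hp⟩ := hc.exists_walk_length_eq_dist z a
  cases p with
  | nil => grind
  | @cons _ w _ hw q =>
    refine ⟨w, hw, ?_⟩
    have h1 := dist_le q
    simp only [Walk.length_cons] at hp
    have h2 : G.dist z a ≤ G.dist z w + G.dist w a := hc.dist_triangle
    have h3 : G.dist z w = 1 := dist_eq_one_iff_adj.2 hw
    rw [G.dist_comm (u := a) (v := w), G.dist_comm (u := a) (v := z)]
    omega

lemma adj_dist {V : Type*} {G : SimpleGraph V} (hc : G.Connected) {z w : V} (a : V) (h : G.Adj z w) :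
    G.dist a w ≤ G.dist a z + 1 := by
  have h3 : G.dist z w = 1 := dist_eq_one_iff_adj.2 h
  have : G.dist a w ≤ G.dist a z + G.dist z w := hc.dist_triangle
  omega

lemma pred_unique (ht : IsRegTree Gt d) (a : T) {z w w' : T} (h1 : Gt.Adj z w)
    (h1' : Gt.dist a w + 1 = Gt.dist a z) (h2 : Gt.Adj z w')
    (h2' : Gt.dist a w' + 1 = Gt.dist a z) : w = w' := by
  have key : ∀ u, (hu : Gt.Adj z u) → Gt.dist a u + 1 = Gt.dist a z →
      ∃ p : Gt.Walk a u, (p.concat hu.symm).IsPath := by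
    intro u hu hd
    obtain ⟨p, hp, hl⟩ := (ht.1 a u).exists_path_of_dist
    refine ⟨p, hp.concat ?_ _⟩
    intro hz
    have := dist_le (p.takeUntil z hz)
    have := p.length_takeUntil_le hz
    omega
  obtain ⟨p, hp⟩ := key w h1 h1'
  obtain ⟨q, hq⟩ := key w' h2 h2'
  have h := congrArg Subtype.val (ht.2.1.path_unique ⟨_, hp⟩ ⟨_, hq⟩)
  have := congrArg Walk.penultimate h
  simpa using this

lemma tree_adj (ht : IsRegTree Gt d) (a : T) {z w : T} (h : Gt.Adj z w) :
    Gt.dist a z = Gt.dist a w + 1 ∨ Gt.dist a w = Gt.dist a z + 1 :=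
  ht.2.1.dist_eq_dist_add_one_of_adj_of_reachable a h (ht.1 a z)

noncomputable def par (Gt : SimpleGraph T) (o z : T) : T :=
  if h : ∃ w, Gt.Adj z w ∧ Gt.dist o w + 1 = Gt.dist o z then h.choose else z

lemma par_self (Gt : SimpleGraph T) (o : T) : par Gt o o = o := by
  unfold par
  grind

lemma par_spec (ht : IsRegTree Gt d) {z : T} (h : z ≠ o) :
    Gt.Adj z (par Gt o z) ∧ Gt.dist o (par Gt o z) + 1 = Gt.dist o z := by
  have := exists_pred ht.1 o z h
  unfold par
  grind

lemma par_eq (ht : IsRegTree Gt d) {z w : T} (h : Gt.Adj z w) (h' : Gt.dist o w + 1 = Gt.dist o z) :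
    par Gt o z = w := by
  have hz : z ≠ o := by
    grind
  exact pred_unique ht o (par_spec ht hz).1 (par_spec ht hz).2 h h'

lemma dist_o_eq_zero (ht : IsRegTree Gt d) {z : T} : Gt.dist o z = 0 ↔ z = o := by
  rw [(ht.1 o z).dist_eq_zero_iff, eq_comm]

lemma par_depth (ht : IsRegTree Gt d) (z : T) : Gt.dist o (par Gt o z) = Gt.dist o z - 1 := by
  by_cases h : z = o
  · subst h; rw [par_self]; simp
  · have := (par_spec ht h).2; omega

lemma adj_par (ht : IsRegTree Gt d) {z w : T} (h : Gt.Adj z w) :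
    (par Gt o z = w ∧ z ≠ o) ∨ (par Gt o w = z ∧ w ≠ o) := by
  rcases tree_adj ht o h with h1 | h1
  · left
    refine ⟨par_eq ht h h1.symm, ?_⟩
    grind
  · right
    refine ⟨par_eq ht h.symm h1.symm, ?_⟩
    grind

lemma desc_depth (ht : IsRegTree Gt d) {z : T} (hz : z ≠ o) : ∀ (n : ℕ) (w : T), Gt.dist z w = n →
    Gt.dist (par Gt o z) w = Gt.dist z w + 1 → Gt.dist o w = Gt.dist o z + n := by
  intro n
  induction n using Nat.strong_induction_on with
  | _ n ih =>
  intro w hw hp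
  by_cases hwz : w = z
  · grind
  obtain ⟨w', hadj, hd⟩ := exists_pred ht.1 z w hwz
  have hA : ∀ u, Gt.dist (par Gt o z) u ≤ Gt.dist z u + 1 := by
    intro u
    have h1 : Gt.dist (par Gt o z) z = 1 :=
      dist_eq_one_iff_adj.2 (par_spec ht hz).1.symm
    have : Gt.dist (par Gt o z) u ≤ Gt.dist (par Gt o z) z + Gt.dist z u := ht.1.dist_triangle
    omega
  have h1 := hA w'
  have h2 := adj_dist ht.1 (par Gt o z) hadj.symm
  have ih1 := ih (n - 1) (by omega) w' (by omega) (by omega)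
  rcases tree_adj ht o hadj with h3 | h3
  · omega
  exfalso
  have hpw : par Gt o w' = w := par_eq ht hadj.symm h3.symm
  by_cases hw' : w' = z
  · grind
  obtain ⟨w'', hadj', hd'⟩ := exists_pred ht.1 z w' hw'
  have h1'' := hA w''
  have h2'' := adj_dist ht.1 (par Gt o z) hadj'.symm
  have ih2 := ih (n - 2) (by omega) w'' (by omega) (by omega)
  have : par Gt o w' = w'' := par_eq ht hadj' (by omega)
  grind

lemma dist_par (ht : IsRegTree Gt d) {z w : T} (hz : z ≠ o) (hwz : w ≠ z)
    (hd : Gt.dist o w ≤ Gt.dist o z) : Gt.dist z w = Gt.dist (par Gt o z) w + 1 := by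
  rcases tree_adj ht w (par_spec ht hz).1 with h | h
  · rw [Gt.dist_comm (u := z), Gt.dist_comm (u := par Gt o z)]; exact h
  · rw [Gt.dist_comm (v := z), Gt.dist_comm (v := par Gt o z)] at h
    have := desc_depth ht hz _ w rfl h
    have h0 : Gt.dist z w = 0 := by omega
    rw [(ht.1 z w).dist_eq_zero_iff] at h0
    grind

def chil (Gt : SimpleGraph T) (o w : T) : Set T := {z | z ≠ o ∧ par Gt o z = w}

lemma nbr_eq (ht : IsRegTree Gt d) {w : T} (hw : w ≠ o) :
    Gt.neighborSet w = insert (par Gt o w) (chil Gt o w) := by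
  ext z
  simp only [mem_neighborSet, mem_insert_iff, chil, mem_setOf_eq]
  constructor
  · intro h
    rcases adj_par ht h with h1 | h1
    · left; exact h1.1.symm
    · grind
  · rintro (rfl | ⟨h1, rfl⟩)
    · exact (par_spec ht hw).1
    · exact (par_spec ht h1).1.symm

lemma nbr_o (ht : IsRegTree Gt d) : Gt.neighborSet o = chil Gt o o := by
  ext z
  simp only [mem_neighborSet, chil, mem_setOf_eq]
  constructor
  · intro h
    rcases adj_par ht h with h1 | h1
    · exact absurd rfl h1.2
    · grind
  · rintro ⟨h1, h2⟩
    have := (par_spec ht h1).1.symm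
    grind

lemma nbr_ncard (ht : IsRegTree Gt d) (w : T) : (Gt.neighborSet w).ncard = d := ht.2.2 w

lemma nbr_fin (ht : IsRegTree Gt d) (hd : 3 ≤ d) (w : T) : (Gt.neighborSet w).Finite := by
  apply finite_of_ncard_ne_zero
  rw [nbr_ncard ht]; omega

lemma chil_fin (ht : IsRegTree Gt d) (hd : 3 ≤ d) (w : T) : (chil Gt o w).Finite := by
  refine (nbr_fin ht hd w).subset fun z hz => ?_
  have := (par_spec ht hz.1).1.symm
  rwa [hz.2] at this

lemma chil_ncard (ht : IsRegTree Gt d) (hd : 3 ≤ d) {w : T} (hw : w ≠ o) :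
    (chil Gt o w).ncard = d - 1 := by
  have h := nbr_ncard ht w
  rw [nbr_eq ht hw, ncard_insert_of_notMem ?_ (chil_fin ht hd w)] at h
  · omega
  · rintro ⟨h1, h2⟩
    have a := (par_spec ht h1).2
    have b := (par_spec ht hw).2
    grind

def sph (Gt : SimpleGraph T) (o : T) (n : ℕ) : Set T := {z | Gt.dist o z = n}

lemma sph_zero (ht : IsRegTree Gt d) : sph Gt o 0 = {o} := by
  ext z; simp only [sph, mem_setOf_eq, mem_singleton_iff]; exact dist_o_eq_zero ht

lemma sph_succ (ht : IsRegTree Gt d) (n : ℕ) : sph Gt o (n + 1) = ⋃ w ∈ sph Gt o n, chil Gt o w := by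
  ext z
  simp only [sph, mem_setOf_eq, mem_iUnion, chil, exists_prop]
  constructor
  · intro h
    have hz : z ≠ o := by grind
    exact ⟨par Gt o z, by rw [par_depth ht]; omega, hz, rfl⟩
  · rintro ⟨w, h1, h2, rfl⟩
    have := (par_spec ht h2).2
    omega

lemma sph_fin (ht : IsRegTree Gt d) (hd : 3 ≤ d) (n : ℕ) : (sph Gt o n).Finite := by
  induction n with
  | zero => rw [sph_zero ht]; simp
  | succ n ih =>
    rw [sph_succ ht]
    exact ih.biUnion fun w _ => chil_fin ht hd w

lemma ball_fin (ht : IsRegTree Gt d) (hd : 3 ≤ d) (n : ℕ) : (gball Gt o n).Finite := by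
  have : gball Gt o n = ⋃ k ∈ Iic n, sph Gt o k := by
    ext z; simp [gball, sph]
  rw [this]
  exact (finite_Iic n).biUnion fun k _ => sph_fin ht hd k

def anc (Gt : SimpleGraph T) (o : T) (h : ℝ) (ω : T → ℝ) (z : T) : Prop :=
  ∀ i : ℕ, h ≤ ω ((par Gt o)^[i] z)

lemma anc_iff {h : ℝ} {ω : T → ℝ} {z : T} :
    anc Gt o h ω z ↔ h ≤ ω z ∧ anc Gt o h ω (par Gt o z) := by
  constructor
  · intro H
    exact ⟨H 0, fun i => H (i+1)⟩
  · rintro ⟨h0, H⟩ i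
    cases i with
    | zero => exact h0
    | succ i => exact H i

lemma anc_o {h : ℝ} {ω : T → ℝ} : anc Gt o h ω o ↔ h ≤ ω o := by
  constructor
  · intro H; exact H 0
  · intro H i
    have : (par Gt o)^[i] o = o := Function.iterate_fixed (par_self Gt o) i
    grind

lemma anc_mem (ht : IsRegTree Gt d) {h : ℝ} {ω : T → ℝ} (z : T) :
    z ∈ levelComp Gt h ω o ↔ anc Gt o h ω z := by
  constructor
  · rintro ⟨p, hp⟩
    have key : ∀ (u v : T) (p : Gt.Walk u v), (∀ x ∈ p.support, h ≤ ω x) → anc Gt o h ω u →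
        anc Gt o h ω v := by
      intro u v p
      induction p with
      | nil => grind
      | @cons a b c hab q ih =>
        intro hs ha
        refine ih (fun x hx => hs x (by simp [hx])) ?_
        rcases adj_par (o := o) ht hab with h1 | h1
        · rw [← h1.1]; exact (anc_iff.1 ha).2
        · rw [anc_iff, h1.1]
          exact ⟨hs b (by simp), ha⟩
    exact key _ _ p hp (anc_o.2 (hp o p.start_mem_support))
  · have key : ∀ (n : ℕ) (z : T), Gt.dist o z = n → anc Gt o h ω z → z ∈ levelComp Gt h ω o := by
      intro n
      induction n with
      | zero =>
        intro z hz ha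
        rw [dist_o_eq_zero ht] at hz; subst hz
        exact ⟨Walk.nil, by simpa using ha 0⟩
      | succ n ih =>
        intro z hz ha
        have hzo : z ≠ o := by grind
        obtain ⟨p, hp⟩ := ih (par Gt o z) (by rw [par_depth ht]; omega) (anc_iff.1 ha).2
        refine ⟨p.concat (par_spec ht hzo).1.symm, ?_⟩
        intro v hv
        rw [Walk.support_concat] at hv
        simp only [List.concat_eq_append, List.mem_append, List.mem_singleton] at hv
        rcases hv with hv | rfl
        · exact hp v hv
        · exact ha 0
    grind

lemma anc_measurable (h : ℝ) (z : T) : MeasurableSet {ω : T → ℝ | anc Gt o h ω z} := by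
  unfold anc
  rw [Set.setOf_forall]
  exact MeasurableSet.iInter fun i => measurableSet_le measurable_const (measurable_pi_apply _)

lemma anc_local (ht : IsRegTree Gt d) {h : ℝ} {ω ω' : T → ℝ} {z : T} {n : ℕ} (hz : Gt.dist o z ≤ n)
    (H : ∀ w, Gt.dist o w ≤ n → ω w = ω' w) : anc Gt o h ω z ↔ anc Gt o h ω' z := by
  have : ∀ i, Gt.dist o ((par Gt o)^[i] z) ≤ n := by
    intro i
    induction i with
    | zero => exact hz
    | succ i ih => rw [iterate_succ_apply', par_depth ht]; omega
  unfold anc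
  grind

structure RS (Gt : SimpleGraph T) (o : T) (R : Set T) (j : ℕ) : Prop where
  ho : o ∈ R
  up : ∀ z, z ∈ R → par Gt o z ∈ R
  down : ∀ z, par Gt o z ∈ R → par Gt o z ≠ o → z ∈ R
  card : (chil Gt o o ∩ R).ncard = j

lemma RS_univ (ht : IsRegTree Gt d) : RS Gt o univ d :=
  ⟨trivial, fun _ _ => trivial, fun _ _ _ => trivial, by
    rw [Set.inter_univ, ← nbr_o ht, nbr_ncard ht]⟩

lemma obar_spec (ht : IsRegTree Gt d) (hob : Gt.Adj o obar) : obar ≠ o ∧ par Gt o obar = o := by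
  have h1 : obar ∈ chil Gt o o := by rw [← nbr_o ht]; exact hob
  exact h1

lemma RS_plus (ht : IsRegTree Gt d) (hd : 3 ≤ d) (hob : Gt.Adj o obar) :
    RS Gt o (treePlus Gt o obar) (d - 1) := by
  have hob1 := obar_spec ht hob
  have hob2 : Gt.dist o obar = 1 := dist_eq_one_iff_adj.2 hob
  have hstep : ∀ z, z ≠ o → z ≠ obar → Gt.dist z obar = Gt.dist (par Gt o z) obar + 1 := by
    intro z hz hzo
    refine dist_par ht hz (Ne.symm hzo) ?_
    have : Gt.dist o z ≠ 0 := fun h => hz ((dist_o_eq_zero ht).1 h)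
    omega
  have hnot : obar ∉ treePlus Gt o obar := by
    unfold treePlus; simp
  have hiff : ∀ z, z ≠ o → z ≠ obar → (z ∈ treePlus Gt o obar ↔ par Gt o z ∈ treePlus Gt o obar) := by
    intro z hz hzo
    unfold treePlus
    simp only [mem_setOf_eq]
    rw [hstep z hz hzo, Gt.dist_comm (v := o), Gt.dist_comm (v := o)]
    have := (par_spec ht hz).2
    omega
  have ho : o ∈ treePlus Gt o obar := by unfold treePlus; simp [hob2]
  refine ⟨ho, fun z hz => ?_, fun z hz hz' => ?_, ?_⟩
  · by_cases h : z = o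
    · subst h; rw [par_self]; exact hz
    grind
  · by_cases h : z = o
    · grind
    grind
  · have : chil Gt o o ∩ treePlus Gt o obar = chil Gt o o \ {obar} := by
      ext z
      simp only [mem_inter_iff, mem_diff, mem_singleton_iff]
      constructor
      · grind
      · rintro ⟨h1, h2⟩
        refine ⟨h1, (hiff z h1.1 h2).2 ?_⟩
        rw [h1.2]; exact ho
    rw [this, ncard_diff_singleton_of_mem (show obar ∈ chil Gt o o from hob1), ← nbr_o ht, nbr_ncard ht]

lemma chil_disj {w w' : T} (h : w ≠ w') : Disjoint (chil Gt o w) (chil Gt o w') := by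
  rw [Set.disjoint_left]
  rintro z ⟨_, h1⟩ ⟨_, h2⟩
  grind

lemma ncard_sphR (ht : IsRegTree Gt d) (hd : 3 ≤ d) {R : Set T} {j : ℕ} (hR : RS Gt o R j) (n : ℕ) :
    (sph Gt o (n + 1) ∩ R).ncard = j * (d - 1) ^ n := by
  induction n with
  | zero =>
    rw [sph_succ ht, sph_zero ht]
    simpa using hR.card
  | succ n ih =>
    have e : sph Gt o (n + 1 + 1) ∩ R = ⋃ w ∈ sph Gt o (n + 1) ∩ R, chil Gt o w := by
      rw [sph_succ ht]
      ext z
      simp only [mem_inter_iff, mem_iUnion, exists_prop]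
      constructor
      · rintro ⟨⟨w, h1, h2⟩, h3⟩
        exact ⟨w, ⟨h1, h2.2 ▸ hR.up z h3⟩, h2⟩
      · rintro ⟨w, ⟨h1, h2⟩, h3⟩
        refine ⟨⟨w, h1, h3⟩, hR.down z (by rw [h3.2]; exact h2) ?_⟩
        rw [h3.2]
        rintro rfl
        simp [sph] at h1
    have hfin : (sph Gt o (n + 1) ∩ R).Finite := (sph_fin ht hd _).inter_of_left _
    rw [e, Finite.ncard_biUnion hfin (fun w _ => chil_fin ht hd w)
      (fun w _ w' _ h => chil_disj h)]
    rw [finsum_mem_congr rfl (g := fun _ => (d - 1)) (fun w hw => chil_ncard ht hd ?_)]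
    · rw [finsum_mem_eq_finite_toFinset_sum _ hfin, sum_const,
        ← ncard_eq_toFinset_card _ hfin, ih, smul_eq_mul, pow_succ, mul_assoc]
    · rintro rfl
      simp [sph] at hw

end
end GFF

namespace GFF
set_option linter.all false

section
local notation "δ(" x ")" => ((x:ℝ)-1)
variable {T : Type} {Gt : SimpleGraph T} {d : ℕ} {o obar : T}

structure TH (Gt : SimpleGraph T) (d : ℕ) (μT : Measure (T → ℝ)) : Prop where
  hd : 3 ≤ d
  ht : IsRegTree Gt d
  hμ : IsGaussianField μT (treeGreen Gt d)

lemma treeGreen_symm (x y : T) : treeGreen Gt d x y = treeGreen Gt d y x := by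
  unfold treeGreen; rw [Gt.dist_comm]

lemma treeGreen_nonneg (hd : 3 ≤ d) (x y : T) : 0 ≤ treeGreen Gt d x y := by
  have : (3:ℝ) ≤ d := by exact_mod_cast hd
  unfold treeGreen
  have h1 : (0:ℝ) ≤ d - 1 := by linarith
  have h2 : (0:ℝ) ≤ d - 2 := by linarith
  positivity

lemma TH.fin {μT : Measure (T → ℝ)} (H : TH Gt d μT) {J : Type*} [Fintype J] (f : J → T)
    (hf : Injective f) :
    GF (μT.map (fun ω => ω ∘ f)) (fun i j => treeGreen Gt d (f i) (f j)) :=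
  H.hμ.fin f hf (fun c => H.hμ.nonneg_of_pos treeGreen_symm (treeGreen_nonneg H.hd) f c)

noncomputable def sphF (H : IsRegTree Gt d) (hd : 3 ≤ d) (o : T) (n : ℕ) : Finset T :=
  (sph_fin (o := o) H hd n).toFinset
noncomputable def ballF (H : IsRegTree Gt d) (hd : 3 ≤ d) (o : T) (n : ℕ) : Finset T :=
  (ball_fin (o := o) H hd n).toFinset

lemma mem_sphF (H : IsRegTree Gt d) (hd : 3 ≤ d) (n : ℕ) (z : T) :
    z ∈ sphF H hd o n ↔ Gt.dist o z = n := by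
  simp [sphF, sph]
lemma mem_ballF (H : IsRegTree Gt d) (hd : 3 ≤ d) (n : ℕ) (z : T) :
    z ∈ ballF H hd o n ↔ Gt.dist o z ≤ n := by
  simp [ballF, gball]

noncomputable def gvar (d : ℕ) : ℝ≥0 := (d : ℝ≥0) / ((d - 1 : ℕ) : ℝ≥0)
noncomputable def nvar (d : ℕ) : ℝ≥0 := ((d - 1 : ℕ) : ℝ≥0) / ((d - 2 : ℕ) : ℝ≥0)

lemma gvar_coe (hd : 3 ≤ d) : (gvar d : ℝ) = (d : ℝ) / δ(d) := by
  unfold gvar; rw [NNReal.coe_div, NNReal.coe_natCast, NNReal.coe_natCast, Nat.cast_sub (show 1 ≤ d by omega)]; simp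
lemma nvar_coe (hd : 3 ≤ d) : (nvar d : ℝ) = δ(d) / ((d:ℝ) - 2) := by
  unfold nvar; rw [NNReal.coe_div, NNReal.coe_natCast, NNReal.coe_natCast, Nat.cast_sub (show 1 ≤ d by omega), Nat.cast_sub (show 2 ≤ d by omega)]; simp

lemma inc_cov (ht : IsRegTree Gt d) (hd : 3 ≤ d) {z w : T} (hz : z ≠ o) (hw : Gt.dist o w ≤ Gt.dist o z) :
    treeGreen Gt d z w - δ(d)⁻¹ * treeGreen Gt d (par Gt o z) w =
      if z = w then (gvar d : ℝ) else 0 := by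
  have h3 : (3:ℝ) ≤ d := by exact_mod_cast hd
  have h1 : (d:ℝ) - 1 ≠ 0 := by linarith
  have h2 : (d:ℝ) - 2 ≠ 0 := by linarith
  split_ifs with h
  · subst h
    unfold treeGreen
    have : Gt.dist (par Gt o z) z = 1 := dist_eq_one_iff_adj.2 (par_spec ht hz).1.symm
    rw [this, gvar_coe hd]
    simp only [SimpleGraph.dist_self, pow_zero, pow_one]
    grind
  · unfold treeGreen
    rw [dist_par ht hz (Ne.symm h) hw, pow_succ]
    ring

lemma gsum_ind {B : Type*} [Fintype B] [DecidableEq B] (b : B) (f : B → ℝ) : ∑ i, (if i = b then (1:ℝ) else 0) * f i = f b := by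
  simp

variable {μT : Measure (T → ℝ)}

lemma inc_law (H : TH Gt d μT) (k : ℕ) :
    μT.map (fun ω => (Sum.elim (fun i : ballF H.ht H.hd o k => ω i)
      (fun z : sphF H.ht H.hd o (k+1) => ω z - δ(d)⁻¹ * ω (par Gt o z)) : _ ⊕ _ → ℝ)) =
    ((μT.map (fun ω (i : ballF H.ht H.hd o k) => ω i)).prod
      (Measure.pi (fun _ : sphF H.ht H.hd o (k+1) => gaussianReal 0 (gvar d)))).map
        (fun p => (Sum.elim p.1 p.2 : _ ⊕ _ → ℝ)) := by
  have ht := H.ht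
  have hd := H.hd
  have hB := H.fin (fun b : ballF H.ht H.hd o (k+1) => (b : T)) Subtype.val_injective
  have hI := H.fin (fun b : ballF H.ht H.hd o k => (b : T)) Subtype.val_injective
  have hJ := GF.pi (I := sphF H.ht H.hd o (k+1)) (gvar d)
  have hprod := GF.prod hI hJ
  let ii : ballF H.ht H.hd o k → ballF H.ht H.hd o (k+1) := fun b =>
    ⟨b.1, by have := b.2; rw [mem_ballF] at this ⊢; omega⟩
  let jj : sphF H.ht H.hd o (k+1) → ballF H.ht H.hd o (k+1) := fun b =>
    ⟨b.1, by have := b.2; rw [mem_sphF] at this; rw [mem_ballF]; omega⟩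
  let pp : sphF H.ht H.hd o (k+1) → ballF H.ht H.hd o (k+1) := fun b =>
    ⟨par Gt o b.1, by have := b.2; rw [mem_sphF] at this; rw [mem_ballF, par_depth ht]; omega⟩
  let A : (ballF H.ht H.hd o k) ⊕ (sphF H.ht H.hd o (k+1)) → ballF H.ht H.hd o (k+1) → ℝ :=
    Sum.elim (fun i b => if b = ii i then 1 else 0)
      (fun z b => (if b = jj z then 1 else 0) - δ(d)⁻¹ * (if b = pp z then 1 else 0))
  have hA : ∀ (f : ballF H.ht H.hd o (k+1) → ℝ) s, ∑ b, A s b * f b =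
      Sum.elim (fun i => f (ii i)) (fun z => f (jj z) - δ(d)⁻¹ * f (pp z)) s := by
    intro f s
    rcases s with i | z
    · simp only [A, Sum.elim_inl]; exact gsum_ind (ii i) f
    · simp only [A, Sum.elim_inr, sub_mul, sum_sub_distrib, mul_assoc, ← mul_sum, gsum_ind]
  have hlin := GF.lin hB A
  rw [Measure.map_map (by fun_prop) (by fun_prop)] at hlin
  have e1 : ((fun (ω : ballF H.ht H.hd o (k+1) → ℝ) j => ∑ i, A j i * ω i) ∘
      (fun ω : T → ℝ => ω ∘ (fun b : ballF H.ht H.hd o (k+1) => (b : T)))) =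
      (fun ω => (Sum.elim (fun i : ballF H.ht H.hd o k => ω i)
      (fun z : sphF H.ht H.hd o (k+1) => ω z - δ(d)⁻¹ * ω (par Gt o z)) : _ ⊕ _ → ℝ)) := by
    funext ω s
    simp only [comp]
    rw [hA]
  rw [e1] at hlin
  have hz : ∀ z : sphF H.ht H.hd o (k+1), Gt.dist o z.1 = k + 1 := fun z => (mem_sphF ht hd _ _).1 z.2
  have hzo : ∀ z : sphF H.ht H.hd o (k+1), z.1 ≠ o := fun z h => by
    grind
  have hi : ∀ z : ballF H.ht H.hd o k, Gt.dist o z.1 ≤ k := fun z => (mem_ballF ht hd _ _).1 z.2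
  refine GF.unique (hlin.congr fun s s' => ?_) hprod
  have e2 : ∑ i, ∑ i', A s i * A s' i' * treeGreen Gt d i.1 i'.1 =
      ∑ i, A s i * (∑ i', A s' i' * treeGreen Gt d i.1 i'.1) := by
    refine sum_congr rfl fun i _ => ?_
    rw [mul_sum]
    grind
  rw [e2, hA]
  rcases s with i | z <;> rcases s' with i' | z'
  · simp only [hA, Sum.elim_inl]; rfl
  · simp only [hA, Sum.elim_inl, Sum.elim_inr]
    have h1 := inc_cov (w := i.1) ht hd (hzo z') (by grind)
    rw [if_neg (fun h => by grind)] at h1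
    rw [treeGreen_symm, treeGreen_symm (y := (pp z').1)]
    exact h1
  · simp only [hA, Sum.elim_inl, Sum.elim_inr]
    have h1 := inc_cov (w := i'.1) ht hd (hzo z) (by grind)
    grind
  · simp only [hA, Sum.elim_inl, Sum.elim_inr]
    have h1 := inc_cov (w := z'.1) ht hd (hzo z) (by rw [hz, hz])
    have h2 := inc_cov (w := par Gt o z'.1) ht hd (hzo z) (by rw [par_depth ht, hz, hz]; omega)
    rw [if_neg (fun h => by have h1 := hz z; have h2 := hz z'; rw [h, par_depth ht] at h1; omega)] at h2
    grind

lemma inc_int (H : TH Gt d μT) (k : ℕ) (F : (T → ℝ) × (sphF H.ht H.hd o (k+1) → ℝ) → ℝ)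
    (hF : Measurable F) (hb : ∀ p, |F p| ≤ 1)
    (hloc : ∀ ω ω' x, (∀ w, Gt.dist o w ≤ k → ω w = ω' w) → F (ω, x) = F (ω', x)) :
    ∫ ω, F (ω, fun z => ω z - δ(d)⁻¹ * ω (par Gt o z)) ∂μT =
    ∫ ω, (∫ x, F (ω, x) ∂(Measure.pi (fun _ : sphF H.ht H.hd o (k+1) => gaussianReal 0 (gvar d)))) ∂μT := by
  haveI := H.hμ.1
  let e : (ballF H.ht H.hd o k → ℝ) → (T → ℝ) := fun a w =>
    if h : w ∈ ballF H.ht H.hd o k then a ⟨w, h⟩ else 0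
  have he : Measurable e := by
    refine measurable_pi_iff.2 fun w => ?_
    simp only [e]
    split_ifs
    · fun_prop
    fun_prop
  let r : (T → ℝ) → (ballF H.ht H.hd o k → ℝ) := fun ω i => ω i
  have hr : Measurable r := measurable_pi_iff.2 fun i => measurable_pi_apply _
  have her : ∀ ω x, F (e (r ω), x) = F (ω, x) := by
    intro ω x
    refine hloc _ _ _ fun w hw => ?_
    simp only [e, r]
    rw [dif_pos ((mem_ballF H.ht H.hd k w).2 hw)]
  let F' : ((ballF H.ht H.hd o k) ⊕ (sphF H.ht H.hd o (k+1)) → ℝ) → ℝ := fun s =>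
    F (e (fun i => s (Sum.inl i)), fun j => s (Sum.inr j))
  have hi0 : Measurable (fun (s : (ballF H.ht H.hd o k) ⊕ (sphF H.ht H.hd o (k+1)) → ℝ) (i : ballF H.ht H.hd o k) => s (Sum.inl i)) := measurable_pi_iff.2 fun i => measurable_pi_apply _
  have hj0 : Measurable (fun (s : (ballF H.ht H.hd o k) ⊕ (sphF H.ht H.hd o (k+1)) → ℝ) (i : sphF H.ht H.hd o (k+1)) => s (Sum.inr i)) := measurable_pi_iff.2 fun i => measurable_pi_apply _
  have hF' : Measurable F' := hF.comp (Measurable.prodMk (he.comp hi0) hj0)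
  have hm1 : Measurable (fun ω : T → ℝ => (Sum.elim (fun i : ballF H.ht H.hd o k => ω i)
      (fun z : sphF H.ht H.hd o (k+1) => ω z - δ(d)⁻¹ * ω (par Gt o z)) : _ ⊕ _ → ℝ)) := by
    refine measurable_pi_iff.2 fun s => ?_
    rcases s with s | s <;> simp only [Sum.elim_inl, Sum.elim_inr] <;> fun_prop
  have hm2 : Measurable (fun p : (ballF H.ht H.hd o k → ℝ) × (sphF H.ht H.hd o (k+1) → ℝ) =>
      (Sum.elim p.1 p.2 : _ ⊕ _ → ℝ)) := by
    refine measurable_pi_iff.2 fun s => ?_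
    rcases s with s | s <;> simp only [Sum.elim_inl, Sum.elim_inr] <;> fun_prop
  have h1 : ∫ ω, F (ω, fun z => ω z - δ(d)⁻¹ * ω (par Gt o z)) ∂μT =
      ∫ s, F' s ∂(μT.map (fun ω => (Sum.elim (fun i : ballF H.ht H.hd o k => ω i)
      (fun z : sphF H.ht H.hd o (k+1) => ω z - δ(d)⁻¹ * ω (par Gt o z)) : _ ⊕ _ → ℝ))) := by
    rw [integral_map hm1.aemeasurable hF'.aestronglyMeasurable]
    grind
  haveI : IsProbabilityMeasure (μT.map r) := isProbabilityMeasure_map hr.aemeasurable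
  rw [h1, inc_law H k, integral_map hm2.aemeasurable hF'.aestronglyMeasurable]
  have hint : Integrable (fun p : (ballF H.ht H.hd o k → ℝ) × (sphF H.ht H.hd o (k+1) → ℝ) => F (e p.1, p.2))
      ((μT.map r).prod (Measure.pi (fun _ : sphF H.ht H.hd o (k+1) => gaussianReal 0 (gvar d)))) := by
    refine Integrable.of_bound (C := 1) (Measurable.aestronglyMeasurable (hF.comp (Measurable.prodMk (he.comp measurable_fst) measurable_snd))) ?_
    exact ae_of_all _ fun p => by rw [norm_eq_abs]; exact hb _
  have h2 := integral_prod (μ := μT.map r) _ hint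
  refine Eq.trans h2 ?_
  rw [integral_map hr.aemeasurable]
  · grind
  · refine StronglyMeasurable.aestronglyMeasurable ?_
    have : Measurable (fun p : (ballF H.ht H.hd o k → ℝ) × (sphF H.ht H.hd o (k+1) → ℝ) => F (e p.1, p.2)) :=
      hF.comp (Measurable.prodMk (he.comp measurable_fst) measurable_snd)
    exact (this.stronglyMeasurable).integral_prod_right'

end
end GFF

namespace GFF
set_option linter.all false

section
local notation "δ(" x ")" => ((x:ℝ)-1)
variable {T : Type} {Gt : SimpleGraph T} {d : ℕ} {o obar : T} {μT : Measure (T → ℝ)}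

noncomputable def yop (d : ℕ) (q : ℝ → ℝ) (a : ℝ) : ℝ :=
  ∫ x, q (δ(d)⁻¹ * a + x) ∂(gaussianReal 0 (gvar d))

structure Fn (q : ℝ → ℝ) : Prop where
  meas : Measurable q
  nn : ∀ a, 0 ≤ q a
  le : ∀ a, q a ≤ 1

lemma Fn.integrable {q : ℝ → ℝ} (h : Fn q) {Ω : Type*} [MeasurableSpace Ω] (μ : Measure Ω)
    [IsFiniteMeasure μ] {f : Ω → ℝ} (hf : Measurable f) : Integrable (fun x => q (f x)) μ := by
  refine Integrable.of_bound (C := 1) (h.meas.comp hf).aestronglyMeasurable (ae_of_all _ fun x => ?_)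
  rw [norm_eq_abs, abs_of_nonneg (h.nn _)]; exact h.le _

lemma Fn.yop {q : ℝ → ℝ} (h : Fn q) : Fn (yop d q) := by
  refine ⟨?_, fun a => integral_nonneg fun x => h.nn _, fun a => ?_⟩
  · have : Measurable (fun p : ℝ × ℝ => q (δ(d)⁻¹ * p.1 + p.2)) := h.meas.comp (by fun_prop)
    exact (this.stronglyMeasurable.integral_prod_right'
      (ν := gaussianReal 0 (gvar d))).measurable
  · have h1 : ∫ x, q (δ(d)⁻¹ * a + x) ∂(gaussianReal 0 (gvar d)) ≤ ∫ x, 1 ∂(gaussianReal 0 (gvar d)) :=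
      integral_mono (h.integrable _ (by fun_prop)) (integrable_const _) fun x => h.le _
    simpa [GFF.yop] using h1

noncomputable def bst (h : ℝ) (j : ℕ) (y : ℝ → ℝ) (a : ℝ) : ℝ := if h ≤ a then 1 - (1 - y a) ^ j else 0

lemma Fn.bst {y : ℝ → ℝ} (hy : Fn y) (h : ℝ) (j : ℕ) : Fn (bst h j y) := by
  refine ⟨?_, fun a => ?_, fun a => ?_⟩
  · exact Measurable.ite measurableSet_Ici (by have := hy.meas; fun_prop) measurable_const
  · unfold GFF.bst; split_ifs
    · have := pow_le_one₀ (n := j) (by linarith [hy.le a] : 0 ≤ 1 - y a) (by linarith [hy.nn a])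
      linarith
    grind
  · unfold GFF.bst; split_ifs
    · have := pow_nonneg (by linarith [hy.le a] : 0 ≤ 1 - y a) j
      linarith
    grind

noncomputable def Qn (d : ℕ) (h : ℝ) : ℕ → ℝ → ℝ
  | 0 => fun a => if h ≤ a then 1 else 0
  | n + 1 => bst h (d - 1) (yop d (Qn d h n))

lemma Qn_Fn (h : ℝ) (n : ℕ) : Fn (Qn d h n) := by
  induction n with
  | zero =>
    refine ⟨Measurable.ite measurableSet_Ici measurable_const measurable_const, fun a => ?_, fun a => ?_⟩ <;>
    · simp only [Qn]; grind
  | succ n ih => exact ih.yop.bst h (d - 1)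

lemma Qn_lt {h a : ℝ} (ha : ¬ h ≤ a) (n : ℕ) : Qn d h n a = 0 := by
  cases n with
  | zero => simp [Qn, ha]
  | succ n => simp [Qn, bst, ha]

noncomputable def genP (H : TH Gt d μT) (o : T) (R : Set T) (h : ℝ) (q : ℝ → ℝ) (k : ℕ) : ℝ :=
  ∫ ω, ∏ z ∈ sphF H.ht H.hd o k, (if z ∈ R ∧ anc Gt o h ω z then 1 - q (ω z) else 1) ∂μT

lemma gen_step0 (H : TH Gt d μT) {R : Set T} (h : ℝ) (k : ℕ)
    {q : ℝ → ℝ} (hq : Fn q) (hq0 : ∀ a, ¬ h ≤ a → q a = 0) :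
    genP H o R h q (k+1) = ∫ ω, ∏ z ∈ sphF H.ht H.hd o (k+1),
      (if z ∈ R ∧ anc Gt o h ω (par Gt o z) then 1 - yop d q (ω (par Gt o z)) else 1) ∂μT := by
  let F : (T → ℝ) × (sphF H.ht H.hd o (k+1) → ℝ) → ℝ := fun p =>
    ∏ z : sphF H.ht H.hd o (k+1), (if z.1 ∈ R ∧ anc Gt o h p.1 (par Gt o z.1) then
      1 - q (δ(d)⁻¹ * p.1 (par Gt o z.1) + p.2 z) else 1)
  have hF : Measurable F := by
    refine Finset.measurable_prod _ fun z _ => ?_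
    by_cases hz : z.1 ∈ R
    · simp only [hz, true_and]
      refine Measurable.ite ?_ ?_ measurable_const
      · exact measurable_fst (anc_measurable h _)
      · refine measurable_const.sub (hq.meas.comp ?_)
        fun_prop
    · simp only [hz, false_and, if_false]; fun_prop
  have hb : ∀ p, |F p| ≤ 1 := by
    intro p
    simp only [F]
    rw [Finset.abs_prod]
    refine Finset.prod_le_one (fun _ _ => abs_nonneg _) fun z _ => ?_
    split_ifs
    · rw [abs_le]
      have h1 := hq.nn (δ(d)⁻¹ * p.1 (par Gt o z.1) + p.2 z)
      have h2 := hq.le (δ(d)⁻¹ * p.1 (par Gt o z.1) + p.2 z)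
      grind
    · simp
  have hpd : ∀ z : sphF H.ht H.hd o (k+1), Gt.dist o (par Gt o z.1) ≤ k := by
    intro z
    have := (mem_sphF H.ht H.hd _ _).1 z.2
    rw [par_depth H.ht]; omega
  have hloc : ∀ ω ω' x, (∀ w, Gt.dist o w ≤ k → ω w = ω' w) → F (ω, x) = F (ω', x) := by
    intro ω ω' x hw
    simp only [F]
    refine prod_congr rfl fun z _ => ?_
    rw [hw _ (hpd z)]
    simp only [anc_local H.ht (hpd z) hw]
  have key := inc_int H k F hF hb hloc
  have e1 : genP H o R h q (k+1) = ∫ ω, F (ω, fun z => ω z - δ(d)⁻¹ * ω (par Gt o z)) ∂μT := by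
    unfold genP
    refine integral_congr_ae (ae_of_all _ fun ω => ?_)
    simp only [F]
    rw [← prod_coe_sort]
    refine prod_congr rfl fun z _ => ?_
    rw [anc_iff (z := z.1)]
    grind
  rw [e1, key]
  refine integral_congr_ae (ae_of_all _ fun ω => ?_)
  simp only [F]
  rw [← prod_coe_sort (s := sphF H.ht H.hd o (k+1)), integral_fintype_prod_eq_prod (𝕜 := ℝ)
    (f := fun (z : sphF H.ht H.hd o (k+1)) (x : ℝ) => if z.1 ∈ R ∧ anc Gt o h ω (par Gt o z.1) then
      1 - q (δ(d)⁻¹ * ω (par Gt o z.1) + x) else 1)]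
  refine prod_congr rfl fun z _ => ?_
  split_ifs
  · rw [integral_sub (integrable_const _) (hq.integrable _ (by fun_prop))]
    simp [yop]
  · simp

lemma sphF_succ (H : TH Gt d μT) (k : ℕ) : sphF H.ht H.hd o (k+1) =
    (sphF H.ht H.hd o k).biUnion (fun w => (chil_fin (o := o) H.ht H.hd w).toFinset) := by
  ext z
  rw [mem_sphF]
  have := congrArg (fun S => z ∈ S) (sph_succ (o := o) H.ht k)
  simp only [sph, mem_setOf_eq, mem_iUnion, eq_iff_iff] at this
  rw [this]
  simp [mem_sphF]

lemma gen_step (H : TH Gt d μT) {R : Set T} {j : ℕ} (hR : RS Gt o R j) (h : ℝ) (k : ℕ)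
    {q : ℝ → ℝ} (hq : Fn q) (hq0 : ∀ a, ¬ h ≤ a → q a = 0) :
    genP H o R h q (k+2) = genP H o R h (bst h (d-1) (yop d q)) (k+1) := by
  rw [gen_step0 H h (k+1) hq hq0]
  unfold genP
  refine integral_congr_ae (ae_of_all _ fun ω => ?_)
  simp only
  rw [sphF_succ H (k+1), Finset.prod_biUnion]
  · refine prod_congr rfl fun w hw => ?_
    have hwo : w ≠ o := by
      rintro rfl
      rw [mem_sphF] at hw; simp at hw
    have e : ∀ z ∈ (chil_fin (o := o) H.ht H.hd w).toFinset,
        (if z ∈ R ∧ anc Gt o h ω (par Gt o z) then 1 - yop d q (ω (par Gt o z)) else 1) =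
        (if w ∈ R ∧ anc Gt o h ω w then 1 - yop d q (ω w) else 1) := by
      intro z hz
      rw [Finite.mem_toFinset] at hz
      have h1 : z ∈ R ↔ w ∈ R := by
        constructor
        · intro h; have := hR.up z h; rwa [hz.2] at this
        · intro h; exact hR.down z (by rw [hz.2]; exact h) (by rw [hz.2]; exact hwo)
      rw [hz.2]; grind
    rw [prod_congr rfl e, prod_const, ← ncard_eq_toFinset_card _ _, chil_ncard H.ht H.hd hwo]
    by_cases hw2 : w ∈ R ∧ anc Gt o h ω w
    · rw [if_pos hw2, if_pos hw2]
      have : h ≤ ω w := hw2.2 0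
      simp [bst, this]
    · rw [if_neg hw2, if_neg hw2, one_pow]
  · intro w _ w' _ hne
    simp only [Function.onFun]
    rw [Finite.disjoint_toFinset]
    exact chil_disj hne

lemma gen_one (H : TH Gt d μT) {R : Set T} {j : ℕ} (hR : RS Gt o R j) (h : ℝ)
    {q : ℝ → ℝ} (hq : Fn q) (hq0 : ∀ a, ¬ h ≤ a → q a = 0) :
    genP H o R h q 1 = ∫ ω, (1 - bst h j (yop d q) (ω o)) ∂μT := by
  rw [show (1:ℕ) = 0 + 1 from rfl, gen_step0 H h 0 hq hq0]
  refine integral_congr_ae (ae_of_all _ fun ω => ?_)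
  simp only
  have hs : sphF H.ht H.hd o 0 = {o} := by
    ext z; rw [mem_sphF, dist_o_eq_zero H.ht]; simp
  rw [sphF_succ H 0, hs, Finset.singleton_biUnion]
  have e : ∀ z ∈ (chil_fin (o := o) H.ht H.hd o).toFinset,
      (if z ∈ R ∧ anc Gt o h ω (par Gt o z) then 1 - yop d q (ω (par Gt o z)) else 1) =
      (if z ∈ R then (if h ≤ ω o then 1 - yop d q (ω o) else 1) else 1) := by
    intro z hz
    rw [Finite.mem_toFinset] at hz
    rw [hz.2, anc_o]
    grind
  rw [prod_congr rfl e, ← Finset.prod_filter, prod_const]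
  have : ((chil_fin (o := o) H.ht H.hd o).toFinset.filter (fun z => z ∈ R)).card = j := by
    rw [← hR.card, ← ncard_coe_finset]
    congr 1
    ext z; simp
  rw [this]
  by_cases h1 : h ≤ ω o
  · simp [h1, bst]
  · simp [h1, bst]

def reach (Gt : SimpleGraph T) (o : T) (R : Set T) (h : ℝ) (n : ℕ) : Set (T → ℝ) :=
  {ω | ∃ z, Gt.dist o z = n ∧ z ∈ R ∧ anc Gt o h ω z}

lemma reach_meas (H : TH Gt d μT) (R : Set T) (h : ℝ) (n : ℕ) : MeasurableSet (reach Gt o R h n) := by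
  have : reach Gt o R h n = ⋃ z ∈ (sph Gt o n ∩ R), {ω | anc Gt o h ω z} := by
    ext ω; simp [reach, sph, and_assoc]
  rw [this]
  exact ((sph_fin H.ht H.hd n).inter_of_left _).measurableSet_biUnion fun z _ => anc_measurable h z

lemma map_root (H : TH Gt d μT) : μT.map (fun ω => ω o) = gaussianReal 0 (nvar d) := by
  have h1 := H.fin (fun _ : Unit => o) (fun _ _ _ => rfl)
  have h2 := h1.marg ()
  rw [Measure.map_map (by fun_prop) (by fun_prop)] at h2
  have e : (treeGreen Gt d o o).toNNReal = nvar d := by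
    rw [← Real.toNNReal_coe (r := nvar d), nvar_coe H.hd]
    simp [treeGreen]
  rw [e] at h2
  exact h2

lemma reach_prob (H : TH Gt d μT) {R : Set T} {j : ℕ} (hR : RS Gt o R j) (h : ℝ) (n : ℕ) :
    μT.real (reach Gt o R h (n+1)) = ∫ a, bst h j (yop d (Qn d h n)) a ∂(gaussianReal 0 (nvar d)) := by
  haveI := H.hμ.1
  have e1 : ∀ m k, genP H o R h (Qn d h m) (k+1) = genP H o R h (Qn d h (m+k)) 1 := by
    intro m k
    induction k generalizing m with
    | zero => rfl
    | succ k ih =>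
      rw [gen_step H hR h k (Qn_Fn h m) (fun a ha => Qn_lt ha m)]
      have := ih (m+1)
      rw [show m + 1 + k = m + (k+1) by ring] at this
      exact this
  have e2 : genP H o R h (Qn d h 0) (n+1) = μT.real (reach Gt o R h (n+1))ᶜ := by
    unfold genP
    rw [← integral_indicator_one (reach_meas H R h (n+1)).compl]
    refine integral_congr_ae (ae_of_all _ fun ω => ?_)
    by_cases hω : ω ∈ reach Gt o R h (n+1)
    · simp only [indicator, mem_compl_iff, hω, not_true, if_false]
      obtain ⟨z, h1, h2, h3⟩ := hω
      refine Finset.prod_eq_zero ((mem_sphF H.ht H.hd _ z).2 h1) ?_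
      have : h ≤ ω z := h3 0
      simp [h2, h3, Qn, this]
    · simp only [indicator, mem_compl_iff, hω, not_false_eq_true, if_true]
      refine Finset.prod_eq_one fun z hz => ?_
      rw [if_neg]
      intro h1
      exact hω ⟨z, (mem_sphF H.ht H.hd _ z).1 hz, h1⟩
  rw [e1 0 n, Nat.zero_add, gen_one H hR h (Qn_Fn h n) (fun a ha => Qn_lt ha n),
    probReal_compl_eq_one_sub (reach_meas H R h (n+1))] at e2
  have hF := ((Qn_Fn (d := d) h n).yop (d := d)).bst h j
  rw [integral_sub (integrable_const _) (hF.integrable _ (by fun_prop))] at e2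
  simp only [integral_const, probReal_univ, smul_eq_mul, mul_one] at e2
  rw [← map_root (o := o) H, integral_map (measurable_pi_apply o).aemeasurable hF.meas.aestronglyMeasurable]
  linarith

lemma inf_iff (H : TH Gt d μT) {R : Set T} {j : ℕ} (hR : RS Gt o R j) (h : ℝ) :
    {ω | (levelComp Gt h ω o ∩ R).Infinite} = ⋂ n, reach Gt o R h (n+1) := by
  ext ω
  simp only [mem_setOf_eq, mem_iInter]
  have hdown : ∀ z, z ∈ R → ∀ k, anc Gt o h ω z → k ≤ Gt.dist o z → ω ∈ reach Gt o R h k := by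
    intro z hz k ha hk
    have : ∀ i, i ≤ Gt.dist o z → ω ∈ reach Gt o R h (Gt.dist o z - i) := by
      intro i
      induction i with
      | zero => intro _; exact ⟨z, rfl, hz, ha⟩
      | succ i ih =>
        intro hi
        obtain ⟨w, h1, h2, h3⟩ := ih (by omega)
        exact ⟨par Gt o w, by rw [par_depth H.ht, h1]; omega, hR.up w h2, (anc_iff.1 h3).2⟩
    have := this (Gt.dist o z - k) (by omega)
    grind
  constructor
  · intro hinf n
    obtain ⟨z, hz, hz2⟩ := hinf.exists_notMem_finite (ball_fin (o := o) H.ht H.hd (n+1))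
    refine hdown z hz.2 _ ((anc_mem H.ht z).1 hz.1) ?_
    simp only [gball, mem_setOf_eq] at hz2
    omega
  · intro hn hfin
    obtain ⟨M, hM⟩ := (hfin.image (fun z => Gt.dist o z)).bddAbove
    obtain ⟨z, h1, h2, h3⟩ := hn M
    have := hM ⟨z, ⟨(anc_mem H.ht z).2 h3, h2⟩, rfl⟩
    grind

end
end GFF

namespace GFF
set_option linter.all false

section
variable {T : Type} {Gt : SimpleGraph T} {d : ℕ} {o obar : T} {μT : Measure (T → ℝ)}

lemma yop_mono {q q' : ℝ → ℝ} (hq : Fn q) (hq' : Fn q') (h : ∀ a, q a ≤ q' a) (a : ℝ) :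
    yop d q a ≤ yop d q' a :=
  integral_mono (hq.integrable _ (by fun_prop)) (hq'.integrable _ (by fun_prop)) fun x => h _

lemma bst_mono {y y' : ℝ → ℝ} (hy' : Fn y') (h : ∀ a, y a ≤ y' a) (t : ℝ) (j : ℕ) (a : ℝ) :
    bst t j y a ≤ bst t j y' a := by
  unfold bst
  split_ifs
  · have := pow_le_pow_left₀ (by linarith [hy'.le a] : 0 ≤ 1 - y' a) (by grind : 1 - y' a ≤ 1 - y a) j
    linarith
  grind

lemma Qn_anti (h : ℝ) (n : ℕ) (a : ℝ) : Qn d h (n+1) a ≤ Qn d h n a := by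
  induction n generalizing a with
  | zero =>
    by_cases ha : h ≤ a
    · have : Qn d h 0 a = 1 := by simp [Qn, ha]
      rw [this]; exact (Qn_Fn h 1).le a
    · rw [Qn_lt ha, Qn_lt ha]
  | succ n ih =>
    exact bst_mono (Qn_Fn h n).yop (fun b => yop_mono (Qn_Fn h (n+1)) (Qn_Fn h n) ih b) h (d-1) a

noncomputable def Qi (d : ℕ) (h : ℝ) (a : ℝ) : ℝ := ⨅ n, Qn d h n a

lemma Qi_tendsto (h a : ℝ) : Tendsto (fun n => Qn d h n a) atTop (nhds (Qi d h a)) :=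
  tendsto_atTop_ciInf (antitone_nat_of_succ_le fun n => Qn_anti h n a)
    ⟨0, by rintro _ ⟨n, rfl⟩; exact (Qn_Fn h n).nn a⟩

lemma Qi_Fn (h : ℝ) : Fn (Qi d h) := by
  refine ⟨Measurable.iInf fun n => (Qn_Fn h n).meas, fun a => ?_, fun a => ?_⟩
  · exact ge_of_tendsto' (Qi_tendsto h a) fun n => (Qn_Fn h n).nn a
  · exact le_of_tendsto' (Qi_tendsto h a) fun n => (Qn_Fn h n).le a

lemma yop_tendsto (h a : ℝ) : Tendsto (fun n => yop d (Qn d h n) a) atTop (nhds (yop d (Qi d h) a)) := by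
  unfold yop
  refine tendsto_integral_of_dominated_convergence (fun _ => 1) (fun n => ?_) (integrable_const _) (fun n => ?_) ?_
  · exact ((Qn_Fn h n).integrable _ (by fun_prop)).aestronglyMeasurable
  · exact ae_of_all _ fun x => by
      rw [norm_eq_abs, abs_of_nonneg ((Qn_Fn h n).nn _)]; exact (Qn_Fn h n).le _
  · exact ae_of_all _ fun x => Qi_tendsto h _

lemma bst_tendsto (h : ℝ) (j : ℕ) (a : ℝ) : Tendsto (fun n => bst h j (yop d (Qn d h n)) a) atTop
    (nhds (bst h j (yop d (Qi d h)) a)) := by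
  unfold bst
  split_ifs
  · exact tendsto_const_nhds.sub ((tendsto_const_nhds.sub (yop_tendsto h a)).pow j)
  · exact tendsto_const_nhds

lemma Qi_fix (h a : ℝ) : Qi d h a = bst h (d-1) (yop d (Qi d h)) a := by
  refine tendsto_nhds_unique ((Qi_tendsto h a).comp (tendsto_add_atTop_nat 1)) ?_
  exact bst_tendsto h (d-1) a

noncomputable def etaJ (d : ℕ) (j : ℕ) (h : ℝ) : ℝ :=
  ∫ a, bst h j (yop d (Qi d h)) a ∂(gaussianReal 0 (nvar d))

lemma eta_eq (H : TH Gt d μT) {R : Set T} {j : ℕ} (hR : RS Gt o R j) (h : ℝ) :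
    μT.real {ω | (levelComp Gt h ω o ∩ R).Infinite} = etaJ d j h := by
  haveI := H.hμ.1
  rw [inf_iff H hR h]
  have h1 : Tendsto (fun n => μT (reach Gt o R h (n+1))) atTop (nhds (μT (⋂ n, reach Gt o R h (n+1)))) := by
    refine tendsto_measure_iInter_atTop (fun n => (reach_meas H R h (n+1)).nullMeasurableSet) ?_
      ⟨0, measure_ne_top _ _⟩
    refine antitone_nat_of_succ_le fun n => ?_
    rintro ω ⟨z, h1, h2, h3⟩
    exact ⟨par Gt o z, by rw [par_depth H.ht, h1]; omega, hR.up z h2, (anc_iff.1 h3).2⟩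
  have h2 : Tendsto (fun n => μT.real (reach Gt o R h (n+1))) atTop
      (nhds (μT.real (⋂ n, reach Gt o R h (n+1)))) :=
    (ENNReal.tendsto_toReal (measure_ne_top _ _)).comp h1
  refine tendsto_nhds_unique h2 ?_
  simp only [reach_prob H hR h]
  unfold etaJ
  refine tendsto_integral_of_dominated_convergence (fun _ => 1) (fun n => ?_) (integrable_const _) (fun n => ?_) ?_
  · exact (((Qn_Fn h n).yop).bst h j).meas.aestronglyMeasurable
  · exact ae_of_all _ fun x => by
      have := ((Qn_Fn (d := d) h n).yop (d := d)).bst h j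
      rw [norm_eq_abs, abs_of_nonneg (this.nn _)]; exact this.le _
  · exact ae_of_all _ fun x => bst_tendsto h j x

lemma etaJ_mono {j k : ℕ} (hjk : j ≤ k) (h : ℝ) : etaJ d j h ≤ etaJ d k h := by
  have hF := (Qi_Fn (d := d) h).yop (d := d)
  refine integral_mono ((hF.bst h j).integrable _ measurable_id) ((hF.bst h k).integrable _ measurable_id) fun a => ?_
  simp only [bst, id]
  split_ifs
  · have := pow_le_pow_of_le_one (by linarith [hF.le a] : 0 ≤ 1 - yop d (Qi d h) a) (by linarith [hF.nn a]) hjk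
    linarith
  grind

lemma etaJ_pos {j k : ℕ} (hj : j ≠ 0) (h : ℝ) (hpos : 0 < etaJ d k h) : 0 < etaJ d j h := by
  have hF := (Qi_Fn (d := d) h).yop (d := d)
  by_contra hc
  have h0 : etaJ d j h = 0 := le_antisymm (not_lt.1 hc) (integral_nonneg fun a => (hF.bst h j).nn a)
  have h1 := (integral_eq_zero_iff_of_nonneg (fun a => (hF.bst h j).nn a) ((hF.bst h j).integrable _ measurable_id)).1 h0
  have h2 : etaJ d k h = 0 := by
    unfold etaJ
    rw [integral_eq_zero_iff_of_nonneg (fun a => (hF.bst h k).nn a) ((hF.bst h k).integrable _ measurable_id)]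
    filter_upwards [h1] with a ha
    simp only [bst, Pi.zero_apply] at ha ⊢
    split_ifs with h3
    · rw [if_pos h3] at ha
      have h4 : (1 - yop d (Qi d h) a) ^ j = 1 := by linarith
      have h5 : 1 - yop d (Qi d h) a = 1 := (pow_eq_one_iff_of_nonneg (by linarith [hF.le a]) hj).1 h4
      rw [h5]; simp
    · rfl
  linarith

lemma Qn_monoa (hd : 3 ≤ d) (h : ℝ) (n : ℕ) : Monotone (Qn d h n) := by
  have h3 : (3:ℝ) ≤ d := by exact_mod_cast hd
  have hr : (0:ℝ) ≤ ((d:ℝ)-1)⁻¹ := inv_nonneg.2 (by linarith)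
  induction n with
  | zero =>
    intro a b hab
    simp only [Qn]
    grind
  | succ n ih =>
    intro a b hab
    have hF := (Qn_Fn (d := d) h n).yop (d := d)
    have hy : yop d (Qn d h n) a ≤ yop d (Qn d h n) b :=
      integral_mono ((Qn_Fn h n).integrable _ (by fun_prop)) ((Qn_Fn h n).integrable _ (by fun_prop)) fun x =>
        ih (by have := mul_le_mul_of_nonneg_left hab hr; linarith)
    simp only [Qn, bst]
    split_ifs with h1 h2
    · have := pow_le_pow_left₀ (by linarith [hF.le b] : 0 ≤ 1 - yop d (Qn d h n) b) (by linarith) (d-1) (b := 1 - yop d (Qn d h n) a)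
      linarith
    · grind
    · have := (hF.bst h (d-1)).nn b
      simpa [bst, *] using this
    grind

lemma Qi_monoa (hd : 3 ≤ d) (h : ℝ) : Monotone (Qi d h) := fun a b hab =>
  le_of_tendsto_of_tendsto' (Qi_tendsto h a) (Qi_tendsto h b) fun n => Qn_monoa hd h n hab

lemma gauss_Ico {v : ℝ≥0} (hv : v ≠ 0) : ∃ C : ℝ, 0 < C ∧ ∀ s t : ℝ, s ≤ t →
    (gaussianReal 0 v).real (Ico s t) ≤ C * (t - s) := by
  refine ⟨(Real.sqrt (2 * Real.pi * v))⁻¹, ?_, fun s t hst => ?_⟩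
  · positivity
  · have h1 : gaussianReal 0 v (Ico s t) ≤ ENNReal.ofReal ((Real.sqrt (2 * Real.pi * v))⁻¹) * volume (Ico s t) := by
      rw [gaussianReal_apply 0 hv]
      rw [← setLIntegral_const]
      refine lintegral_mono fun x => ENNReal.ofReal_le_ofReal ?_
      unfold gaussianPDFReal
      refine mul_le_of_le_one_right (by positivity) (exp_le_one_iff.2 ?_)
      have : 0 ≤ (x - 0) ^ 2 / (2 * (v:ℝ)) := by positivity
      grind
    rw [volume_Ico, ← ENNReal.ofReal_mul (by positivity)] at h1
    exact ENNReal.toReal_le_of_le_ofReal (mul_nonneg (by positivity) (by linarith)) h1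

lemma gauss_pos {v : ℝ≥0} (hv : v ≠ 0) (s t : ℝ) (h : s < t) : 0 < (gaussianReal 0 v).real (Ico s t) := by
  have h1 : (volume : Measure ℝ) ≪ gaussianReal 0 v := gaussianReal_absolutelyContinuous' 0 hv
  refine ENNReal.toReal_pos ?_ (measure_ne_top _ _)
  intro h0
  have := h1 h0
  rw [volume_Ico] at this
  simp at this
  linarith

lemma gvar_ne (hd : 3 ≤ d) : gvar d ≠ 0 := by
  unfold gvar
  have h1 : (d:ℝ≥0) ≠ 0 := by positivity
  have h2 : ((d-1:ℕ):ℝ≥0) ≠ 0 := by exact_mod_cast (by omega : d - 1 ≠ 0)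
  positivity
lemma nvar_ne (hd : 3 ≤ d) : nvar d ≠ 0 := by
  unfold nvar
  have h1 : ((d-1:ℕ):ℝ≥0) ≠ 0 := by exact_mod_cast (by omega : d - 1 ≠ 0)
  have h2 : ((d-2:ℕ):ℝ≥0) ≠ 0 := by exact_mod_cast (by omega : d - 2 ≠ 0)
  positivity

lemma jensen0 (e u : ℝ) (he : 0 ≤ e) (he1 : e ≤ 1) (hu : 0 ≤ u) (hu1 : u ≤ 1) (m : ℕ) :
    ((1 - e) + e * u) ^ m ≤ (1 - e) + e * u ^ m := by
  induction m with
  | zero => simp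
  | succ m ih =>
    have h1 : 0 ≤ (1 - e) + e * u := by nlinarith
    have h2 := mul_le_mul_of_nonneg_right ih h1
    have h3 : u ^ m ≤ 1 := pow_le_one₀ hu hu1
    have h4 : 0 ≤ e * (1 - e) * ((1 - u) * (1 - u ^ m)) := by
      positivity
    rw [pow_succ, pow_succ]
    nlinarith

lemma jensen1 (e y : ℝ) (he : 0 ≤ e) (he1 : e ≤ 1) (hy : 0 ≤ y) (hy1 : y ≤ 1) (m : ℕ) (hm : 2 ≤ m) :
    e * (1 - (1 - y) ^ m) + e * (1 - e) * y ^ 2 ≤ 1 - (1 - e * y) ^ m := by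
  obtain ⟨k, rfl⟩ : ∃ k, m = k + 1 + 1 := ⟨m - 2, by omega⟩
  have h0 := jensen0 e (1 - y) he he1 (by linarith) (by linarith) (k+1)
  have h1 : 0 ≤ (1 - e) + e * (1 - y) := by nlinarith
  have h2 := mul_le_mul_of_nonneg_right h0 h1
  have h3 : (1 - y) ^ (k+1) ≤ (1 - y) ^ 1 := pow_le_pow_of_le_one (by linarith) (by linarith) (by omega)
  have h4 : 0 ≤ e * (1 - e) * (y * ((1 - y) ^ 1 - (1 - y) ^ (k+1))) := by
    positivity
  have e1 : (1 - e * y) = (1 - e) + e * (1 - y) := by ring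
  rw [e1, pow_succ ((1 - e) + e * (1 - y)), pow_succ (1 - y)]
  nlinarith

lemma pow_lip (a b : ℝ) (ha : 0 ≤ a) (hab : a ≤ b) (hb : b ≤ 1) (m : ℕ) : b ^ m ≤ a ^ m + m * (b - a) := by
  induction m with
  | zero => simp
  | succ m ih =>
    have h1 : b ^ m ≤ 1 := pow_le_one₀ (by linarith) hb
    have h2 : 0 ≤ a ^ m := pow_nonneg ha m
    have h3 : a * b ^ m ≤ a * (a ^ m + m * (b - a)) := mul_le_mul_of_nonneg_left ih ha
    have h4 : (b - a) * b ^ m ≤ (b - a) * 1 := mul_le_mul_of_nonneg_left h1 (by linarith)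
    have h5 : a * (m * (b - a)) ≤ 1 * (m * (b - a)) :=
      mul_le_mul_of_nonneg_right (by linarith) (mul_nonneg (Nat.cast_nonneg _) (by linarith))
    rw [pow_succ, pow_succ]; grind

end
end GFF

namespace GFF
set_option linter.all false

section
local notation "𝟏" => (fun _ => (1:ℝ))
local notation "δ(" x ")" => ((x:ℝ)-1)
variable {T : Type} {Gt : SimpleGraph T} {d : ℕ} {o obar : T} {μT : Measure (T → ℝ)}

lemma Qi_lt {h a : ℝ} (ha : ¬ h ≤ a) : Qi d h a = 0 := by
  unfold Qi; simp [Qn_lt ha]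

noncomputable def wf (d : ℕ) (h h' e : ℝ) (a : ℝ) : ℝ := e * (if h' ≤ a then Qi d h a else 0)

lemma wf_Fn (h h' e : ℝ) (he : 0 ≤ e) (he1 : e ≤ 1) : Fn (wf d h h' e) := by
  have hF := Qi_Fn (d := d) h
  refine ⟨?_, fun a => ?_, fun a => ?_⟩
  · exact measurable_const.mul (Measurable.ite measurableSet_Ici hF.meas measurable_const)
  · unfold wf; split_ifs
    · exact mul_nonneg he (hF.nn a)
    · simp
  · unfold wf; split_ifs
    · exact mul_le_one₀ he1 (hF.nn a) (hF.le a)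
    · simp

lemma wf_yop (hd : 3 ≤ d) : ∃ C : ℝ, 0 < C ∧ ∀ (h h' e : ℝ), h ≤ h' → 0 ≤ e → e ≤ 1 → ∀ a,
    e * (yop d (Qi d h) a - C * (h' - h)) ≤ yop d (wf d h h' e) a := by
  obtain ⟨C, hC, hI⟩ := gauss_Ico (gvar_ne hd)
  refine ⟨C, hC, fun h h' e hh he he1 a => ?_⟩
  have hF := Qi_Fn (d := d) h
  have hW := wf_Fn (d := d) h h' e he he1
  set s := δ(d)⁻¹ * a
  have h1 : yop d (Qi d h) a - (gaussianReal 0 (gvar d)).real (Ico (h - s) (h' - s)) =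
      ∫ x, (Qi d h (s + x) - (Ico (h - s) (h' - s)).indicator 𝟏 x) ∂(gaussianReal 0 (gvar d)) := by
    rw [integral_sub (hF.integrable _ (by fun_prop)) ((integrable_const _).indicator measurableSet_Ico),
      integral_indicator_const _ measurableSet_Ico]
    simp [yop, s]
  have h2 : e * (yop d (Qi d h) a - (gaussianReal 0 (gvar d)).real (Ico (h - s) (h' - s))) ≤ yop d (wf d h h' e) a := by
    rw [h1, ← integral_const_mul]
    refine integral_mono (Integrable.const_mul (Integrable.sub (hF.integrable _ (by fun_prop)) ((integrable_const _).indicator measurableSet_Ico)) _) (hW.integrable _ (by fun_prop)) fun x => ?_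
    simp only [wf]
    refine mul_le_mul_of_nonneg_left ?_ he
    by_cases hx : h' ≤ s + x
    · rw [if_pos hx]
      have : 0 ≤ (Ico (h - s) (h' - s)).indicator 𝟏 x := indicator_nonneg (fun _ _ => zero_le_one) _
      linarith
    · rw [if_neg hx]
      by_cases hx2 : h ≤ s + x
      · have : x ∈ Ico (h - s) (h' - s) := ⟨by linarith, by linarith⟩
        rw [indicator_of_mem this]
        linarith [hF.le (s + x)]
      · rw [Qi_lt hx2]
        have : 0 ≤ (Ico (h - s) (h' - s)).indicator 𝟏 x := indicator_nonneg (fun _ _ => zero_le_one) _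
        linarith
  have h3 := hI (h - s) (h' - s) (by linarith)
  have h4 : h' - s - (h - s) = h' - h := by ring
  rw [h4] at h3
  refine le_trans (mul_le_mul_of_nonneg_left ?_ he) h2
  linarith

lemma y_lower (hd : 3 ≤ d) (h : ℝ) (hne : ∃ a, Qi d h a ≠ 0) :
    ∃ y0 > 0, ∀ a, h ≤ a → y0 ≤ yop d (Qi d h) a := by
  obtain ⟨a0, ha0⟩ := hne
  have hF := Qi_Fn (d := d) h
  have hp : 0 < Qi d h a0 := lt_of_le_of_ne (hF.nn a0) (Ne.symm ha0)
  have h3 : (3:ℝ) ≤ d := by exact_mod_cast hd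
  have hr : (0:ℝ) ≤ δ(d)⁻¹ := inv_nonneg.2 (by linarith)
  set s := δ(d)⁻¹ * h
  refine ⟨Qi d h a0 * (gaussianReal 0 (gvar d)).real (Ico (a0 - s) (a0 - s + 1)), mul_pos hp (gauss_pos (gvar_ne hd) _ _ (by linarith)), fun a ha => ?_⟩
  have hs : s ≤ δ(d)⁻¹ * a := mul_le_mul_of_nonneg_left ha hr
  have h1 : Qi d h a0 * (gaussianReal 0 (gvar d)).real (Ico (a0 - s) (a0 - s + 1)) =
      ∫ x, (Ico (a0 - s) (a0 - s + 1)).indicator (fun _ => Qi d h a0) x ∂(gaussianReal 0 (gvar d)) := by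
    rw [integral_indicator_const _ measurableSet_Ico, smul_eq_mul, mul_comm]
  rw [h1]
  refine integral_mono ((integrable_const _).indicator measurableSet_Ico) (hF.integrable _ (by fun_prop)) fun x => ?_
  simp only [indicator]
  split_ifs with hx
  · exact Qi_monoa hd h (by linarith [hx.1])
  · exact hF.nn _

lemma etaJ_nonneg (j : ℕ) (h : ℝ) : 0 ≤ etaJ d j h :=
  integral_nonneg fun a => (((Qi_Fn (d := d) h).yop (d := d)).bst h j).nn a

lemma phi_low (m : ℕ) (y y' : ℝ) (h0 : 0 ≤ y) (h1 : y ≤ 1) (h0' : 0 ≤ y') (h1' : y' ≤ 1) (t : ℝ) (ht : 0 ≤ t)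
    (h : y - t ≤ y') : 1 - (1 - y) ^ m - m * t ≤ 1 - (1 - y') ^ m := by
  have hm : (0:ℝ) ≤ m := Nat.cast_nonneg _
  by_cases hc : y ≤ y'
  · have := pow_le_pow_left₀ (by linarith : 0 ≤ 1 - y') (by linarith : 1 - y' ≤ 1 - y) m
    nlinarith
  · have := pow_lip (1 - y) (1 - y') (by linarith) (by linarith) (by linarith) m
    have h2 : (m:ℝ) * (1 - y' - (1 - y)) ≤ m * t := mul_le_mul_of_nonneg_left (by linarith) hm
    linarith

lemma Qn_ge_w (hd : 3 ≤ d) {C y0 h h' e : ℝ} (hhh : h ≤ h') (he : 0 ≤ e) (he1 : e ≤ 1) (hy0 : 0 ≤ y0)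
    (hC : ∀ a, e * (yop d (Qi d h) a - C * (h' - h)) ≤ yop d (wf d h h' e) a) (hC0 : 0 ≤ C)
    (hy : ∀ a, h ≤ a → y0 ≤ yop d (Qi d h) a)
    (hs : ((d-1 : ℕ) : ℝ) * (C * (h' - h)) ≤ (1 - e) * y0 ^ 2) (n : ℕ) (a : ℝ) :
    wf d h h' e a ≤ Qn d h' n a := by
  induction n generalizing a with
  | zero =>
    have := (wf_Fn (d := d) h h' e he he1).le a
    by_cases ha : h' ≤ a
    · simpa [Qn, ha] using this
    · simp [Qn, ha, wf]
  | succ n ih =>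
    have hF := (Qi_Fn (d := d) h).yop (d := d)
    have hW := (wf_Fn (d := d) h h' e he he1).yop (d := d)
    have h1 := bst_mono ((Qn_Fn (d := d) h' n).yop (d := d)) (fun b => yop_mono (wf_Fn (d := d) h h' e he he1) (Qn_Fn h' n) ih b) h' (d-1) a
    refine le_trans ?_ h1
    by_cases ha : h' ≤ a
    · simp only [wf, bst, if_pos ha]
      rw [Qi_fix]
      simp only [bst, if_pos (hhh.trans ha)]
      have h2 := jensen1 e (yop d (Qi d h) a) he he1 (hF.nn a) (hF.le a) (d-1) (by omega)
      have ht : 0 ≤ C * (h' - h) := mul_nonneg hC0 (by linarith)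
      have h3 := phi_low (d-1) (e * yop d (Qi d h) a) (yop d (wf d h h' e) a) (mul_nonneg he (hF.nn a))
        (mul_le_one₀ he1 (hF.nn a) (hF.le a)) (hW.nn a) (hW.le a) (e * (C * (h' - h))) (mul_nonneg he ht)
        (by have := hC a; linarith)
      have h4 : y0 ^ 2 ≤ (yop d (Qi d h) a) ^ 2 := pow_le_pow_left₀ hy0 (hy a (hhh.trans ha)) 2
      have h5 : ((d-1 : ℕ) : ℝ) * (e * (C * (h' - h))) ≤ e * (1 - e) * (yop d (Qi d h) a) ^ 2 := by
        have e1 : ((d-1 : ℕ) : ℝ) * (e * (C * (h' - h))) = e * (((d-1 : ℕ) : ℝ) * (C * (h' - h))) := by ring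
        rw [e1, mul_assoc]
        refine mul_le_mul_of_nonneg_left (hs.trans ?_) he
        exact mul_le_mul_of_nonneg_left h4 (by linarith)
      have h6 : wf d h h' e = fun a => e * (if h' ≤ a then Qi d h a else 0) := rfl
      linarith
    · simp [wf, bst, ha]

lemma etaJ_rc (hd : 3 ≤ d) (j : ℕ) (h : ℝ) {δ : ℝ} (hδ : 0 < δ) :
    ∃ ε > 0, ∀ h', h ≤ h' → h' ≤ h + ε → etaJ d j h - δ ≤ etaJ d j h' := by
  by_cases hne : ∃ a, Qi d h a ≠ 0
  swap
  · push Not at hne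
    refine ⟨1, one_pos, fun h' _ _ => ?_⟩
    have : etaJ d j h = 0 := by
      unfold etaJ
      have : ∀ a, bst h j (yop d (Qi d h)) a = 0 := by
        intro a; simp [bst, yop, hne]
      simp [this]
    rw [this]
    linarith [etaJ_nonneg (d := d) j h']
  obtain ⟨y0, hy0, hy⟩ := y_lower hd h hne
  obtain ⟨C, hC, hw⟩ := wf_yop hd
  obtain ⟨C2, hC2, hI⟩ := gauss_Ico (nvar_ne hd)
  obtain ⟨η, hη, hη1, hη2⟩ : ∃ η : ℝ, 0 < η ∧ η ≤ 1 ∧ j * η ≤ δ / 3 := by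
    refine ⟨min 1 (δ / 3 / (j + 1)), by positivity, min_le_left _ _, ?_⟩
    have h1 : (j:ℝ) * min 1 (δ / 3 / (j + 1)) ≤ (j+1) * (δ / 3 / (j + 1)) := by
      refine mul_le_mul (by linarith) (min_le_right _ _) (by positivity) (by positivity)
    refine h1.trans (le_of_eq ?_)
    field_simp
  have hd1 : (0:ℝ) ≤ ((d-1:ℕ):ℝ) := Nat.cast_nonneg _
  have hj : (0:ℝ) ≤ (j:ℝ) := Nat.cast_nonneg _
  obtain ⟨ε, hε, he1, he2, he3⟩ : ∃ ε : ℝ, 0 < ε ∧ ((d-1:ℕ):ℝ) * (C * ε) ≤ η * y0 ^ 2 ∧ j * (C * ε) ≤ δ / 3 ∧ C2 * ε ≤ δ / 3 := by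
    refine ⟨min (η * y0 ^ 2 / ((((d-1:ℕ):ℝ) + 1) * C)) (min (δ / 3 / ((j + 1) * C)) (δ / 3 / C2)), by positivity, ?_, ?_, ?_⟩
    · refine (mul_le_mul (by linarith : ((d-1:ℕ):ℝ) ≤ ((d-1:ℕ):ℝ) + 1) (mul_le_mul_of_nonneg_left (min_le_left _ _) hC.le) (by positivity) (by positivity)).trans (le_of_eq ?_)
      field_simp
    · refine (mul_le_mul (by linarith : (j:ℝ) ≤ j + 1) (mul_le_mul_of_nonneg_left ((min_le_right _ _).trans (min_le_left _ _)) hC.le) (by positivity) (by positivity)).trans (le_of_eq ?_)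
      field_simp
    · refine (mul_le_mul_of_nonneg_left ((min_le_right _ _).trans (min_le_right _ _)) hC2.le).trans (le_of_eq ?_)
      field_simp
  refine ⟨ε, hε, fun h' hh hh' => ?_⟩
  have hd' : h' - h ≤ ε := by linarith
  have e0 : (0:ℝ) ≤ 1 - η := by linarith
  have e1 : 1 - η ≤ 1 := by linarith
  have hF := (Qi_Fn (d := d) h).yop (d := d)
  have hF' := (Qi_Fn (d := d) h').yop (d := d)
  have hwa := hw h h' (1-η) hh e0 e1
  have hCe : C * (h' - h) ≤ C * ε := mul_le_mul_of_nonneg_left hd' hC.le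
  have hge : ∀ n a, wf d h h' (1-η) a ≤ Qn d h' n a := fun n a =>
    Qn_ge_w hd hh e0 e1 hy0.le hwa hC.le hy
      ((mul_le_mul_of_nonneg_left hCe hd1).trans (by linarith)) n a
  have hge' : ∀ a, wf d h h' (1-η) a ≤ Qi d h' a := fun a => le_ciInf fun n => hge n a
  have hyy : ∀ a, (1-η) * (yop d (Qi d h) a - C * (h' - h)) ≤ yop d (Qi d h') a := fun a =>
    (hwa a).trans (yop_mono (wf_Fn h h' _ e0 e1) (Qi_Fn h') hge' a)
  have key : ∀ a, bst h j (yop d (Qi d h)) a - 2 * δ / 3 - (Ico h h').indicator 𝟏 a ≤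
      bst h' j (yop d (Qi d h')) a := by
    intro a
    by_cases ha : h' ≤ a
    · have hi : 0 ≤ (Ico h h').indicator 𝟏 a := indicator_nonneg (fun _ _ => zero_le_one) _
      simp only [bst, if_pos ha, if_pos (hh.trans ha)]
      have h1 := phi_low j (yop d (Qi d h) a) (yop d (Qi d h') a) (hF.nn a) (hF.le a) (hF'.nn a) (hF'.le a)
        (η + C * (h' - h)) (by have := mul_nonneg hC.le (by linarith : 0 ≤ h' - h); linarith)
        (by have := hyy a; have := hF.le a; have := hF.nn a; have := mul_nonneg hC.le (by linarith : 0 ≤ h' - h); nlinarith)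
      have h2 : (j:ℝ) * (η + C * (h' - h)) ≤ 2 * δ / 3 := by
        have := mul_le_mul_of_nonneg_left hCe hj
        rw [mul_add]; linarith
      linarith
    · have hn := (hF'.bst h' j).nn a
      by_cases ha2 : h ≤ a
      · rw [indicator_of_mem (show a ∈ Ico h h' from ⟨ha2, by linarith⟩)]
        have := (hF.bst h j).le a
        linarith
      · have hi : 0 ≤ (Ico h h').indicator 𝟏 a := indicator_nonneg (fun _ _ => zero_le_one) _
        have : bst h j (yop d (Qi d h)) a = 0 := by simp [bst, ha2]
        linarith
  have i1 : Integrable (fun a => bst h j (yop d (Qi d h)) a) (gaussianReal 0 (nvar d)) := (hF.bst h j).integrable _ measurable_id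
  have i2 : Integrable (fun a => bst h' j (yop d (Qi d h')) a) (gaussianReal 0 (nvar d)) := (hF'.bst h' j).integrable _ measurable_id
  have i3 : Integrable ((Ico h h').indicator 𝟏) (gaussianReal 0 (nvar d)) :=
    (integrable_const _).indicator measurableSet_Ico
  have i4 : Integrable (fun a => bst h j (yop d (Qi d h)) a - 2 * δ / 3) (gaussianReal 0 (nvar d)) :=
    i1.sub (integrable_const _)
  have := integral_mono (i4.sub i3) i2 key
  have e3 : ∫ a, ((fun a => bst h j (yop d (Qi d h)) a - 2 * δ / 3) - (Ico h h').indicator 𝟏) a ∂(gaussianReal 0 (nvar d))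
      = etaJ d j h - 2 * δ / 3 - (gaussianReal 0 (nvar d)).real (Ico h h') := by
    simp only [Pi.sub_apply]
    rw [integral_sub i4 i3, integral_sub i1 (integrable_const _), integral_indicator_const _ measurableSet_Ico]
    simp [etaJ]
  rw [e3] at this
  have h5 := hI h h' hh
  have h6 := mul_le_mul_of_nonneg_left hd' hC2.le
  have h7 : ∫ a, bst h' j (yop d (Qi d h')) (id a) ∂(gaussianReal 0 (nvar d)) = etaJ d j h' := rfl
  have h8 : ∫ a, bst h' j (yop d (Qi d h')) a ∂(gaussianReal 0 (nvar d)) = etaJ d j h' := rfl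
  first
  | rw [h7] at this; linarith
  | rw [h8] at this; linarith

lemma etaJ_neg (hd : 3 ≤ d) : ∃ H0 : ℝ, ∀ h ≤ H0, 0 < etaJ d d h := by
  have h3 : (3:ℝ) ≤ d := by exact_mod_cast hd
  have hr : (0:ℝ) < δ(d)⁻¹ := inv_pos.2 (by linarith)
  have hr1 : δ(d)⁻¹ < 1 := inv_lt_one_of_one_lt₀ (by linarith)
  set r := δ(d)⁻¹ with hrdef
  have hlim : Tendsto (fun n : ℕ => (gaussianReal 0 (gvar d)) (Ici (-(n:ℝ)))) atTop (nhds ((gaussianReal 0 (gvar d)) (⋃ n : ℕ, Ici (-(n:ℝ))))) := by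
    refine tendsto_measure_iUnion_atTop ?_
    intro a b hab x hx
    have : (a:ℝ) ≤ b := by exact_mod_cast hab
    simp only [mem_Ici] at hx ⊢; linarith
  have hU : (⋃ n : ℕ, Ici (-(n:ℝ))) = univ := by
    ext x
    simp only [mem_iUnion, mem_Ici, mem_univ, iff_true]
    obtain ⟨n, hn⟩ := exists_nat_ge (-x)
    exact ⟨n, by linarith⟩
  rw [hU, measure_univ] at hlim
  have hlim2 := (ENNReal.tendsto_toReal (by simp : (1:ℝ≥0∞) ≠ ⊤)).comp hlim
  have hev := hlim2.eventually (lt_mem_nhds (show (3/4:ℝ) < (1:ℝ≥0∞).toReal by norm_num))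
  obtain ⟨n, hn⟩ := hev.exists
  refine ⟨-(n:ℝ) / (1 - r), fun h hh => ?_⟩
  have hh2 : h * (1 - r) ≤ -(n:ℝ) := by rwa [le_div_iff₀ (by linarith)] at hh
  have hn' : 3/4 ≤ (gaussianReal 0 (gvar d)).real (Ici (-(n:ℝ))) := le_of_lt hn
  have hyop : ∀ q : ℝ → ℝ, Fn q → (∀ a, h ≤ a → 1/2 ≤ q a) → ∀ a, h ≤ a → 3/8 ≤ yop d q a := by
    intro q hq hq2 a ha
    have h1 : (1/2) * (gaussianReal 0 (gvar d)).real (Ici (-(n:ℝ))) =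
        ∫ x, (Ici (-(n:ℝ))).indicator (fun _ => (1/2:ℝ)) x ∂(gaussianReal 0 (gvar d)) := by
      rw [integral_indicator_const _ measurableSet_Ici, smul_eq_mul, mul_comm]
    have h2 : (1/2) * (gaussianReal 0 (gvar d)).real (Ici (-(n:ℝ))) ≤ yop d q a := by
      rw [h1]
      refine integral_mono ((integrable_const _).indicator measurableSet_Ici) (hq.integrable _ (by fun_prop)) fun x => ?_
      simp only [indicator]
      split_ifs with hx
      · refine hq2 _ ?_
        have hx' : -(n:ℝ) ≤ x := hx
        have := mul_le_mul_of_nonneg_left ha hr.le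
        rw [← hrdef]
        nlinarith
      · exact hq.nn _
    linarith
  have hQ : ∀ n a, h ≤ a → 1/2 ≤ Qn d h n a := by
    intro k
    induction k with
    | zero => intro a ha; simp [Qn, ha]; norm_num
    | succ k ih =>
      intro a ha
      have hF := (Qn_Fn (d := d) h k).yop (d := d)
      have h1 := hyop _ (Qn_Fn h k) ih a ha
      simp only [Qn, bst, if_pos ha]
      have h2 : (1 - yop d (Qn d h k) a) ^ (d-1) ≤ (1 - yop d (Qn d h k) a) ^ 2 :=
        pow_le_pow_of_le_one (by linarith [hF.le a]) (by linarith) (by omega)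
      have h4 : (1 - yop d (Qn d h k) a) ^ 2 ≤ (5/8) ^ 2 := pow_le_pow_left₀ (by linarith [hF.le a]) (by linarith) 2
      norm_num at h4
      linarith
  have hQi : ∀ a, h ≤ a → 1/2 ≤ Qi d h a := fun a ha => le_ciInf fun n => hQ n a ha
  have hF := (Qi_Fn (d := d) h).yop (d := d)
  have hpos := gauss_pos (nvar_ne hd) h (h+1) (by linarith)
  have h1 : (3/8) * (gaussianReal 0 (nvar d)).real (Ico h (h+1)) =
      ∫ x, (Ico h (h+1)).indicator (fun _ => (3/8:ℝ)) x ∂(gaussianReal 0 (nvar d)) := by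
    rw [integral_indicator_const _ measurableSet_Ico, smul_eq_mul, mul_comm]
  refine lt_of_lt_of_le (mul_pos (by norm_num : (0:ℝ) < 3/8) hpos) ?_
  rw [h1]
  refine integral_mono ((integrable_const _).indicator measurableSet_Ico) ((hF.bst h d).integrable _ measurable_id) fun x => ?_
  simp only [indicator, id]
  split_ifs with hx
  · have h1 := hyop _ (Qi_Fn h) hQi x hx.1
    simp only [bst, if_pos hx.1]
    have h2 : (1 - yop d (Qi d h) x) ^ d ≤ (1 - yop d (Qi d h) x) ^ 1 :=
      pow_le_pow_of_le_one (by linarith [hF.le x]) (by linarith) (by omega)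
    linarith
  · exact (hF.bst h d).nn _

lemma etaJ_hstar (H : TH Gt d μT) (h : ℝ) (hh : h < hstar Gt o μT) : 0 < etaJ d d h := by
  haveI := H.hμ.1
  by_contra hc
  have h0 : etaJ d d h = 0 := le_antisymm (not_lt.1 hc) (etaJ_nonneg d h)
  have hmem : ∀ t, t ∈ {h : ℝ | μT {ω | (levelComp Gt h ω o).Infinite} = 0} ↔ etaJ d d t = 0 := by
    intro t
    rw [← eta_eq H (RS_univ (o := o) H.ht) t]
    simp only [Set.inter_univ, mem_setOf_eq]
    rw [measureReal_def, ENNReal.toReal_eq_zero_iff]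
    simp [measure_ne_top]
  obtain ⟨H0, hH0⟩ := etaJ_neg H.hd
  have hbdd : BddBelow {h : ℝ | μT {ω | (levelComp Gt h ω o).Infinite} = 0} := by
    refine ⟨H0, fun t ht => ?_⟩
    rw [hmem] at ht
    by_contra hlt
    have := hH0 t (by linarith)
    linarith
  have := csInf_le hbdd ((hmem h).2 h0)
  unfold hstar at hh
  linarith

end
end GFF

namespace GFF
set_option linter.all false

section
variable {T : Type} {Gt : SimpleGraph T} {d : ℕ} {o obar : T} {V : Type} [Fintype V] {G : SimpleGraph V}

def GoodB (G : SimpleGraph V) (r : ℕ) (x : V) : Prop :=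
  adjPairs G (gball G x r) < 2 * (gball G x r).ncard

lemma self_gball (G : SimpleGraph V) (x : V) (r : ℕ) : x ∈ gball G x r := by
  simp [gball]

lemma tree_edges (hc : G.Connected) {r : ℕ} {x : V} (hg : GoodB G r x) :
    ∃ p : V → V, (∀ v, v ≠ x → G.Adj v (p v) ∧ G.dist x (p v) + 1 = G.dist x v) ∧
      ∀ a ∈ gball G x r, ∀ b ∈ gball G x r, G.Adj a b → (a ≠ x ∧ b = p a) ∨ (b ≠ x ∧ a = p b) := by
  have hp : ∀ v : V, ∃ w, v ≠ x → G.Adj v w ∧ G.dist x w + 1 = G.dist x v := by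
    intro v
    by_cases h : v = x
    · exact ⟨v, fun h' => absurd h h'⟩
    · obtain ⟨w, hw⟩ := exists_pred hc x v h
      grind
  choose p hp using hp
  refine ⟨p, hp, ?_⟩
  intro a ha b hb hab
  by_contra hcon
  push Not at hcon
  set U := gball G x r with hU
  set U' := U \ {x} with hU'
  have hUc : U'.ncard + 1 = U.ncard := ncard_diff_singleton_add_one (self_gball G x r) (toFinite _)
  set F1 : Set (V × V) := (fun v => (v, p v)) '' U'
  set F2 : Set (V × V) := (fun v => (p v, v)) '' U'
  have c1 : F1.ncard = U'.ncard := ncard_image_of_injective _ (fun a b h => (Prod.ext_iff.1 h).1)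
  have c2 : F2.ncard = U'.ncard := ncard_image_of_injective _ (fun a b h => (Prod.ext_iff.1 h).2)
  have hpU : ∀ v ∈ U', p v ∈ U := by
    intro v hv
    have := (hp v hv.2).2
    have h2 : G.dist x v ≤ r := hv.1
    show G.dist x (p v) ≤ r
    omega
  have d12 : Disjoint F1 F2 := by
    grind
  set F3 : Set (V × V) := {(a, b), (b, a)}
  have c3 : F3.ncard = 2 := ncard_pair (by
    intro h; exact hab.ne (Prod.ext_iff.1 h).1)
  have d3 : Disjoint (F1 ∪ F2) F3 := by
    grind
  have hsub : F1 ∪ F2 ∪ F3 ⊆ {q : V × V | q.1 ∈ U ∧ q.2 ∈ U ∧ G.Adj q.1 q.2} := by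
    rintro q ((⟨v, hv, rfl⟩ | ⟨v, hv, rfl⟩) | (rfl | rfl))
    · grind
    · exact ⟨hpU v hv, hv.1, (hp v hv.2).1.symm⟩
    · grind
    · exact ⟨hb, ha, hab.symm⟩
  have := ncard_le_ncard hsub (toFinite _)
  rw [ncard_union_eq d3 (toFinite _) (toFinite _), ncard_union_eq d12 (toFinite _) (toFinite _), c1, c2, c3] at this
  have h2 : adjPairs G U < 2 * U.ncard := hg
  unfold adjPairs at h2
  omega

structure CV (Gt : SimpleGraph T) (G : SimpleGraph V) (d : ℕ) (o : T) (x : V) (π : T → V) : Prop where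
  ht : IsRegTree Gt d
  hd : 3 ≤ d
  hc : G.Connected
  hr : IsReg G d
  cov : IsCoverMap Gt G o x π

variable {x : V} {π : T → V}

lemma CV.adj (H : CV Gt G d o x π) {z w : T} (h : Gt.Adj z w) : G.Adj (π z) (π w) := by
  have : π w ∈ π '' (Gt.neighborSet z) := ⟨w, h, rfl⟩
  rw [H.cov.2.2 z] at this
  exact this

lemma CV.lift (H : CV Gt G d o x π) {z : T} {y : V} (h : G.Adj (π z) y) : ∃ w, Gt.Adj z w ∧ π w = y := by
  have : y ∈ π '' (Gt.neighborSet z) := by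
    rw [H.cov.2.2 z]; exact h
  exact this

lemma CV.inj (H : CV Gt G d o x π) (z : T) : Set.InjOn π (Gt.neighborSet z) := by
  refine Set.injOn_of_ncard_image_eq ?_ (nbr_fin H.ht H.hd z)
  rw [H.cov.2.2 z, nbr_ncard H.ht]
  exact H.hr (π z)

lemma CV.dist_le (H : CV Gt G d o x π) : ∀ (n : ℕ) (z : T), Gt.dist o z = n → G.dist x (π z) ≤ n := by
  intro n
  induction n with
  | zero => intro z hz; rw [dist_o_eq_zero H.ht] at hz; subst hz; rw [H.cov.1]; simp
  | succ n ih =>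
    intro z hz
    have hzo : z ≠ o := by grind
    have h1 := par_spec H.ht hzo
    have h2 := ih (par Gt o z) (by omega)
    have := adj_dist H.hc x (H.adj h1.1.symm)
    omega

lemma CV.ball_sub (H : CV Gt G d o x π) : ∀ (n : ℕ) (y : V), G.dist x y ≤ n → ∃ z, Gt.dist o z ≤ n ∧ π z = y := by
  intro n
  induction n with
  | zero =>
    intro y hy
    have : x = y := by
      have h0 : G.dist x y = 0 := by omega
      exact ((H.hc x y).dist_eq_zero_iff).1 h0
    exact ⟨o, by simp, by rw [H.cov.1, this]⟩
  | succ n ih =>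
    intro y hy
    by_cases hyx : y = x
    · grind
    · obtain ⟨w, hw1, hw2⟩ := exists_pred H.hc x y hyx
      obtain ⟨z, hz1, hz2⟩ := ih w (by omega)
      rw [← hz2] at hw1
      obtain ⟨z', h1, h2⟩ := H.lift hw1.symm
      refine ⟨z', ?_, h2⟩
      have := adj_dist H.ht.1 o h1
      omega

lemma CV.good (H : CV Gt G d o x π) {r : ℕ} (hg : GoodB G r x) :
    (∀ z, Gt.dist o z ≤ r → G.dist x (π z) = Gt.dist o z) ∧ Set.InjOn π (gball Gt o r) := by
  obtain ⟨p, hp, hE⟩ := tree_edges H.hc hg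
  have key : ∀ n ≤ r, ∀ z, Gt.dist o z = n → G.dist x (π z) = n ∧ (z ≠ o → π (par Gt o z) = p (π z)) := by
    intro n
    induction n with
    | zero =>
      intro _ z hz
      rw [dist_o_eq_zero H.ht] at hz; subst hz; rw [H.cov.1]; simp
    | succ n ih =>
      intro hn z hz
      have hzo : z ≠ o := by grind
      have h1 := par_spec H.ht hzo
      have h2 := ih (by omega) (par Gt o z) (by omega)
      have h3 := H.dist_le _ z rfl
      have hadj := H.adj h1.1
      have hpz : π (par Gt o z) = p (π z) ∧ π z ≠ x := by
        rcases hE _ (show π z ∈ gball G x r by show _ ≤ r; omega) _ (show π (par Gt o z) ∈ gball G x r by show _ ≤ r; omega) hadj with h | h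
        · grind
        · exfalso
          have hpo : par Gt o z ≠ o := by
            grind
          have h4 := h2.2 hpo
          rw [← h.2] at h4
          have h5 := par_spec H.ht hpo
          have h6 : par Gt o (par Gt o z) = z := H.inj (par Gt o z) h5.1 h1.1.symm h4
          grind
      grind
  refine ⟨fun z hz => (key _ hz z rfl).1, ?_⟩
  have inj : ∀ n ≤ r, ∀ z z', Gt.dist o z = n → Gt.dist o z' = n → π z = π z' → z = z' := by
    intro n
    induction n with
    | zero =>
      intro _ z z' hz hz' _
      rw [dist_o_eq_zero H.ht] at hz hz'
      rw [hz, hz']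
    | succ n ih =>
      intro hn z z' hz hz' he
      have hzo : z ≠ o := by grind
      have hzo' : z' ≠ o := by grind
      have h1 := par_spec H.ht hzo
      have h1' := par_spec H.ht hzo'
      have h2 := (key _ hn z hz).2 hzo
      have h2' := (key _ hn z' hz').2 hzo'
      have h3 := ih (by omega) (par Gt o z) (par Gt o z') (by omega) (by omega) (by grind)
      exact H.inj (par Gt o z) h1.1.symm (by rw [h3]; exact h1'.1.symm) he
  intro z hz z' hz' he
  have a1 := (key _ hz z rfl).1
  have a2 := (key _ hz' z' rfl).1
  rw [he] at a1
  exact inj _ hz z z' rfl (a2.symm.trans a1) he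

lemma ball_card (ht : IsRegTree Gt d) (hd : 3 ≤ d) (n : ℕ) : (gball Gt o n).ncard ≤ 4 * (d - 1) ^ n := by
  have key : ∀ n, (gball Gt o n).ncard + 2 ≤ 4 * (d - 1) ^ n := by
    intro n
    induction n with
    | zero =>
      have : gball Gt o 0 = {o} := by
        ext z; simp only [gball, mem_setOf_eq, nonpos_iff_eq_zero, mem_singleton_iff]; exact dist_o_eq_zero ht
      rw [this]; simp
    | succ n ih =>
      have h1 : gball Gt o (n+1) = gball Gt o n ∪ (sph Gt o (n+1) ∩ univ) := by
        ext z; simp only [gball, sph, mem_setOf_eq, mem_union, Set.inter_univ]; omega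
      have h2 := ncard_union_le (gball Gt o n) (sph Gt o (n+1) ∩ univ)
      rw [← h1, ncard_sphR ht hd (RS_univ ht)] at h2
      obtain ⟨e, rfl⟩ : ∃ e, d = e + 3 := ⟨d - 3, by omega⟩
      grind
  grind

lemma spherePlus_card (ht : IsRegTree Gt d) (hd : 3 ≤ d) (hob : Gt.Adj o obar) (n : ℕ) (hn : 1 ≤ n) :
    (spherePlus Gt o obar n).ncard = (d - 1) ^ n := by
  obtain ⟨m, rfl⟩ : ∃ m, n = m + 1 := ⟨n - 1, by omega⟩
  have : spherePlus Gt o obar (m+1) = sph Gt o (m+1) ∩ treePlus Gt o obar := by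
    ext z; simp only [spherePlus, sph, mem_setOf_eq, mem_inter_iff]; tauto
  rw [this, ncard_sphR ht hd (RS_plus ht hd hob), pow_succ]; ring

lemma CV.ball_card (H : CV Gt G d o x π) (n : ℕ) : (gball G x n).ncard ≤ 4 * (d - 1) ^ n := by
  refine le_trans ?_ (GFF.ball_card (o := o) H.ht H.hd n)
  have : gball G x n ⊆ π '' gball Gt o n := by
    intro y hy
    obtain ⟨z, h1, h2⟩ := H.ball_sub n y hy
    exact ⟨z, h1, h2⟩
  exact (ncard_le_ncard this (toFinite _)).trans (ncard_image_le (ball_fin H.ht H.hd n))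

lemma CV.lift_comp (H : CV Gt G d o x π) (h : ℝ) (ω : V → ℝ) : ∀ (u v : V) (p : G.Walk u v),
    (∀ y ∈ p.support, h ≤ ω y) → ∀ z, π z = u → z ∈ levelComp Gt h (ω ∘ π) o →
      ∃ z' ∈ levelComp Gt h (ω ∘ π) o, π z' = v := by
  intro u v p
  induction p with
  | nil => grind
  | cons hadj q ih =>
    intro hs z hz hz'
    rw [← hz] at hadj
    obtain ⟨w, h1, h2⟩ := H.lift hadj
    refine ih (fun y hy => hs y (by simp [hy])) w h2 ?_
    obtain ⟨q', hq'⟩ := hz'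
    refine ⟨q'.concat h1, ?_⟩
    intro t ht
    rw [Walk.support_concat] at ht
    simp only [List.concat_eq_append, List.mem_append, List.mem_singleton] at ht
    rcases ht with ht | ht
    · grind
    · subst ht
      show h ≤ ω (π t)
      rw [h2]
      exact hs _ (by simp)

lemma anc_up (ht : IsRegTree Gt d) {h : ℝ} {ω : T → ℝ} {z : T} (hz : anc Gt o h ω z) (k : ℕ)
    (hk : k ≤ Gt.dist o z) : ∃ w, Gt.dist o w = k ∧ anc Gt o h ω w := by
  refine ⟨(par Gt o)^[Gt.dist o z - k] z, ?_, ?_⟩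
  · have : ∀ i ≤ Gt.dist o z, Gt.dist o ((par Gt o)^[i] z) = Gt.dist o z - i := by
      intro i
      induction i with
      | zero => simp
      | succ i ih => intro hi; rw [iterate_succ_apply', par_depth ht, ih (by omega)]; omega
    grind
  · intro i
    rw [← Function.iterate_add_apply]
    exact hz _

lemma CV.reach_of (H : CV Gt G d o x π) {h : ℝ} {ω : V → ℝ} {y : V} (hy : y ∈ levelComp G h ω x) {s : ℕ}
    (hs : s ≤ G.dist x y) : ω ∘ π ∈ reach Gt o univ h s := by
  obtain ⟨p, hp⟩ := hy
  have h0 : o ∈ levelComp Gt h (ω ∘ π) o := by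
    refine ⟨Walk.nil, ?_⟩
    intro v hv
    simp only [Walk.support_nil, List.mem_singleton] at hv
    subst hv
    show h ≤ ω (π _)
    rw [H.cov.1]; exact hp x (by simp)
  obtain ⟨z, h1, h2⟩ := H.lift_comp h ω x y p hp o H.cov.1 h0
  rw [anc_mem H.ht] at h1
  have h3 := H.dist_le _ z rfl
  rw [h2] at h3
  obtain ⟨w, h4, h5⟩ := anc_up H.ht h1 s (by omega)
  exact ⟨w, h4, trivial, h5⟩

lemma CV.map_comp (H : CV Gt G d o x π) (h : ℝ) (ω : V → ℝ) {z : T} (hz : z ∈ levelComp Gt h (ω ∘ π) o) :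
    π z ∈ levelComp G h ω x := by
  have key : ∀ (u v : T) (p : Gt.Walk u v), (∀ y ∈ p.support, h ≤ (ω ∘ π) y) → π v ∈ levelComp G h ω (π u) := by
    intro u v p
    induction p with
    | nil => intro hs; exact ⟨Walk.nil, fun y hy => by
        simp only [Walk.support_nil, List.mem_singleton] at hy; subst hy; exact hs _ (by simp)⟩
    | cons hadj q ih =>
      intro hs
      obtain ⟨q', hq'⟩ := ih (fun y hy => hs y (by simp [hy]))
      refine ⟨Walk.cons (H.adj hadj) q', ?_⟩
      grind
  obtain ⟨p, hp⟩ := hz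
  have := key o z p hp
  rwa [H.cov.1] at this

lemma CV.card_of (H : CV Gt G d o x π) {h : ℝ} {ω : V → ℝ} {r s : ℕ} (hg : GoodB G r x) (hs : s ≤ r)
    (hR : ω ∘ π ∈ reach Gt o univ h s) : s < (levelComp G h ω x).ncard := by
  obtain ⟨z, hz, _, ha⟩ := hR
  have : ∀ k : Fin (s+1), ∃ w, Gt.dist o w = k ∧ anc Gt o h (ω ∘ π) w := fun k =>
    anc_up H.ht ha k (by omega)
  choose f hf using this
  have hinj : Injective (fun k => π (f k)) := by
    intro a b hab
    have h1 := (H.good hg).1 (f a) (by grind)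
    have h2 := (H.good hg).1 (f b) (by grind)
    grind
  have hsub : Set.range (fun k => π (f k)) ⊆ levelComp G h ω x := by
    rintro _ ⟨k, rfl⟩
    exact H.map_comp h ω ((anc_mem H.ht _).2 (hf k).2)
  have := ncard_le_ncard hsub (toFinite _)
  rw [← image_univ, ncard_image_of_injective _ hinj, ncard_univ, Nat.card_eq_fintype_card, Fintype.card_fin] at this
  omega
end
end GFF

namespace GFF
set_option linter.all false

section
local notation "δ(" x ")" => ((x:ℝ)-1)
variable {T : Type} {Gt : SimpleGraph T} {d : ℕ} {o obar : T} {V : Type} [Fintype V] {G : SimpleGraph V}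

lemma adjPairs_union {A B : Set V} (hd : Disjoint A B) {a b : V} (ha : a ∈ A) (hb : b ∈ B) (hab : G.Adj a b) :
    adjPairs G A + adjPairs G B + 2 ≤ adjPairs G (A ∪ B) := by
  unfold adjPairs
  set PA := {p : V × V | p.1 ∈ A ∧ p.2 ∈ A ∧ G.Adj p.1 p.2}
  set PB := {p : V × V | p.1 ∈ B ∧ p.2 ∈ B ∧ G.Adj p.1 p.2}
  have hd' : ∀ v, v ∈ A → v ∈ B → False := fun v h1 h2 => Set.disjoint_left.1 hd h1 h2
  have c3 : ({(a, b), (b, a)} : Set (V × V)).ncard = 2 := ncard_pair (by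
    grind)
  have d1 : Disjoint PA PB := by
    grind
  have d2 : Disjoint (PA ∪ PB) {(a, b), (b, a)} := by
    grind
  rw [← c3, ← ncard_union_eq d1 (toFinite _) (toFinite _), ← ncard_union_eq d2 (toFinite _) (toFinite _)]
  refine ncard_le_ncard ?_ (toFinite _)
  rintro q ((h1 | h1) | (rfl | rfl))
  · grind
  · grind
  · grind
  · exact ⟨Or.inr hb, Or.inl ha, hab.symm⟩

lemma ball_adj (hc : G.Connected) {x : V} {ρ : ℕ} {S : Set V} (hS : S ⊆ gball G x ρ) (hne : S.Nonempty)
    (hS' : S ≠ gball G x ρ) : ∃ a ∈ S, ∃ v ∈ gball G x ρ, v ∉ S ∧ G.Adj a v := by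
  by_cases hx : x ∈ S
  · have : (gball G x ρ \ S).Nonempty := by
      rw [Set.nonempty_iff_ne_empty]; intro h
      exact hS' (hS.antisymm (Set.diff_eq_empty.1 h))
    obtain ⟨v, hv, hmin⟩ := Set.exists_min_image (gball G x ρ \ S) (fun v => G.dist x v) (toFinite _) this
    have hvx : v ≠ x := by grind
    obtain ⟨w, hw1, hw2⟩ := exists_pred hc x v hvx
    refine ⟨w, ?_, v, hv.1, hv.2, hw1.symm⟩
    by_contra hwS
    have h1 : G.dist x v ≤ ρ := hv.1
    have := hmin w ⟨by show _ ≤ ρ; omega, hwS⟩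
    omega
  · obtain ⟨a, ha, hmin⟩ := Set.exists_min_image S (fun v => G.dist x v) (toFinite _) hne
    have hax : a ≠ x := by grind
    obtain ⟨w, hw1, hw2⟩ := exists_pred hc x a hax
    have h1 : G.dist x a ≤ ρ := hS ha
    refine ⟨a, ha, w, by show _ ≤ ρ; omega, ?_, hw1⟩
    grind

lemma max_set (Q : Set V → Prop) (S0 : Set V) (h0 : Q S0) : ∃ S, Q S ∧ ∀ v, v ∉ S → ¬ Q (S ∪ {v}) := by
  obtain ⟨S, hS, hmax⟩ := Set.exists_max_image {S | Q S} (fun S => S.ncard) (toFinite _) ⟨S0, h0⟩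
  refine ⟨S, hS, fun v hv hQ => ?_⟩
  have := hmax _ hQ
  rw [Set.union_singleton, ncard_insert_of_notMem hv (toFinite _)] at this
  omega

lemma adjPairs_insert {S : Set V} {a v : V} (ha : a ∈ S) (hv : v ∉ S) (h : G.Adj a v) {k : ℕ}
    (hk : 2 * S.ncard + k ≤ adjPairs G S) : 2 * (S ∪ {v}).ncard + k ≤ adjPairs G (S ∪ {v}) := by
  have h1 := adjPairs_union (Set.disjoint_singleton_right.2 hv) ha (mem_singleton v) h
  have h2 : (S ∪ {v}).ncard = S.ncard + 1 := by
    rw [Set.union_singleton, ncard_insert_of_notMem hv (toFinite _)]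
  omega

lemma bad_close (hc : G.Connected) {x y y0 : V} {ρ r : ℕ}
    (hcyc : adjPairs G (gball G x ρ) ≤ 2 * (gball G x ρ).ncard)
    (hy : G.dist x y + r ≤ ρ) (hy0 : G.dist x y0 + r ≤ ρ) (hb : ¬ GoodB G r y) (hb0 : ¬ GoodB G r y0) :
    G.dist y0 y ≤ 2 * r := by
  by_contra hcon
  push Not at hcon
  unfold GoodB at hb hb0
  push Not at hb hb0
  have sub : ∀ y, G.dist x y + r ≤ ρ → gball G y r ⊆ gball G x ρ := by
    intro y hy v hv
    have h1 : G.dist y v ≤ r := hv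
    have h2 : G.dist x v ≤ G.dist x y + G.dist y v := hc.dist_triangle
    show _ ≤ ρ; omega
  have hdis : ∀ v, v ∈ gball G y r → v ∈ gball G y0 r → False := by
    intro v h1 h2
    have h1' : G.dist y v ≤ r := h1
    have h2' : G.dist y0 v ≤ r := h2
    have : G.dist y0 y ≤ G.dist y0 v + G.dist v y := hc.dist_triangle
    rw [G.dist_comm (u := v)] at this
    omega
  set U2 := gball G y0 r
  obtain ⟨S, ⟨h1, h2, h3, h4⟩, hmax⟩ := max_set
    (fun S => gball G y r ⊆ S ∧ S ⊆ gball G x ρ ∧ Disjoint S U2 ∧ 2 * S.ncard + 0 ≤ adjPairs G S)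
    (gball G y r) ⟨subset_rfl, sub y hy, Set.disjoint_left.2 (fun v a b => hdis v a b), by omega⟩
  have hy0U : y0 ∈ U2 := self_gball G y0 r
  have hyS : y ∈ S := h1 (self_gball G y r)
  obtain ⟨a, ha, v, hv, hvS, hav⟩ := ball_adj hc h2 ⟨y, hyS⟩ (by
    grind)
  have hvU : v ∈ U2 := by
    by_contra hvU
    exact hmax v hvS ⟨h1.trans subset_union_left, Set.union_subset h2 (Set.singleton_subset_iff.2 hv),
      Set.disjoint_union_left.2 ⟨h3, Set.disjoint_singleton_left.2 hvU⟩, adjPairs_insert ha hvS hav h4⟩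
  have h5 := adjPairs_union h3 ha hvU hav
  have h6 := ncard_union_eq h3 (toFinite _) (toFinite _)
  obtain ⟨S', ⟨k1, k2, k3⟩, hmax'⟩ := max_set
    (fun S' => y0 ∈ S' ∧ S' ⊆ gball G x ρ ∧ 2 * S'.ncard + 2 ≤ adjPairs G S') (S ∪ U2)
    ⟨Or.inr hy0U, Set.union_subset h2 (sub y0 hy0), by omega⟩
  by_cases hS' : S' = gball G x ρ
  · grind
  · obtain ⟨a, ha, v, hv, hvS, hav⟩ := ball_adj hc k2 ⟨y0, k1⟩ hS'
    exact hmax' v hvS ⟨Or.inl k1, Set.union_subset k2 (Set.singleton_subset_iff.2 hv), adjPairs_insert ha hvS hav k3⟩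

lemma bad_count {β : ℝ} (h : GH G d β) {ρ r : ℕ} (hr : r ≤ ρ)
    (hcyc : ∀ x, adjPairs G (gball G x ρ) ≤ 2 * (gball G x ρ).ncard)
    {C : ℕ} (hball : ∀ y, (gball G y (2 * r)).ncard ≤ C) :
    (({x | ¬ GoodB G r x} : Set V).ncard : ℝ) ≤
      (Fintype.card V : ℝ) * (C * (1 / (Fintype.card V : ℝ) + (1 - β / 2) ^ (ρ - r))) := by
  set k := ρ - r
  set Bd : Finset V := Finset.univ.filter (fun x => ¬ GoodB G r x)
  have e0 : (({x | ¬ GoodB G r x} : Set V).ncard : ℝ) = Bd.card := by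
    rw [← ncard_coe_finset]; simp [Bd]
  have hnn : (0:ℝ) ≤ 1 / (Fintype.card V : ℝ) + (1 - β / 2) ^ k := by
    have : 0 ≤ 1 - β / 2 := by linarith [h.b2]
    positivity
  have e1 : (Bd.card : ℝ) = ∑ x : V, ∑ y ∈ Bd, (lazyP G d ^ k) x y := by
    have e3 : ∑ x : V, ∑ y ∈ Bd, (lazyP G d ^ k) x y = ∑ y ∈ Bd, ∑ x : V, (lazyP G d ^ k) x y := sum_comm
    have e4 : ∀ y ∈ Bd, ∑ x : V, (lazyP G d ^ k) x y = 1 := fun y _ =>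
      (sum_congr rfl fun x _ => h.lazy_symm k x y).trans (h.lazy_row k y)
    rw [e3, sum_congr rfl e4]; simp
  have e2 : ∀ x : V, ∑ y ∈ Bd, (lazyP G d ^ k) x y ≤ C * (1 / (Fintype.card V : ℝ) + (1 - β / 2) ^ k) := by
    intro x
    rw [← Finset.sum_filter_add_sum_filter_not Bd (fun y => G.dist x y ≤ k)]
    have z : ∑ y ∈ Bd with ¬ G.dist x y ≤ k, (lazyP G d ^ k) x y = 0 :=
      sum_eq_zero fun y hy => lazy_far h.conn k x y (by
        grind)
    rw [z, add_zero]
    have c1 : (Bd.filter (fun y => G.dist x y ≤ k)).card ≤ C := by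
      by_cases hne : (Bd.filter (fun y => G.dist x y ≤ k)).Nonempty
      · obtain ⟨y0, hy0⟩ := hne
        refine le_trans ?_ (hball y0)
        rw [← ncard_coe_finset]
        refine ncard_le_ncard ?_ (toFinite _)
        intro y hy
        simp only [Bd, Finset.coe_filter, mem_filter, Finset.mem_univ, true_and, mem_setOf_eq] at hy hy0
        exact bad_close h.conn (hcyc x) (by omega) (by omega) hy.1 hy0.1
      · rw [Finset.not_nonempty_iff_eq_empty.1 hne]; simp
    calc _ ≤ ∑ y ∈ Bd with G.dist x y ≤ k, (1 / (Fintype.card V : ℝ) + (1 - β / 2) ^ k) :=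
          sum_le_sum fun y _ => h.lazy_le k x y
      _ = (Bd.filter (fun y => G.dist x y ≤ k)).card * (1 / (Fintype.card V : ℝ) + (1 - β / 2) ^ k) := by
          rw [sum_const, nsmul_eq_mul]
      _ ≤ _ := mul_le_mul_of_nonneg_right (by exact_mod_cast c1) hnn
  rw [e0, e1]
  calc _ ≤ ∑ x : V, C * (1 / (Fintype.card V : ℝ) + (1 - β / 2) ^ k) := sum_le_sum fun x _ => e2 x
    _ = _ := by rw [sum_const, nsmul_eq_mul, card_univ]

noncomputable def nb (H : IsRegTree Gt d) (hd : 3 ≤ d) (z : T) : Finset T := (nbr_fin H hd z).toFinset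

lemma mem_nb (H : IsRegTree Gt d) (hd : 3 ≤ d) (z w : T) : w ∈ nb H hd z ↔ Gt.Adj z w := by simp [nb]

lemma nb_card (H : IsRegTree Gt d) (hd : 3 ≤ d) (z : T) : (nb H hd z).card = d := by
  have := nbr_ncard H z
  rwa [ncard_eq_toFinset_card _ (nbr_fin H hd z)] at this

lemma nb_sum (H : IsRegTree Gt d) (hd : 3 ≤ d) (a : T) (f : ℕ → ℝ) {z : T} (hz : z ≠ a) :
    ∑ w ∈ nb H hd z, f (Gt.dist a w) = f (Gt.dist a z - 1) + δ(d) * f (Gt.dist a z + 1) := by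
  have hp := par_spec (o := a) H hz
  have hm : par Gt a z ∈ nb H hd z := (mem_nb H hd _ _).2 hp.1
  rw [← Finset.add_sum_erase _ _ hm]
  have : ∀ w ∈ (nb H hd z).erase (par Gt a z), f (Gt.dist a w) = f (Gt.dist a z + 1) := by
    intro w hw
    rw [Finset.mem_erase, mem_nb] at hw
    rcases tree_adj H a hw.2 with h | h
    · exact absurd (par_eq H hw.2 h.symm).symm hw.1
    · rw [h]
  rw [sum_congr rfl this, sum_const, Finset.card_erase_of_mem hm, nb_card, nsmul_eq_mul,
    Nat.cast_sub (by omega), par_depth H]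
  simp

lemma nb_sum_self (H : IsRegTree Gt d) (hd : 3 ≤ d) (a : T) (f : ℕ → ℝ) :
    ∑ w ∈ nb H hd a, f (Gt.dist a w) = d * f 1 := by
  have : ∀ w ∈ nb H hd a, f (Gt.dist a w) = f 1 := by
    intro w hw
    rw [mem_nb] at hw
    rw [dist_eq_one_iff_adj.2 hw]
  rw [sum_congr rfl this, sum_const, nb_card, nsmul_eq_mul]

lemma treeGreen_harm (H : IsRegTree Gt d) (hd : 3 ≤ d) (z a : T) :
    treeGreen Gt d z a - (d:ℝ)⁻¹ * ∑ w ∈ nb H hd z, treeGreen Gt d w a = if z = a then 1 else 0 := by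
  have h3 : (3:ℝ) ≤ d := by exact_mod_cast hd
  have n1 : (d:ℝ) - 1 ≠ 0 := by linarith
  have n2 : (d:ℝ) - 2 ≠ 0 := by linarith
  have n0 : (d:ℝ) ≠ 0 := by linarith
  have e : ∀ w, treeGreen Gt d w a = (fun n : ℕ => (δ(d) / ((d : ℝ) - 2)) * (δ(d)⁻¹) ^ n) (Gt.dist a w) := by
    intro w; rw [treeGreen_symm]; rfl
  simp_rw [e]
  split_ifs with h
  · subst h
    rw [nb_sum_self H hd z (fun n : ℕ => (δ(d) / ((d : ℝ) - 2)) * (δ(d)⁻¹) ^ n)]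
    simp only [SimpleGraph.dist_self]
    grind
  · rw [nb_sum H hd a (fun n : ℕ => (δ(d) / ((d : ℝ) - 2)) * (δ(d)⁻¹) ^ n) h]
    obtain ⟨m, hm⟩ : ∃ m, Gt.dist a z = m + 1 := ⟨Gt.dist a z - 1, by
      have := (dist_o_eq_zero (o := a) H (z := z)).not.2 h; omega⟩
    grind

lemma max_prin (H : IsRegTree Gt d) (hd : 3 ≤ d) (r : ℕ) (f : T → ℝ)
    (hf : ∀ z, Gt.dist o z < r → f z ≤ (d:ℝ)⁻¹ * ∑ w ∈ nb H hd z, f w) (B : ℝ)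
    (hB : ∀ z, Gt.dist o z = r → f z ≤ B) : ∀ z, Gt.dist o z ≤ r → f z ≤ B := by
  have h3 : (3:ℝ) ≤ d := by exact_mod_cast hd
  obtain ⟨z1, hz1, hmax⟩ := Set.exists_max_image (gball Gt o r) f (ball_fin H hd r) ⟨o, by simp [gball]⟩
  obtain ⟨z2, hz2, hmax2⟩ := Set.exists_max_image {z | z ∈ gball Gt o r ∧ f z = f z1} (fun z => Gt.dist o z)
    ((ball_fin (o := o) H hd r).subset fun z hz => hz.1) ⟨z1, hz1, rfl⟩
  have hz2r : Gt.dist o z2 = r := by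
    by_contra hne
    have hle : Gt.dist o z2 ≤ r := hz2.1
    have hlt : Gt.dist o z2 < r := by omega
    have h1 := hf z2 hlt
    have hb : ∀ w ∈ nb H hd z2, f w ≤ f z2 := by
      intro w hw
      rw [mem_nb] at hw
      rw [hz2.2]
      refine hmax w ?_
      have := adj_dist H.1 o hw
      show _ ≤ r; omega
    have hch : (chil Gt o z2).Nonempty := by
      rw [← ncard_pos (chil_fin H hd z2)]
      by_cases h : z2 = o
      · subst h; rw [← nbr_o H, nbr_ncard H]; omega
      · rw [chil_ncard H hd h]; omega
    obtain ⟨c, hc1, hc2⟩ := hch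
    have hc3 := par_spec H hc1
    rw [hc2] at hc3
    have hcm : c ∈ nb H hd z2 := (mem_nb H hd _ _).2 hc3.1.symm
    have hcb : Gt.dist o c ≤ r := by omega
    have hclt : f c < f z2 := by
      refine lt_of_le_of_ne (hb c hcm) fun h => ?_
      have := hmax2 c ⟨hcb, h.trans hz2.2⟩
      omega
    have h4 : ∑ w ∈ nb H hd z2, f w < ∑ w ∈ nb H hd z2, f z2 := Finset.sum_lt_sum hb ⟨c, hcm, hclt⟩
    rw [sum_const, nb_card, nsmul_eq_mul] at h4
    have h5 : (d:ℝ)⁻¹ * ∑ w ∈ nb H hd z2, f w < (d:ℝ)⁻¹ * (d * f z2) := by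
      apply mul_lt_mul_of_pos_left h4; positivity
    rw [inv_mul_cancel_left₀ (by linarith)] at h5
    linarith
  intro z hz
  have := hB z2 hz2r
  rw [hz2.2] at this
  exact (hmax z hz).trans this

lemma max_prin2 (H : IsRegTree Gt d) (hd : 3 ≤ d) (r : ℕ) (f : T → ℝ) {ν : ℝ} (hν : 0 ≤ ν)
    (hf : ∀ z, Gt.dist o z < r → f z ≤ (d:ℝ)⁻¹ * ∑ w ∈ nb H hd z, f w + ν) (B : ℝ)
    (hB : ∀ z, Gt.dist o z = r → f z ≤ B) : ∀ z, Gt.dist o z ≤ r → f z ≤ B + d * ν * r := by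
  have h3 : (3:ℝ) ≤ d := by exact_mod_cast hd
  intro z hz
  have key := max_prin (o := o) H hd r (fun z => f z + d * ν * (Gt.dist o z : ℝ)) ?_ (B + d * ν * r) ?_ z hz
  · have : 0 ≤ d * ν * (Gt.dist o z : ℝ) := by positivity
    linarith
  · intro z hz
    have h1 := hf z hz
    rw [sum_add_distrib, ← mul_sum, mul_add]
    have h2 : (Gt.dist o z : ℝ) + (d:ℝ)⁻¹ ≤ (d:ℝ)⁻¹ * ∑ w ∈ nb H hd z, (Gt.dist o w : ℝ) := by
      by_cases hzo : z = o
      · subst hzo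
        rw [nb_sum_self H hd z (fun n => (n:ℝ))]
        simp only [SimpleGraph.dist_self]
        push_cast
        rw [inv_mul_cancel_left₀ (by linarith)]
        have := inv_le_one_of_one_le₀ (show (1:ℝ) ≤ d by linarith)
        linarith
      · rw [nb_sum H hd o (fun n => (n:ℝ)) hzo]
        obtain ⟨m, hm⟩ : ∃ m, Gt.dist o z = m + 1 := ⟨Gt.dist o z - 1, by
          have := (dist_o_eq_zero (o := o) H (z := z)).not.2 hzo; omega⟩
        rw [hm]
        push_cast [Nat.add_sub_cancel]
        rw [le_inv_mul_iff₀ (by linarith), mul_add, mul_inv_cancel₀ (by linarith)]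
        nlinarith
    have h4 : (d:ℝ)⁻¹ * (d * ν * ∑ w ∈ nb H hd z, (Gt.dist o w : ℝ)) = d * ν * ((d:ℝ)⁻¹ * ∑ w ∈ nb H hd z, (Gt.dist o w : ℝ)) := by ring
    rw [h4]
    have h5 := mul_le_mul_of_nonneg_left h2 (show 0 ≤ d * ν by positivity)
    have h6 : d * ν * ((Gt.dist o z : ℝ) + (d:ℝ)⁻¹) = d * ν * (Gt.dist o z : ℝ) + ν := by
      field_simp
    linarith
  grind

variable {x : V} {π : T → V}

lemma CV.P_sum (H : CV Gt G d o x π) (f : V → ℝ) (z : T) :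
    ∑ y, transP G d (π z) y * f y = (d:ℝ)⁻¹ * ∑ w ∈ nb H.ht H.hd z, f (π w) := by
  have h1 : (nb H.ht H.hd z).image π = Finset.univ.filter (fun y => G.Adj (π z) y) := by
    ext y
    simp only [Finset.mem_image, mem_nb, mem_filter, Finset.mem_univ, true_and]
    constructor
    · rintro ⟨w, hw, rfl⟩; exact H.adj hw
    · intro h; exact H.lift h
  rw [← Finset.sum_image (f := f) (g := π) (s := nb H.ht H.hd z), h1, sum_filter, mul_sum]
  · refine sum_congr rfl fun y _ => ?_
    simp only [transP, of_apply]
    grind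
  · intro a ha b hb hab
    exact H.inj z ((mem_nb H.ht H.hd _ _).1 ha) ((mem_nb H.ht H.hd _ _).1 hb) hab

noncomputable def gerr (β : ℝ) (d N r s : ℕ) : ℝ :=
  (1 - β / 2) ^ (r - s) / β + r / (2 * (N : ℝ)) + 2 * (1/2) ^ (r - s) + d * (1 / (N:ℝ)) * r

lemma CV.green_cmp {β : ℝ} (H : CV Gt G d o x π) (h : GH G d β) {r s : ℕ} (hg : GoodB G r x) (hs : s ≤ r)
    {z z0 : T} (hz : Gt.dist o z ≤ r) (hz0 : Gt.dist o z0 ≤ s) :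
    |zG G d (π z) (π z0) - treeGreen Gt d z z0| ≤ gerr β d (Fintype.card V) r s := by
  have h3 : (3:ℝ) ≤ d := by exact_mod_cast H.hd
  set w : T → ℝ := fun z => zG G d (π z) (π z0) - treeGreen Gt d z z0 with hw
  have heq : ∀ z, Gt.dist o z < r → w z = (d:ℝ)⁻¹ * ∑ u ∈ nb H.ht H.hd z, w u - 1 / (Fintype.card V : ℝ) := by
    intro z hz
    have e1 := h.green_harm (π z) (π z0)
    rw [H.P_sum (fun y => zG G d y (π z0)) z] at e1
    have e2 := treeGreen_harm H.ht H.hd z z0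
    have e3 : (π z = π z0) ↔ (z = z0) := ⟨fun he => (H.good hg).2 (show _ ≤ r by omega) (show _ ≤ r by omega) he, fun he => by rw [he]⟩
    simp only [e3] at e1
    simp only [hw, sum_sub_distrib, mul_sub]
    linarith
  have hbd : ∀ z, Gt.dist o z = r → |w z| ≤ (1 - β / 2) ^ (r - s) / β + r / (2 * (Fintype.card V : ℝ)) + 2 * (1/2) ^ (r - s) := by
    intro z hz
    have hd1 : r - s ≤ G.dist (π z) (π z0) := by
      have a1 := (H.good hg).1 z (by omega)
      have a2 := H.dist_le _ z0 rfl
      have a3 : G.dist x (π z) ≤ G.dist x (π z0) + G.dist (π z0) (π z) := H.hc.dist_triangle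
      rw [G.dist_comm (u := π z0)] at a3
      omega
    have hd2 : r - s ≤ Gt.dist z z0 := by
      have a3 : Gt.dist o z ≤ Gt.dist o z0 + Gt.dist z0 z := H.ht.1.dist_triangle
      rw [Gt.dist_comm (u := z0)] at a3
      omega
    have b1 := h.green_decay _ _ _ hd1
    have b2 : ((r - s : ℕ) : ℝ) / (2 * (Fintype.card V : ℝ)) ≤ r / (2 * (Fintype.card V : ℝ)) := by
      gcongr; omega
    have b3 : treeGreen Gt d z z0 ≤ 2 * (1/2) ^ (r - s) := by
      unfold treeGreen
      have c1 : δ(d) / (d - 2) ≤ 2 := by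
        rw [div_le_iff₀ (by linarith)]; linarith
      have c2 : δ(d)⁻¹ ≤ 1/2 := by
        rw [inv_eq_one_div]; apply one_div_le_one_div_of_le <;> linarith
      have c3 : (0:ℝ) ≤ δ(d)⁻¹ := by rw [inv_nonneg]; linarith
      have c4 : (δ(d)⁻¹) ^ (Gt.dist z z0) ≤ (1/2) ^ (r - s) :=
        (pow_le_pow_left₀ c3 c2 _).trans (pow_le_pow_of_le_one (by norm_num) (by norm_num) hd2)
      exact mul_le_mul c1 c4 (pow_nonneg c3 _) (by norm_num)
    have b4 := treeGreen_nonneg (Gt := Gt) H.hd z z0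
    grind
  have hN : (0:ℝ) ≤ 1 / (Fintype.card V : ℝ) := by positivity
  rw [abs_le]
  constructor
  · have := max_prin2 (o := o) H.ht H.hd r (fun z => - w z) hN (fun z hz => by
      rw [heq z hz]; simp only [sum_neg_distrib]; linarith) _ (fun z hz => (neg_le_abs _).trans (hbd z hz)) z hz
    simp only [hw] at this
    unfold gerr; linarith
  · have := max_prin2 (o := o) H.ht H.hd r w hN (fun z hz => by
      grind) _ (fun z hz => (le_abs_self _).trans (hbd z hz)) z hz
    simp only [hw] at this
    unfold gerr; linarith
end
end GFF

namespace GFF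
set_option linter.all false

section
local notation "𝟏" => (fun _ => (1:ℝ))
variable {T : Type} {Gt : SimpleGraph T} {d : ℕ} {o obar : T} {μT : Measure (T → ℝ)}

def PS (H : TH Gt d μT) (o : T) (s : ℕ) (S : Set (ballF H.ht H.hd o s)) : Prop :=
  ∃ z, Gt.dist o z = s ∧ ∀ k, ∃ i ∈ S, i.1 = (par Gt o)^[k] z

lemma reach_PS (H : TH Gt d μT) (h : ℝ) (s : ℕ) (φ : T → ℝ) :
    φ ∈ reach Gt o univ h s ↔ PS H o s {i | h ≤ φ i.1} := by
  unfold reach PS anc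
  simp only [mem_setOf_eq, mem_univ, true_and]
  refine exists_congr fun z => and_congr_right fun hz => forall_congr' fun k => ?_
  constructor
  · intro hk
    refine ⟨⟨(par Gt o)^[k] z, ?_⟩, hk, rfl⟩
    rw [mem_ballF]
    clear hk
    induction k with
    | zero => simp [hz]
    | succ k ih => rw [iterate_succ_apply', par_depth H.ht]; omega
  grind

lemma GF.isProb {I : Type*} [Fintype I] {μ : Measure (I → ℝ)} {K : I → I → ℝ} (h : GF μ K) : IsProbabilityMeasure μ := h.1

lemma loc_lim (H : TH Gt d μT) (h : ℝ) (s : ℕ) {δ : ℝ} (hδ : 0 < δ) :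
    ∃ η > 0, ∀ (V : Type) [Fintype V] (K : V → V → ℝ) (μ : Measure (V → ℝ)) (π π' : T → V), GF μ K →
      (∀ z z', Gt.dist o z ≤ s → Gt.dist o z' ≤ s → |K (π z) (π z') - treeGreen Gt d z z'| ≤ η) →
      |μ.real {ω | ω ∘ π ∈ reach Gt o univ h s} - μT.real (reach Gt o univ h s)| ≤ δ ∧
      ((∀ z z', Gt.dist o z ≤ s → Gt.dist o z' ≤ s → |K (π' z) (π' z') - treeGreen Gt d z z'| ≤ η) →
      (∀ z z', Gt.dist o z ≤ s → Gt.dist o z' ≤ s → |K (π z) (π' z')| ≤ η) →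
      (∀ z z', Gt.dist o z ≤ s → Gt.dist o z' ≤ s → |K (π' z) (π z')| ≤ η) →
      |μ.real {ω | ω ∘ π ∈ reach Gt o univ h s ∧ ω ∘ π' ∈ reach Gt o univ h s} -
        μT.real (reach Gt o univ h s) ^ 2| ≤ δ) := by
  have h3 : (3:ℝ) ≤ d := by exact_mod_cast H.hd
  let I := ballF H.ht H.hd o s
  let μ0 : Measure (I → ℝ) := μT.map (fun ω => ω ∘ (fun i : I => i.1))
  have g0 : GF μ0 (fun i j : I => treeGreen Gt d i.1 j.1) := H.fin _ Subtype.val_injective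
  have gp : ∀ z : T, 0 < treeGreen Gt d z z := by
    intro z; simp only [treeGreen, SimpleGraph.dist_self, pow_zero, mul_one]
    apply div_pos <;> linarith
  have m1 : Measurable (fun ω : T → ℝ => ω ∘ (fun i : I => i.1)) :=
    measurable_pi_iff.2 fun j => measurable_pi_apply _
  have E0 : μ0.real {ω | PS H o s {i | h ≤ ω i}} = μT.real (reach Gt o univ h s) := by
    rw [map_measureReal_apply m1 (measurableSet_thr h _)]
    congr 1
    ext ω
    exact (reach_PS H h s ω).symm
  have g00 := g0.prod g0
  have := g0.isProb
  set μ00 := (μ0.prod μ0).map (fun p : (I → ℝ) × (I → ℝ) => (Sum.elim p.1 p.2 : I ⊕ I → ℝ)) with hμ00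
  have m2 : Measurable (fun p : (I → ℝ) × (I → ℝ) => (Sum.elim p.1 p.2 : I ⊕ I → ℝ)) := by
    refine measurable_pi_iff.2 fun j => ?_
    cases j with
    | inl i => exact (measurable_pi_apply i).comp measurable_fst
    | inr i => exact (measurable_pi_apply i).comp measurable_snd
  set P2 : Set (I ⊕ I) → Prop := fun S => PS H o s (Sum.inl ⁻¹' S) ∧ PS H o s (Sum.inr ⁻¹' S) with hP2
  have E00 : μ00.real {ω | P2 {i | h ≤ ω i}} = μT.real (reach Gt o univ h s) ^ 2 := by
    rw [hμ00, map_measureReal_apply m2 (measurableSet_thr h P2), ← E0, sq, ← measureReal_prod_prod]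
    rfl
  obtain ⟨η1, hη1, k1⟩ := g0.contThr (fun i => gp i.1) h (PS H o s) hδ
  obtain ⟨η2, hη2, k2⟩ := g00.contThr (fun i => by cases i <;> exact gp _) h P2 hδ
  refine ⟨min η1 η2, lt_min hη1 hη2, ?_⟩
  intro V _ K μ π π' hK hc
  have mI : ∀ i : I, Gt.dist o i.1 ≤ s := fun i => (mem_ballF H.ht H.hd s i.1).1 i.2
  refine ⟨?_, ?_⟩
  · have := k1 _ (fun i j => (hc i.1 j.1 (mI i) (mI j)).trans (min_le_left _ _)) _ (hK.comp (fun i : I => π i.1))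
    rw [E0] at this
    have m3 : Measurable (fun ω : V → ℝ => ω ∘ (fun i : I => π i.1)) :=
      measurable_pi_iff.2 fun j => measurable_pi_apply _
    rw [map_measureReal_apply m3 (measurableSet_thr h _)] at this
    convert this using 4
    ext ω
    exact reach_PS H h s (ω ∘ π)
  · intro hc' hd1 hd2
    have := k2 _ (fun i j => ?_) _ (hK.comp (fun i : I ⊕ I => Sum.elim (fun i => π i.1) (fun i => π' i.1) i))
    · rw [E00] at this
      have m3 : Measurable (fun ω : V → ℝ => ω ∘ (fun i : I ⊕ I => Sum.elim (fun i => π i.1) (fun i => π' i.1) i)) :=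
        measurable_pi_iff.2 fun j => measurable_pi_apply _
      rw [map_measureReal_apply m3 (measurableSet_thr h _)] at this
      convert this using 4
      ext ω
      exact and_congr (reach_PS H h s (ω ∘ π)) (reach_PS H h s (ω ∘ π'))
    · refine le_trans ?_ (min_le_right η1 η2)
      cases i with
      | inl i => cases j with
        | inl j => grind
        | inr j => grind
      | inr i => cases j with
        | inl j => grind
        | inr j => grind

lemma lln {V Ω : Type*} [MeasurableSpace Ω] (μ : Measure Ω) [IsProbabilityMeasure μ] (M : V → Set Ω)
    (hM : ∀ x, MeasurableSet (M x)) (S : Finset V) (Gd : V → Prop) (near : V → Finset V) (C : ℕ)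
    (hC : ∀ x, (near x).card ≤ C) {p δ : ℝ} (hp0 : 0 ≤ p) (hp1 : p ≤ 1) (hδ : 0 ≤ δ)
    (h1 : ∀ x ∈ S, Gd x → |μ.real (M x) - p| ≤ δ)
    (h2 : ∀ x ∈ S, ∀ y ∈ S, Gd x → Gd y → y ∉ near x → |μ.real (M x ∩ M y) - p ^ 2| ≤ δ) :
    ∫ ω, (∑ x ∈ S, ((M x).indicator 𝟏 ω - p)) ^ 2 ∂μ ≤
      3 * δ * S.card ^ 2 + 2 * (S.filter (fun x => ¬ Gd x)).card * S.card + C * S.card := by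
  have int1 : ∀ x, Integrable ((M x).indicator 𝟏) μ := fun x => (integrable_const _).indicator (hM x)
  have ival : ∀ A, MeasurableSet A → ∫ ω, A.indicator 𝟏 ω ∂μ = μ.real A := by
    intro A hA; rw [integral_indicator_const _ hA]; simp
  set t : V → V → ℝ := fun x y => μ.real (M x ∩ M y) - p * μ.real (M x) - p * μ.real (M y) + p ^ 2 with ht
  have hprod : ∀ x y ω, ((M x).indicator 𝟏 ω - p) * ((M y).indicator 𝟏 ω - p) =
      (M x ∩ M y).indicator 𝟏 ω - p * (M x).indicator 𝟏 ω - p * (M y).indicator 𝟏 ω + p ^ 2 := by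
    intro x y ω
    have : (M x ∩ M y).indicator 𝟏 ω = (M x).indicator 𝟏 ω * (M y).indicator 𝟏 ω := by
      by_cases a : ω ∈ M x <;> by_cases b : ω ∈ M y <;> simp [a, b]
    rw [this]; ring
  have i2 : ∀ x y, Integrable (fun ω => (M x ∩ M y).indicator 𝟏 ω) μ := fun x y => (integrable_const _).indicator ((hM x).inter (hM y))
  have i3 : ∀ x, Integrable (fun ω => p * (M x).indicator 𝟏 ω) μ := fun x => (int1 x).const_mul p
  have i4 : ∀ x y, Integrable (fun ω => (M x ∩ M y).indicator 𝟏 ω - p * (M x).indicator 𝟏 ω) μ := fun x y => (i2 x y).sub (i3 x)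
  have i5 : ∀ x y, Integrable (fun ω => (M x ∩ M y).indicator 𝟏 ω - p * (M x).indicator 𝟏 ω - p * (M y).indicator 𝟏 ω) μ := fun x y => (i4 x y).sub (i3 y)
  have i6 : ∀ x y, Integrable (fun ω => (M x ∩ M y).indicator 𝟏 ω - p * (M x).indicator 𝟏 ω - p * (M y).indicator 𝟏 ω + p ^ 2) μ := fun x y => (i5 x y).add (integrable_const _)
  have e1 : ∫ ω, (∑ x ∈ S, ((M x).indicator 𝟏 ω - p)) ^ 2 ∂μ = ∑ x ∈ S, ∑ y ∈ S, t x y := by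
    simp_rw [sq (∑ x ∈ S, _), sum_mul_sum, hprod]
    rw [integral_finsetSum _ (fun x _ => integrable_finsetSum _ fun y _ => i6 x y)]
    refine sum_congr rfl fun x _ => ?_
    rw [integral_finsetSum _ (fun y _ => i6 x y)]
    refine sum_congr rfl fun y _ => ?_
    rw [integral_add (i5 x y) (integrable_const _), integral_sub (i4 x y) (i3 y), integral_sub (i2 x y) (i3 x),
      integral_const_mul, integral_const_mul, ival _ ((hM x).inter (hM y)), ival _ (hM x), ival _ (hM y)]
    simp [ht]
  rw [e1]
  have b1 : ∀ x y, t x y ≤ 1 := by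
    intro x y
    simp only [ht]
    have a1 : μ.real (M x ∩ M y) ≤ μ.real (M x) := measureReal_mono Set.inter_subset_left
    have a2 : μ.real (M x ∩ M y) ≤ μ.real (M y) := measureReal_mono Set.inter_subset_right
    have a3 : μ.real (M x) ≤ 1 := measureReal_le_one
    have a4 : 0 ≤ μ.real (M x ∩ M y) := measureReal_nonneg
    nlinarith
  have b2 : ∀ x ∈ S, ∀ y ∈ S, t x y ≤ 3 * δ + (if Gd x then 0 else 1) + (if Gd y then 0 else 1) + (if y ∈ near x then 1 else 0) := by
    intro x hx y hy
    by_cases gx : Gd x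
    · by_cases gy : Gd y
      · by_cases hn : y ∈ near x
        · have := b1 x y
          simp [gx, gy, hn]; linarith
        · simp only [gx, gy, hn, if_true, if_false, add_zero]
          have c1 := abs_le.1 (h1 x hx gx)
          have c2 := abs_le.1 (h1 y hy gy)
          have c3 := abs_le.1 (h2 x hx y hy gx gy hn)
          simp only [ht]
          nlinarith
      · have := b1 x y
        have q : (0:ℝ) ≤ if y ∈ near x then 1 else 0 := by split_ifs <;> norm_num
        simp only [gx, gy, if_true, if_false]; linarith
    · have := b1 x y
      have q : (0:ℝ) ≤ if y ∈ near x then 1 else 0 := by split_ifs <;> norm_num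
      have q' : (0:ℝ) ≤ if Gd y then 0 else 1 := by split_ifs <;> norm_num
      simp only [gx, if_false]; linarith
  refine (sum_le_sum fun x hx => sum_le_sum fun y hy => b2 x hx y hy).trans ?_
  have cG : ∑ x ∈ S, (if Gd x then (0:ℝ) else 1) = (S.filter (fun x => ¬ Gd x)).card := by
    rw [card_filter]; push_cast
    refine sum_congr rfl fun x _ => ?_
    split_ifs <;> simp_all
  have cN : ∀ x, ∑ y ∈ S, (if y ∈ near x then (1:ℝ) else 0) ≤ C := by
    intro x
    rw [← sum_filter, sum_const, nsmul_eq_mul, mul_one]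
    have : (S.filter (fun y => y ∈ near x)).card ≤ (near x).card := Finset.card_le_card fun y hy => (mem_filter.1 hy).2
    exact_mod_cast this.trans (hC x)
  simp only [sum_add_distrib, sum_const, nsmul_eq_mul, cG]
  have : ∑ x ∈ S, ∑ y ∈ S, (if y ∈ near x then (1:ℝ) else 0) ≤ ∑ x ∈ S, (C:ℝ) := sum_le_sum fun x _ => cN x
  rw [sum_const, nsmul_eq_mul] at this
  rw [← mul_sum, cG]
  nlinarith
end
end GFF

namespace GFF
set_option linter.all false

section
local notation "δ(" x ")" => ((x:ℝ)-1)

structure SQ (d : ℕ) (V : ℕ → Type) [∀ n, Fintype (V n)] (G : ∀ n, SimpleGraph (V n)) (N : ℕ → ℕ) (α β : ℝ)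
    (μ : ∀ n, Measure (V n → ℝ)) (T : Type) (Gt : SimpleGraph T) (o obar : T) (μT : Measure (T → ℝ))
    (cov : ∀ n, V n → T → V n) : Prop where
  gh : ∀ n, GH (G n) d β
  hN : ∀ n, N n = Fintype.card (V n)
  Nt : Tendsto N atTop atTop
  a0 : 0 < α
  a1 : α ≤ 1
  cyc : ∀ n (x : V n), adjPairs (G n) (gball (G n) x ⌊α * logb δ(d) (N n : ℝ)⌋₊) ≤
        2 * (gball (G n) x ⌊α * logb δ(d) (N n : ℝ)⌋₊).ncard
  gf : ∀ n, GF (μ n) (zG (G n) d)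
  th : TH Gt d μT
  cv : ∀ n x, CV Gt (G n) d o x (cov n x)
  ob : Gt.Adj o obar

variable {d : ℕ} {V : ℕ → Type} [∀ n, Fintype (V n)] {G : ∀ n, SimpleGraph (V n)} {N : ℕ → ℕ} {α β : ℝ}
    {μ : ∀ n, Measure (V n → ℝ)} {T : Type} {Gt : SimpleGraph T} {o obar : T} {μT : Measure (T → ℝ)}
    {cov : ∀ n, V n → T → V n}
local notation "Sq" => SQ d V G N α β μ T Gt o obar μT cov
local notation "ρ(" n ")" => (rn d α β (N n))

lemma SQ.Npos (Q : Sq) (n : ℕ) : 0 < N n := by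
  rw [Q.hN]
  have := (Q.gh n).conn.nonempty
  positivity

lemma SQ.d3 (Q : Sq) : (3:ℝ) ≤ d := by exact_mod_cast Q.th.hd

lemma SQ.b0 (Q : Sq) : 0 < β := (Q.gh 0).b0
lemma SQ.b2 (Q : Sq) : β ≤ 2 := (Q.gh 0).b2

lemma SQ.c0pos (Q : Sq) : 0 < c0 d α β ∧ c0 d α β ≤ 1 := by
  have h3 := Q.d3
  have := Q.b0; have := Q.a0; have := Q.a1; have := Q.b2
  unfold c0
  constructor
  · apply div_pos (by positivity); linarith
  · rw [div_le_one (by linarith)]; nlinarith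

lemma SQ.Ntr (Q : Sq) : Tendsto (fun n => (N n : ℝ)) atTop atTop :=
  tendsto_natCast_atTop_atTop.comp Q.Nt

lemma SQ.Lt (Q : Sq) :
    Tendsto (fun n => logb δ(d) (N n : ℝ)) atTop atTop :=
  (Real.tendsto_logb_atTop (by have := Q.d3; linarith)).comp Q.Ntr

lemma SQ.r_ev (Q : Sq) : ∀ᶠ n in atTop,
    (ρ(n) : ℝ) ≤ (c0 d α β / 18) * logb δ(d) (N n) ∧
    (c0 d α β / 18) * logb δ(d) (N n) - 1 ≤ ρ(n) := by
  have hc := Q.c0pos.1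
  have h1 : Tendsto (fun n => (c0 d α β / 18) * logb δ(d) (N n)) atTop atTop :=
    Q.Lt.const_mul_atTop (by positivity)
  filter_upwards [h1.eventually_ge_atTop 1] with n hn
  have h2 : ρ(n) = ⌊(c0 d α β / 18) * logb δ(d) (N n : ℝ)⌋₊ := by
    unfold rn
    exact max_eq_right (Nat.le_floor (by grind))
  rw [h2]
  constructor
  · exact Nat.floor_le (by linarith)
  · have := Nat.lt_floor_add_one ((c0 d α β / 18) * logb δ(d) (N n : ℝ))
    linarith

lemma SQ.r_tend (Q : Sq) : Tendsto (fun n => ρ(n)) atTop atTop := by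
  have hc := Q.c0pos.1
  have h1 : Tendsto (fun n => (c0 d α β / 18) * logb δ(d) (N n) - 1) atTop atTop :=
    tendsto_atTop_add_const_right _ _ (Q.Lt.const_mul_atTop (by positivity))
  have h2 : Tendsto (fun n => (ρ(n) : ℝ)) atTop atTop :=
    tendsto_atTop_mono' _ (Q.r_ev.mono fun n h => h.2) h1
  exact tendsto_natCast_atTop_iff.1 h2

lemma SQ.rpow_eq (Q : Sq) (n : ℕ) (a : ℝ) :
    δ(d) ^ (a * logb δ(d) (N n)) = (N n : ℝ) ^ a := by
  have h3 := Q.d3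
  rw [mul_comm, Real.rpow_mul (by linarith), Real.rpow_logb (by linarith) (by linarith) (by exact_mod_cast Q.Npos n)]

lemma SQ.pow_ge (Q : Sq) (K : ℝ) : ∀ᶠ n in atTop,
    K * (N n : ℝ) ^ (c0 d α β / 36) ≤ δ(d) ^ ρ(n) := by
  have hc := Q.c0pos.1
  have h3 := Q.d3
  have h1 : Tendsto (fun n => (N n : ℝ) ^ (c0 d α β / 36)) atTop atTop :=
    (tendsto_rpow_atTop (by positivity)).comp Q.Ntr
  filter_upwards [Q.r_ev, h1.eventually_ge_atTop (K * δ(d))] with n hn hK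
  have h4 : δ(d) ^ ((c0 d α β / 18) * logb δ(d) (N n) - 1) ≤ δ(d) ^ (ρ(n) : ℝ) :=
    Real.rpow_le_rpow_of_exponent_le (by linarith) hn.2
  rw [Real.rpow_natCast, Real.rpow_sub (by linarith), Q.rpow_eq, Real.rpow_one] at h4
  refine le_trans ?_ h4
  rw [le_div_iff₀ (by linarith)]
  have h5 : (N n : ℝ) ^ (c0 d α β / 18) = (N n : ℝ) ^ (c0 d α β / 36) * (N n : ℝ) ^ (c0 d α β / 36) := by
    rw [← Real.rpow_add (by exact_mod_cast Q.Npos n)]; congr 1; ring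
  rw [h5]
  have : 0 ≤ (N n : ℝ) ^ (c0 d α β / 36) := by positivity
  nlinarith

lemma SQ.pow_div (Q : Sq) :
    Tendsto (fun n => δ(d) ^ (2 * ρ(n)) * (1 / (N n : ℝ))) atTop (nhds 0) := by
  have hc := Q.c0pos
  have h3 := Q.d3
  have h1 : Tendsto (fun n => (N n : ℝ) ^ (-(1 - c0 d α β / 9))) atTop (nhds 0) :=
    (tendsto_rpow_neg_atTop (by linarith)).comp Q.Ntr
  refine squeeze_zero' ?_ ?_ h1
  · filter_upwards with n
    have : (0:ℝ) ≤ (d:ℝ) - 1 := by linarith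
    positivity
  · filter_upwards [Q.r_ev] with n hn
    have hN : (0:ℝ) < N n := by exact_mod_cast Q.Npos n
    have h4 : δ(d) ^ (2 * ρ(n)) ≤ (N n : ℝ) ^ (c0 d α β / 9) := by
      rw [← Q.rpow_eq, ← Real.rpow_natCast]
      apply Real.rpow_le_rpow_of_exponent_le (by linarith)
      grind
    calc _ ≤ (N n : ℝ) ^ (c0 d α β / 9) * (1 / (N n : ℝ)) := by gcongr
      _ = _ := by rw [neg_sub, Real.rpow_sub hN, Real.rpow_one]; ring

lemma SQ.bad_tend (Q : Sq) :
    Tendsto (fun n => ((4 * (d - 1) ^ (2 * ρ(n)) : ℕ) : ℝ) * (1 / (N n : ℝ) +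
      (1 - β / 2) ^ (⌊α * logb δ(d) (N n : ℝ)⌋₊ - ρ(n)))) atTop (nhds 0) := by
  have hc := Q.c0pos
  have h3 := Q.d3
  have hb := Q.b0; have ha := Q.a0; have ha1 := Q.a1; have hb2 := Q.b2
  have h1 : Tendsto (fun n => Real.exp (-((13/36 * (α * β)) * logb δ(d) (N n)) + β / 2)) atTop (nhds 0) := by
    refine Real.tendsto_exp_atBot.comp (tendsto_atBot_add_const_right _ _ ?_)
    exact tendsto_neg_atTop_atBot.comp (Q.Lt.const_mul_atTop (by positivity))
  have h2 : Tendsto (fun n => δ(d) ^ (2 * ρ(n)) *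
      (1 - β / 2) ^ (⌊α * logb δ(d) (N n : ℝ)⌋₊ - ρ(n))) atTop (nhds 0) := by
    refine squeeze_zero' ?_ ?_ h1
    · filter_upwards with n
      have : (0:ℝ) ≤ (d:ℝ) - 1 := by linarith
      have : (0:ℝ) ≤ 1 - β / 2 := by linarith
      positivity
    · filter_upwards [Q.r_ev, Q.Lt.eventually_ge_atTop 0] with n hn hL0
      set L := logb δ(d) (N n)
      set r := ρ(n)
      have e1 : δ(d) ^ (2 * r) ≤ Real.exp (α * β / 9 * L) := by
        rw [← Real.rpow_natCast, Real.rpow_def_of_pos (by linarith)]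
        apply exp_le_exp.2
        have l1 : Real.log δ(d) ≤ (d:ℝ) - 1 := (Real.log_le_sub_one_of_pos (by linarith)).trans (by linarith)
        have l0 : 0 ≤ Real.log δ(d) := Real.log_nonneg (by linarith)
        push_cast
        calc Real.log δ(d) * (2 * r) ≤ δ(d) * (2 * (c0 d α β / 18 * L)) := by
              apply mul_le_mul l1 (by linarith) (by positivity) (by linarith)
          _ = _ := by unfold c0; have : (d:ℝ) - 1 ≠ 0 := by linarith
                      field_simp; ring
      have e2 : (1 - β / 2) ^ (⌊α * L⌋₊ - r) ≤ Real.exp (-(β / 2) * (17/18 * α * L - 1)) := by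
        have q1 : 1 - β / 2 ≤ Real.exp (-(β/2)) := by linarith [add_one_le_exp (-(β/2))]
        refine (pow_le_pow_left₀ (by linarith) q1 _).trans ?_
        rw [← exp_nat_mul]
        apply exp_le_exp.2
        have q2 : 17/18 * α * L - 1 ≤ ((⌊α * L⌋₊ - r : ℕ) : ℝ) := by
          have q3 : (⌊α * L⌋₊ : ℝ) - r ≤ ((⌊α * L⌋₊ - r : ℕ) : ℝ) := by
            rw [sub_le_iff_le_add]; exact_mod_cast (by omega : ⌊α * L⌋₊ ≤ ⌊α * L⌋₊ - r + r)
          have q4 := Nat.lt_floor_add_one (α * L)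
          have q5 : c0 d α β ≤ α := by
            unfold c0; rw [div_le_iff₀ (by linarith)]; nlinarith
          have q6 : c0 d α β / 18 * L ≤ α / 18 * L := by gcongr
          linarith
        nlinarith
      have n1 : (0:ℝ) ≤ (1 - β / 2) ^ (⌊α * L⌋₊ - r) := by
        have : (0:ℝ) ≤ 1 - β / 2 := by linarith
        positivity
      refine (mul_le_mul e1 e2 n1 (Real.exp_pos _).le).trans ?_
      rw [← Real.exp_add]
      apply exp_le_exp.2
      linarith
  have h5 := (Q.pow_div.add h2).const_mul 4
  simp only [add_zero, mul_zero] at h5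
  refine h5.congr fun n => ?_
  have hd := Q.th.hd
  push_cast [Nat.cast_sub (show 1 ≤ d by omega)]
  ring

lemma SQ.bad (Q : Sq) {ε : ℝ} (hε : 0 < ε) : ∀ᶠ n in atTop,
    ((Finset.univ.filter (fun x => ¬ GoodB (G n) ρ(n) x)).card : ℝ) ≤ ε * N n := by
  have h3 := Q.d3
  have hL := Q.Lt
  have ha := Q.a0
  have hr : ∀ᶠ n in atTop, ρ(n) ≤ ⌊α * logb δ(d) (N n : ℝ)⌋₊ := by
    filter_upwards [Q.r_ev, Q.Lt.eventually_ge_atTop 0] with n hn hL0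
    apply Nat.le_floor
    have q5 : c0 d α β ≤ α := by
      have := Q.b0; have := Q.b2
      unfold c0; rw [div_le_iff₀ (by linarith)]; nlinarith
    have q6 : c0 d α β / 18 * logb δ(d) (N n : ℝ) ≤ α * logb δ(d) (N n : ℝ) := by
      gcongr; linarith
    linarith [hn.1]
  filter_upwards [hr, (tendsto_order.1 Q.bad_tend).2 ε hε] with n hn hb
  have h1 := bad_count (Q.gh n) hn (Q.cyc n) (fun y => (Q.cv n y).ball_card (2 * ρ(n)))
  rw [← Q.hN] at h1
  have e0 : (({x | ¬ GoodB (G n) ρ(n) x} : Set (V n)).ncard : ℝ) =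
     (Finset.univ.filter (fun x => ¬ GoodB (G n) ρ(n) x)).card := by
    rw [← ncard_coe_finset]; simp
  rw [← e0]
  refine h1.trans ?_
  rw [mul_comm ε]
  exact mul_le_mul_of_nonneg_left hb.le (by positivity)

lemma SQ.gerr (Q : Sq) (s : ℕ) :
    Tendsto (fun n => gerr β d (N n) ρ(n) s) atTop (nhds 0) := by
  have h3 := Q.d3
  have hb := Q.b0; have hb2 := Q.b2
  have hrs : Tendsto (fun n => ρ(n) - s) atTop atTop := (tendsto_sub_atTop_nat s).comp Q.r_tend
  have t1 : Tendsto (fun n => (1 - β / 2) ^ (ρ(n) - s) / β) atTop (nhds (0 / β)) :=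
    ((tendsto_pow_atTop_nhds_zero_of_lt_one (by linarith) (by linarith)).comp hrs).div_const _
  have t2 : Tendsto (fun n => (1/2 : ℝ) ^ (ρ(n) - s)) atTop (nhds 0) :=
    (tendsto_pow_atTop_nhds_zero_of_lt_one (by norm_num) (by norm_num)).comp hrs
  have t3 : Tendsto (fun n => (ρ(n) : ℝ) * (1 / (N n : ℝ))) atTop (nhds 0) := by
    refine squeeze_zero (fun n => by positivity) (fun n => ?_) Q.pow_div
    gcongr
    have : (ρ(n) : ℝ) ≤ 2 ^ ρ(n) := by exact_mod_cast Nat.lt_two_pow_self.le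
    refine this.trans ((pow_le_pow_left₀ (by norm_num) (by linarith : (2:ℝ) ≤ (d:ℝ) - 1) _).trans ?_)
    exact pow_le_pow_right₀ (by linarith) (by omega)
  have := ((t1.add (t3.const_mul (1/2))).add (t2.const_mul 2)).add (t3.const_mul (d:ℝ))
  simp only [zero_div, mul_zero, add_zero] at this
  refine this.congr fun n => ?_
  unfold GFF.gerr
  ring

def Mv (Gt : SimpleGraph T) (o : T) {V : Type} (π : T → V) (h : ℝ) (s : ℕ) : Set (V → ℝ) :=
  {ω | ω ∘ π ∈ reach Gt o univ h s}

lemma Mv_meas (H : TH Gt d μT) {V : Type} (π : T → V) (h : ℝ) (s : ℕ) : MeasurableSet (Mv Gt o π h s) :=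
  (reach_meas H univ h s).preimage (measurable_pi_iff.2 fun z => measurable_pi_apply _)

lemma SQ.loc (Q : Sq) (h : ℝ) (s : ℕ) {δ : ℝ} (hδ : 0 < δ) :
    ∃ D : ℕ, ∀ᶠ n in atTop, (∀ x, GoodB (G n) ρ(n) x →
      |(μ n).real (Mv Gt o (cov n x) h s) - μT.real (reach Gt o univ h s)| ≤ δ) ∧
      ∀ x y, GoodB (G n) ρ(n) x → GoodB (G n) ρ(n) y → D < (G n).dist x y →
      |(μ n).real (Mv Gt o (cov n x) h s ∩ Mv Gt o (cov n y) h s) - μT.real (reach Gt o univ h s) ^ 2| ≤ δ := by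
  obtain ⟨η, hη, hk⟩ := loc_lim (o := o) Q.th h s hδ
  have hb := Q.b0; have hb2 := Q.b2
  have t1 : Tendsto (fun k : ℕ => (1 - β / 2) ^ k / β) atTop (nhds (0 / β)) :=
    (tendsto_pow_atTop_nhds_zero_of_lt_one (by linarith) (by linarith)).div_const _
  rw [zero_div] at t1
  obtain ⟨D', hD'⟩ := ((tendsto_order.1 t1).2 (η/2) (by linarith)).exists
  have t2 : Tendsto (fun n => (D' : ℝ) / 2 * (N n : ℝ)⁻¹) atTop (nhds ((D':ℝ) / 2 * 0)) :=
    (tendsto_inv_atTop_zero.comp Q.Ntr).const_mul _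
  rw [mul_zero] at t2
  refine ⟨D' + 2 * s, ?_⟩
  filter_upwards [(tendsto_order.1 (Q.gerr s)).2 η hη, (tendsto_order.1 t2).2 (η/2) (by linarith),
    Q.r_tend.eventually_ge_atTop s] with n h1 h2 h3
  have cmp : ∀ x, GoodB (G n) ρ(n) x → ∀ z z', Gt.dist o z ≤ s → Gt.dist o z' ≤ s →
      |zG (G n) d (cov n x z) (cov n x z') - treeGreen Gt d z z'| ≤ η := by
    intro x hx z z' hz hz'
    have := (Q.cv n x).green_cmp (Q.gh n) hx h3 (hz.trans h3) hz'
    rw [← Q.hN] at this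
    linarith
  have far : ∀ x y, D' + 2 * s < (G n).dist x y → ∀ z z', Gt.dist o z ≤ s → Gt.dist o z' ≤ s →
      |zG (G n) d (cov n x z) (cov n y z')| ≤ η := by
    intro x y hxy z z' hz hz'
    have a1 := (Q.cv n x).dist_le _ z rfl
    have a2 := (Q.cv n y).dist_le _ z' rfl
    have a3 : (G n).dist x y ≤ (G n).dist x (cov n x z) + (G n).dist (cov n x z) y := (Q.gh n).conn.dist_triangle
    have a4 : (G n).dist (cov n x z) y ≤ (G n).dist (cov n x z) (cov n y z') + (G n).dist (cov n y z') y := (Q.gh n).conn.dist_triangle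
    rw [(G n).dist_comm (v := y)] at a4
    have a5 := (Q.gh n).green_decay D' (cov n x z) (cov n y z') (by
      rw [(G n).dist_comm (u := y)] at a4
      rw [(G n).dist_comm (u := y)] at a2
      omega)
    rw [← Q.hN] at a5
    have : (D':ℝ) / (2 * (N n : ℝ)) = (D' : ℝ) / 2 * (N n : ℝ)⁻¹ := by
      grind
    linarith
  refine ⟨fun x hx => (hk (V n) _ (μ n) (cov n x) (cov n x) (Q.gf n) (cmp x hx)).1, ?_⟩
  intro x y hx hy hxy
  exact (hk (V n) _ (μ n) (cov n x) (cov n y) (Q.gf n) (cmp x hx)).2 (cmp y hy) (far x y hxy)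
    (far y x (by rw [(G n).dist_comm]; exact hxy))
end
end GFF

namespace GFF
set_option linter.all false

section
local notation "δ(" x ")" => ((x:ℝ)-1)

lemma cheb {V Ω : Type*} [MeasurableSpace Ω] (μ : Measure Ω) [IsProbabilityMeasure μ] (M : V → Set Ω)
    (hM : ∀ x, MeasurableSet (M x)) (S : Finset V) {p t E : ℝ} (ht : 0 < t)
    (hE : ∫ ω, (∑ x ∈ S, ((M x).indicator (fun _ => (1:ℝ)) ω - p)) ^ 2 ∂μ ≤ E) :
    μ.real {ω | ((S.filter (fun x => ω ∈ M x)).card : ℝ) ≤ p * S.card - t} ≤ E / t ^ 2 := by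
  set f : Ω → ℝ := fun ω => (∑ x ∈ S, ((M x).indicator (fun _ => (1:ℝ)) ω - p)) with hf
  have hfm : Measurable f := measurable_sum _ fun x _ => (measurable_const.indicator (hM x)).sub_const _
  have hb : ∀ ω, |f ω| ≤ S.card * (1 + |p|) := by
    intro ω
    refine (abs_sum_le_sum_abs _ _).trans ?_
    rw [← nsmul_eq_mul, ← sum_const]
    refine sum_le_sum fun x _ => ?_
    refine (abs_sub _ _).trans ?_
    gcongr
    by_cases h : ω ∈ M x <;> simp [h]
  have hi : Integrable (fun ω => f ω ^ 2) μ := by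
    refine Integrable.of_bound (hfm.pow_const 2).aestronglyMeasurable ((S.card * (1 + |p|))^2) ?_
    filter_upwards with ω
    rw [norm_eq_abs, abs_pow]
    exact pow_le_pow_left₀ (abs_nonneg _) (hb ω) 2
  have h1 := mul_meas_ge_le_integral_of_nonneg (μ := μ) (f := fun ω => f ω ^ 2) (ae_of_all _ fun ω => sq_nonneg _) hi (t^2)
  rw [le_div_iff₀ (by positivity), mul_comm]
  refine le_trans ?_ (h1.trans hE)
  refine mul_le_mul_of_nonneg_left (measureReal_mono ?_) (by positivity)
  intro ω hω
  have hω' : ((S.filter (fun x => ω ∈ M x)).card : ℝ) ≤ p * S.card - t := hω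
  have e : f ω = ((S.filter (fun x => ω ∈ M x)).card : ℝ) - p * S.card := by
    simp only [hf, sum_sub_distrib, sum_const, nsmul_eq_mul]
    rw [card_filter]
    push_cast
    simp only [indicator_apply]
    ring
  show t ^ 2 ≤ f ω ^ 2
  have : f ω ≤ -t := by grind
  nlinarith

variable {d : ℕ} {V : ℕ → Type} [∀ n, Fintype (V n)] {G : ∀ n, SimpleGraph (V n)} {N : ℕ → ℕ} {α β : ℝ}
    {μ : ∀ n, Measure (V n → ℝ)} {T : Type} {Gt : SimpleGraph T} {o obar : T} {μT : Measure (T → ℝ)}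
    {cov : ∀ n, V n → T → V n}
local notation "Sq" => SQ d V G N α β μ T Gt o obar μT cov
local notation "ρ(" n ")" => (rn d α β (N n))

lemma SQ.pT (Q : Sq) (A : Set (T → ℝ)) : 0 ≤ μT.real A ∧ μT.real A ≤ 1 := by
  have := Q.th.hμ.1
  exact ⟨measureReal_nonneg, measureReal_le_one⟩

lemma SQ.lln (Q : Sq) (h : ℝ) (s : ℕ) {δ : ℝ} (hδ : 0 < δ) :
    ∃ C : ℕ, ∀ᶠ n in atTop, ∀ S : Finset (V n),
      ∫ ω, (∑ x ∈ S, ((Mv Gt o (cov n x) h s).indicator (fun _ => (1:ℝ)) ω - μT.real (reach Gt o univ h s))) ^ 2 ∂(μ n) ≤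
      3 * δ * S.card ^ 2 + 2 * (S.filter (fun x => ¬ GoodB (G n) ρ(n) x)).card * S.card + C * S.card := by
  obtain ⟨D, hD⟩ := Q.loc h s hδ
  refine ⟨4 * (d-1)^D, ?_⟩
  filter_upwards [hD] with n hn S
  have := (Q.gf n).isProb
  refine GFF.lln (μ n) (fun x => Mv Gt o (cov n x) h s) (fun x => Mv_meas Q.th _ h s) S _
    (fun x => (gball (G n) x D).toFinset) _ ?_ (Q.pT _).1 (Q.pT _).2 hδ.le (fun x _ hx => hn.1 x hx) ?_
  · intro x
    rw [← ncard_eq_toFinset_card']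
    exact (Q.cv n x).ball_card D
  · intro x _ y _ hx hy hxy
    refine hn.2 x y hx hy ?_
    by_contra hh
    exact hxy (by rw [mem_toFinset]; exact not_lt.1 hh)

lemma SQ.cnt (Q : Sq) (h : ℝ) (s : ℕ) {ε : ℝ} (hε : 0 < ε) :
    ∀ᶠ n in atTop, (μ n).real {ω | ((Finset.univ.filter (fun x => ω ∈ Mv Gt o (cov n x) h s)).card : ℝ) ≤
      (μT.real (reach Gt o univ h s) - ε) * N n} ≤ ε := by
  obtain ⟨C, hC⟩ := Q.lln h s (δ := ε^3/6) (by positivity)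
  filter_upwards [hC, Q.bad (ε := ε^3/8) (by positivity), Q.Ntr.eventually_ge_atTop (C * 4 / ε^3)] with n h1 h2 h3
  have := (Q.gf n).isProb
  have hN : (0:ℝ) < N n := by exact_mod_cast Q.Npos n
  have h4 := cheb (μ n) (fun x => Mv Gt o (cov n x) h s) (fun x => Mv_meas Q.th _ h s) Finset.univ
    (t := ε * N n) (by positivity) (h1 Finset.univ)
  rw [card_univ, ← Q.hN] at h4
  rw [sub_mul]
  refine h4.trans ?_
  rw [div_le_iff₀ (by positivity)]
  rw [div_le_iff₀ (by positivity)] at h3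
  nlinarith

noncomputable def Sf (Gt : SimpleGraph T) (o obar : T) {V : Type} [Fintype V] (π : T → V) (r : ℕ) : Finset V :=
  (π '' spherePlus Gt o obar r).toFinset

lemma SQ.r1 (n : ℕ) : 1 ≤ ρ(n) := le_max_left _ _

lemma SQ.Sf_card (Q : Sq) (n : ℕ) (x : V n)
    (hx : GoodB (G n) ρ(n) x) :
    (Sf Gt o obar (cov n x) ρ(n)).card = (d-1)^ρ(n) := by
  unfold Sf
  rw [← ncard_eq_toFinset_card', Set.InjOn.ncard_image, spherePlus_card Q.th.ht Q.th.hd Q.ob _ (SQ.r1 n)]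
  refine (((Q.cv n x).good hx).2).mono ?_
  intro z hz
  exact hz.2.le

lemma SQ.Sf_dist (Q : Sq) (n : ℕ) (x y : V n) {r : ℕ}
    (hy : y ∈ Sf Gt o obar (cov n x) r) : (G n).dist x y ≤ r := by
  unfold Sf at hy
  rw [mem_toFinset] at hy
  obtain ⟨z, hz, rfl⟩ := hy
  exact (Q.cv n x).dist_le _ z hz.2

lemma SQ.dc (Q : Sq) (n : ℕ) (r : ℕ) (X B : Finset (V n)) :
    ∑ x ∈ X, (((Sf Gt o obar (cov n x) r).filter (fun y => y ∈ B)).card : ℝ) ≤ B.card * (4 * δ(d)^r) := by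
  have h1 : ∀ x ∈ X, (((Sf Gt o obar (cov n x) r).filter (fun y => y ∈ B)).card : ℝ) ≤
      ∑ y ∈ B, if (G n).dist x y ≤ r then (1:ℝ) else 0 := by
    intro x _
    rw [← sum_filter, sum_const, nsmul_eq_mul, mul_one]
    norm_cast
    refine Finset.card_le_card ?_
    intro y hy
    rw [mem_filter] at hy ⊢
    exact ⟨hy.2, Q.Sf_dist n x y hy.1⟩
  refine (sum_le_sum h1).trans ?_
  rw [sum_comm, ← nsmul_eq_mul, ← sum_const]
  refine sum_le_sum fun y _ => ?_
  rw [← sum_filter, sum_const, nsmul_eq_mul, mul_one]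
  have h2 := (Q.cv n y).ball_card r
  have h3 : (X.filter (fun x => (G n).dist x y ≤ r)).card ≤ 4 * (d-1)^r := by
    refine le_trans ?_ h2
    rw [ncard_eq_toFinset_card']
    refine Finset.card_le_card ?_
    intro x hx
    rw [mem_filter] at hx
    rw [mem_toFinset]
    show (G n).dist y x ≤ r
    rw [(G n).dist_comm]; exact hx.2
  have hd := Q.th.hd
  have h4 : ((X.filter (fun x => (G n).dist x y ≤ r)).card : ℝ) ≤ ((4 * (d-1)^r : ℕ) : ℝ) := by exact_mod_cast h3
  push_cast [Nat.cast_sub (show 1 ≤ d by omega)] at h4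
  exact h4

lemma SQ.sph (Q : Sq) (h : ℝ) (s : ℕ) {ε p : ℝ} (hε : 0 < ε)
    (hp : p = μT.real (reach Gt o univ h s)) (hp0 : 0 < p) :
    ∀ᶠ n in atTop, ∑ x ∈ Finset.univ.filter (fun x => GoodB (G n) ρ(n) x),
      (μ n).real {ω | (((Sf Gt o obar (cov n x) ρ(n)).filter (fun y => ω ∈ Mv Gt o (cov n y) h s)).card : ℝ) ≤
      p / 2 * δ(d)^ρ(n)} ≤ ε * N n := by
  set ε' := ε * p^2 / 48 with hε'
  have e0 : 0 < ε' := by positivity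
  obtain ⟨C, hC⟩ := Q.lln h s (δ := ε') e0
  have h3 := Q.d3
  have hm : Tendsto (fun n => δ(d)^ρ(n)) atTop atTop :=
    (tendsto_pow_atTop_atTop_of_one_lt (by linarith)).comp Q.r_tend
  filter_upwards [hC, Q.bad e0, hm.eventually_ge_atTop (C / ε')] with n h1 h2 h4
  have := (Q.gf n).isProb
  set m := δ(d)^ρ(n) with hmdef
  have m0 : 0 < m := by rw [hmdef]; apply pow_pos; linarith
  rw [div_le_iff₀ e0] at h4
  set Bad := Finset.univ.filter (fun x => ¬ GoodB (G n) ρ(n) x) with hBad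
  set Gd := Finset.univ.filter (fun x => GoodB (G n) ρ(n) x) with hGd
  set b : V n → ℝ := fun x => (((Sf Gt o obar (cov n x) ρ(n)).filter (fun y => y ∈ Bad)).card : ℝ)
  have key : ∀ x ∈ Gd, (μ n).real {ω | (((Sf Gt o obar (cov n x) ρ(n)).filter (fun y => ω ∈ Mv Gt o (cov n y) h s)).card : ℝ) ≤
      p / 2 * m} ≤ 4 / p^2 * (4 * ε' + 2 * b x / m) := by
    intro x hx
    have hx' : GoodB (G n) ρ(n) x := by simpa [hGd] using hx
    have hc : ((Sf Gt o obar (cov n x) ρ(n)).card : ℝ) = m := by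
      rw [Q.Sf_card n x hx', hmdef]
      have hd := Q.th.hd
      push_cast [Nat.cast_sub (show 1 ≤ d by omega)]; rfl
    have h5 := cheb (μ n) (fun x => Mv Gt o (cov n x) h s) (fun x => Mv_meas Q.th _ h s) _
      (t := p / 2 * m) (by positivity) (h1 (Sf Gt o obar (cov n x) ρ(n)))
    rw [hc, ← hp] at h5
    have e1 : p * m - p / 2 * m = p / 2 * m := by ring
    rw [e1] at h5
    have e2 : (((Sf Gt o obar (cov n x) ρ(n)).filter (fun x => ¬ GoodB (G n) ρ(n) x)).card : ℝ) = b x := by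
      simp [b, hBad]
    rw [e2] at h5
    refine h5.trans ?_
    rw [div_le_iff₀ (by positivity)]
    have e3 : 4 / p ^ 2 * (4 * ε' + 2 * b x / m) * (p / 2 * m) ^ 2 = 4 * ε' * m^2 + 2 * b x * m := by
      field_simp; ring
    rw [e3]
    nlinarith
  refine (sum_le_sum key).trans ?_
  rw [← mul_sum, sum_add_distrib, ← sum_div, sum_const, nsmul_eq_mul, ← mul_sum Gd b]
  have h6 := Q.dc n ρ(n) Gd Bad
  have h7 : (Gd.card : ℝ) ≤ N n := by rw [Q.hN]; exact_mod_cast card_le_univ _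
  have h8 : 2 * (∑ x ∈ Gd, b x) / m ≤ 8 * (ε' * N n) := by
    rw [div_le_iff₀ m0]
    have h9 : (Bad.card : ℝ) * (4 * m) ≤ ε' * N n * (4 * m) := by gcongr
    have h10 : ∑ x ∈ Gd, b x ≤ ε' * N n * (4 * m) := h6.trans h9
    nlinarith
  have h9 : (Gd.card : ℝ) * (4 * ε') ≤ N n * (4 * ε') := by gcongr
  calc 4 / p^2 * (Gd.card * (4 * ε') + 2 * (∑ x ∈ Gd, b x) / m) ≤ 4 / p^2 * (N n * (4 * ε') + 8 * (ε' * N n)) := by gcongr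
    _ = ε * N n := by rw [hε']; field_simp; ring
end
end GFF

namespace GFF
set_option linter.all false

section
variable {V : Type} [Fintype V] {G : SimpleGraph V} {d : ℕ} {β : ℝ}

def Conn (G : SimpleGraph V) (A B s : Finset V) : Prop :=
  ∀ W : Set V, (∀ x ∈ A, x ∈ s → x ∈ W) → (∀ x ∈ W, ∀ y ∈ s, G.Adj x y → y ∈ W) → ∃ y ∈ B, y ∈ W

noncomputable def ukill (G : SimpleGraph V) (d : ℕ) (A U : Finset V) : ℕ → V → ℝ
  | 0 => fun y => if y ∈ A ∧ y ∉ U then 1 else 0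
  | k+1 => fun y => if y ∈ U then 0 else ∑ z, lazyP G d y z * ukill G d A U k z

lemma lazy_nonneg1 (x y : V) : 0 ≤ lazyP G d x y := by
  have := lazy_nonneg (G := G) (d := d) 1 x y
  grind

lemma ukill_path (A U : Finset V) (k : ℕ) (y : V) (hy : ukill G d A U k y ≠ 0) :
    ∃ s : Finset V, s.card ≤ k + 1 ∧ Disjoint s U ∧
      ∀ W : Set V, (∀ x ∈ A, x ∈ s → x ∈ W) → (∀ x ∈ W, ∀ y ∈ s, G.Adj x y → y ∈ W) → y ∈ W := by
  induction k generalizing y with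
  | zero =>
    simp only [ukill, ne_eq, ite_eq_right_iff, one_ne_zero, imp_false, not_not] at hy
    refine ⟨{y}, by simp, by simpa using hy.2, fun W h1 _ => h1 y hy.1 (by simp)⟩
  | succ k ih =>
    simp only [ukill] at hy
    split_ifs at hy with hU
    · grind
    obtain ⟨z, _, hz⟩ := exists_ne_zero_of_sum_ne_zero hy
    have hz1 : lazyP G d y z ≠ 0 := left_ne_zero_of_mul hz
    obtain ⟨s, s1, s2, s3⟩ := ih z (right_ne_zero_of_mul hz)
    refine ⟨insert y s, ?_, ?_, ?_⟩
    · exact (Finset.card_insert_le _ _).trans (by omega)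
    · grind
    · intro W h1 h2
      have hzW := s3 W (fun x hx hs => h1 x hx (Finset.mem_insert_of_mem hs))
        (fun x hx w hw => h2 x hx w (Finset.mem_insert_of_mem hw))
      by_cases hyz : y = z
      · grind
      · rw [lazy_apply, if_neg hyz] at hz1
        have : G.Adj y z := by
          by_contra hn
          apply hz1
          simp [transP, hn]
        exact h2 z hzW y (Finset.mem_insert_self _ _) this.symm

lemma GH.ukill_bd (h : GH G d β) (A U : Finset V) (k : ℕ) :
    (∀ y, 0 ≤ ukill G d A U k y ∧ ukill G d A U k y ≤ ∑ x ∈ A, (lazyP G d ^ k) y x) ∧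
    ∑ y, (∑ x ∈ A, (lazyP G d ^ k) y x - ukill G d A U k y) ≤ (k + 1) * U.card := by
  induction k with
  | zero =>
    have e : ∀ y, ∑ x ∈ A, (lazyP G d ^ 0) y x = if y ∈ A then 1 else 0 := by
      intro y; simp [Matrix.one_apply]
    constructor
    · intro y
      rw [e]; simp only [ukill]
      grind
    · simp only [e, ukill]
      calc _ ≤ ∑ y, (if y ∈ U then (1:ℝ) else 0) := by
            refine sum_le_sum fun y _ => ?_
            grind
        _ = _ := by simp
  | succ k ih =>
    obtain ⟨i1, i2⟩ := ih
    set v : V → ℝ := fun y => ∑ x ∈ A, (lazyP G d ^ k) y x with hv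
    set u := ukill G d A U k with hu
    have e : ∀ y, ∑ x ∈ A, (lazyP G d ^ (k+1)) y x = ∑ z, lazyP G d y z * v z := by
      intro y
      simp only [pow_succ', Matrix.mul_apply, hv, mul_sum]
      exact sum_comm
    have hu0 : ∀ y, 0 ≤ ∑ z, lazyP G d y z * u z := fun y =>
      sum_nonneg fun z _ => mul_nonneg (lazy_nonneg1 _ _) (i1 z).1
    have huv : ∀ y, ∑ z, lazyP G d y z * u z ≤ ∑ z, lazyP G d y z * v z := fun y =>
      sum_le_sum fun z _ => mul_le_mul_of_nonneg_left (i1 z).2 (lazy_nonneg1 _ _)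
    have hv1 : ∀ y, ∑ z, lazyP G d y z * v z ≤ 1 := by
      intro y
      rw [← e, ← h.lazy_row (k+1) y]
      exact sum_le_sum_of_subset_of_nonneg (Finset.subset_univ _) fun _ _ _ => lazy_nonneg _ _ _
    constructor
    · intro y
      rw [e]
      simp only [ukill]
      split_ifs
      · exact ⟨le_rfl, (hu0 y).trans (huv y)⟩
      · exact ⟨hu0 y, huv y⟩
    · simp only [e, ukill]
      calc _ ≤ ∑ y, ((∑ z, lazyP G d y z * (v z - u z)) + if y ∈ U then (1:ℝ) else 0) := by
            refine sum_le_sum fun y _ => ?_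
            simp only [mul_sub, sum_sub_distrib]
            split_ifs
            · linarith [hv1 y, huv y]
            · linarith
        _ = ∑ z, (v z - u z) + U.card := by
            rw [sum_add_distrib]
            congr 1
            · have : ∑ y, ∑ z, lazyP G d y z * (v z - u z) = ∑ z, ∑ y, lazyP G d y z * (v z - u z) := sum_comm
              rw [this]
              refine sum_congr rfl fun z _ => ?_
              rw [← sum_mul]
              have : ∑ y, lazyP G d y z = 1 := by
                have h1 := h.lazy_row 1 z
                have h2 := h.lazy_symm 1
                grind
              grind
            · simp
        _ ≤ _ := by grind

lemma GH.cnct (h : GH G d β) (l : ℕ) (A B U : Finset V)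
    (hlt : ((l:ℝ) + 1) * U.card < (A.card : ℝ) * B.card / (Fintype.card V : ℝ) - (1 - β / 2) ^ l * (Fintype.card V : ℝ)) :
    ∃ s : Finset V, s.card ≤ l + 1 ∧ Disjoint s U ∧ Conn G A B s := by
  obtain ⟨h1, h2⟩ := h.ukill_bd A U l
  have h3 := h.mix l A B
  have h4 : ∑ x ∈ A, ∑ y ∈ B, (lazyP G d ^ l) x y = ∑ y ∈ B, ∑ x ∈ A, (lazyP G d ^ l) y x := by
    have e : ∑ x ∈ A, ∑ y ∈ B, (lazyP G d ^ l) x y = ∑ y ∈ B, ∑ x ∈ A, (lazyP G d ^ l) x y := sum_comm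
    exact e.trans (sum_congr rfl fun y _ => sum_congr rfl fun x _ => h.lazy_symm l x y)
  have h5 : ∑ y ∈ B, (∑ x ∈ A, (lazyP G d ^ l) y x - ukill G d A U l y) ≤ ((l:ℝ) + 1) * U.card := by
    refine le_trans ?_ h2
    exact sum_le_sum_of_subset_of_nonneg (Finset.subset_univ _) fun y _ _ => by grind
  rw [sum_sub_distrib] at h5
  have h6 : 0 < ∑ y ∈ B, ukill G d A U l y := by linarith
  obtain ⟨y, hy, hy0⟩ := exists_ne_zero_of_sum_ne_zero h6.ne'
  obtain ⟨s, s1, s2, s3⟩ := ukill_path A U l y hy0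
  exact ⟨s, s1, s2, fun W w1 w2 => ⟨y, hy, s3 W w1 w2⟩⟩

lemma GH.fam (h : GH G d β) (l : ℕ) (A B W : Finset V) (k : ℕ)
    (hlt : ((l:ℝ) + 1) * (W.card + (l + 1) * k) < (A.card : ℝ) * B.card / (Fintype.card V : ℝ) - (1 - β / 2) ^ l * (Fintype.card V : ℝ)) :
    ∃ F : ℕ → Finset V, (∀ i < k, (F i).card ≤ l + 1 ∧ Disjoint (F i) W ∧ Conn G A B (F i)) ∧
      ∀ i < k, ∀ j < i, Disjoint (F i) (F j) := by
  induction k with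
  | zero => exact ⟨fun _ => ∅, by simp, by simp⟩
  | succ k ih =>
    have hl : (0:ℝ) ≤ ((l:ℝ) + 1) * (l+1) := by positivity
    push_cast at hlt
    obtain ⟨F, f1, f2⟩ := ih (by nlinarith)
    set U := W ∪ (Finset.range k).biUnion F with hU
    have hUc : (U.card : ℝ) ≤ W.card + (l+1) * k := by
      have : U.card ≤ W.card + k * (l+1) := by
        refine (Finset.card_union_le _ _).trans ?_
        gcongr
        calc _ ≤ ∑ i ∈ Finset.range k, (F i).card := Finset.card_biUnion_le
          _ ≤ ∑ i ∈ Finset.range k, (l+1) := sum_le_sum fun i hi => (f1 i (Finset.mem_range.1 hi)).1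
          _ = _ := by simp
      have : (U.card : ℝ) ≤ ((W.card + k * (l+1) : ℕ) : ℝ) := by exact_mod_cast this
      grind
    obtain ⟨s, s1, s2, s3⟩ := h.cnct l A B U (by
      refine lt_of_le_of_lt ?_ hlt
      have : (0:ℝ) ≤ (l:ℝ) + 1 := by positivity
      apply mul_le_mul_of_nonneg_left _ this
      nlinarith)
    rw [hU, Finset.disjoint_union_right, Finset.disjoint_biUnion_right] at s2
    refine ⟨fun i => if i = k then s else F i, ?_, ?_⟩
    · grind
    grind
end
end GFF

namespace GFF
set_option linter.all false

section
variable {V : Type} [Fintype V]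

def Ev (H : Set ℝ) (F : ℕ → Finset V) (J : V → Set ℝ) (k : ℕ) : Set (V → ℝ) :=
  {ω | (∀ x, ω x ∈ J x) ∧ ∀ i < k, ∃ x ∈ F i, ω x ∉ H}

noncomputable def Jm (H : Set ℝ) (F : Finset V) (J : V → Set ℝ) : V → Set ℝ :=
  fun x => if x ∈ F then J x ∩ H else J x

lemma Jm_meas {H : Set ℝ} (hH : MeasurableSet H) (F : Finset V) {J : V → Set ℝ} (hJ : ∀ x, MeasurableSet (J x)) (x : V) :
    MeasurableSet (Jm H F J x) := by
  unfold Jm; split_ifs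
  · exact (hJ x).inter hH
  · exact hJ x

lemma Ev_meas {H : Set ℝ} (hH : MeasurableSet H) (F : ℕ → Finset V) {J : V → Set ℝ} (hJ : ∀ x, MeasurableSet (J x)) (k : ℕ) :
    MeasurableSet (Ev H F J k) := by
  have : Ev H F J k = (⋂ x, (fun ω : V → ℝ => ω x) ⁻¹' J x) ∩ ⋂ i : ℕ, ⋂ _ : i < k, ⋃ x ∈ F i, (fun ω : V → ℝ => ω x) ⁻¹' Hᶜ := by
    ext ω; simp [Ev]
  rw [this]
  refine (MeasurableSet.iInter fun x => (measurable_pi_apply x) (hJ x)).inter ?_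
  refine MeasurableSet.iInter fun i => MeasurableSet.iInter fun _ => ?_
  exact Finset.measurableSet_biUnion _ fun x _ => (measurable_pi_apply x) hH.compl

lemma Ev_succ (H : Set ℝ) (F : ℕ → Finset V) (J : V → Set ℝ) (k : ℕ) :
    Ev H F J (k+1) = Ev H F J k \ Ev H F (Jm H (F k) J) k := by
  ext ω
  simp only [Ev, Jm, mem_diff, mem_setOf_eq]
  constructor
  · rintro ⟨h1, h2⟩
    refine ⟨⟨h1, fun i hi => h2 i (by omega)⟩, ?_⟩
    rintro ⟨h3, _⟩
    obtain ⟨x, hx, hx2⟩ := h2 k (by omega)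
    grind
  · rintro ⟨⟨h1, h2⟩, h3⟩
    refine ⟨h1, fun i hi => ?_⟩
    by_cases hk : i < k
    · exact h2 i hk
    grind

lemma Ev_sub (H : Set ℝ) (F : ℕ → Finset V) (J : V → Set ℝ) (E : Finset V) (k : ℕ) :
    Ev H F (Jm H E J) k ⊆ Ev H F J k := by
  rintro ω ⟨h1, h2⟩
  refine ⟨fun x => ?_, h2⟩
  have := h1 x
  unfold Jm at this
  grind

variable (m : V → Measure ℝ) [∀ x, IsProbabilityMeasure (m x)]

lemma Ev_real_succ {H : Set ℝ} (hH : MeasurableSet H) (F : ℕ → Finset V) {J : V → Set ℝ} (hJ : ∀ x, MeasurableSet (J x)) (k : ℕ) :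
    (Measure.pi m).real (Ev H F J (k+1)) = (Measure.pi m).real (Ev H F J k) - (Measure.pi m).real (Ev H F (Jm H (F k) J) k) := by
  rw [Ev_succ, measureReal_diff (Ev_sub _ _ _ _ _) (Ev_meas hH F (Jm_meas hH _ hJ) k)]

lemma Ev_ratio {H : Set ℝ} (hH : MeasurableSet H) (F : ℕ → Finset V) (E : Finset V) (k : ℕ) (hd : ∀ i < k, Disjoint E (F i))
    (J J' : V → Set ℝ) (hJ : ∀ x, MeasurableSet (J x)) (hJ' : ∀ x, MeasurableSet (J' x)) (he : ∀ x, x ∉ E → J x = J' x) :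
    (Measure.pi m).real (Ev H F J' k) * ∏ x ∈ E, (m x).real (J x) = (Measure.pi m).real (Ev H F J k) * ∏ x ∈ E, (m x).real (J' x) := by
  induction k generalizing J J' with
  | zero =>
    have e : ∀ J : V → Set ℝ, (Measure.pi m).real (Ev H F J 0) = (∏ x ∈ E, (m x).real (J x)) * ∏ x ∈ Eᶜ, (m x).real (J x) := by
      intro J
      rw [Finset.prod_mul_prod_compl]
      have : Ev H F J 0 = univ.pi J := by ext ω; simp [Ev]
      rw [this, measureReal_def, Measure.pi_pi, ENNReal.toReal_prod]; rfl
    rw [e, e]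
    have : ∏ x ∈ Eᶜ, (m x).real (J x) = ∏ x ∈ Eᶜ, (m x).real (J' x) :=
      prod_congr rfl fun x hx => by rw [he x (by simpa using hx)]
    grind
  | succ k ih =>
    rw [Ev_real_succ m hH F hJ, Ev_real_succ m hH F hJ', sub_mul, sub_mul,
      ih (fun i hi => hd i (by omega)) J J' hJ hJ' he]
    have h1 := ih (fun i hi => hd i (by omega)) (Jm H (F k) J) (Jm H (F k) J') (Jm_meas hH _ hJ) (Jm_meas hH _ hJ')
      (fun x hx => by unfold Jm; rw [he x hx])
    have e : ∀ J : V → Set ℝ, ∏ x ∈ E, (m x).real (Jm H (F k) J x) = ∏ x ∈ E, (m x).real (J x) := by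
      intro J
      refine prod_congr rfl fun x hx => ?_
      have : x ∉ F k := Finset.disjoint_left.1 (hd k (by omega)) hx
      simp [Jm, this]
    rw [e, e] at h1
    rw [h1]

lemma Ev_bound {H : Set ℝ} (hH : MeasurableSet H) (F : ℕ → Finset V) (J : V → Set ℝ) (hJ : ∀ x, MeasurableSet (J x))
    (hpos : ∀ x, 0 < (m x).real (J x)) {σ : ℝ} (h0 : 0 ≤ σ) (h1 : σ ≤ 1) (l k : ℕ)
    (hF : ∀ i < k, (F i).card ≤ l ∧ ∀ x ∈ F i, σ * (m x).real (J x) ≤ (m x).real (J x ∩ H))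
    (hdis : ∀ i < k, ∀ j < i, Disjoint (F i) (F j)) :
    (Measure.pi m).real (Ev H F J k) ≤ (1 - σ ^ l) ^ k * (Measure.pi m).real (univ.pi J) := by
  induction k with
  | zero =>
    have : Ev H F J 0 = univ.pi J := by ext ω; simp [Ev]
    grind
  | succ k ih =>
    rw [Ev_real_succ m hH F hJ]
    have i1 := ih (fun i hi => hF i (by omega)) (fun i hi => hdis i (by omega))
    have h2 := Ev_ratio m hH F (F k) k (fun j hj => hdis k (by omega) j hj) J (Jm H (F k) J) hJ (Jm_meas hH _ hJ)
      (fun x hx => by simp [Jm, hx])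
    have p0 : 0 < ∏ x ∈ F k, (m x).real (J x) := Finset.prod_pos fun x _ => hpos x
    have h3 : σ ^ l * ∏ x ∈ F k, (m x).real (J x) ≤ ∏ x ∈ F k, (m x).real (Jm H (F k) J x) := by
      calc _ ≤ σ ^ (F k).card * ∏ x ∈ F k, (m x).real (J x) :=
            mul_le_mul_of_nonneg_right (pow_le_pow_of_le_one h0 h1 (hF k (by omega)).1) p0.le
        _ = ∏ x ∈ F k, (σ * (m x).real (J x)) := by rw [Finset.prod_mul_distrib, prod_const]
        _ ≤ _ := by
          refine Finset.prod_le_prod (fun x _ => mul_nonneg h0 (hpos x).le) fun x hx => ?_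
          simp only [Jm, hx, if_true]
          grind
    have h4 : σ ^ l * (Measure.pi m).real (Ev H F J k) ≤ (Measure.pi m).real (Ev H F (Jm H (F k) J) k) := by
      refine le_of_mul_le_mul_right ?_ p0
      rw [h2, mul_assoc, mul_comm (σ ^ l), mul_assoc, mul_comm _ (σ ^ l)]
      exact mul_le_mul_of_nonneg_left h3 measureReal_nonneg
    have h5 : 0 ≤ 1 - σ ^ l := by linarith [pow_le_one₀ (n := l) h0 h1]
    rw [pow_succ]
    nlinarith

lemma part_count (c : V → Finset V) (M : Finset V) (s : ℕ) (hs : ∀ x ∈ M, s ≤ (c x).card)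
    (hd : ∀ x ∈ M, ∀ y ∈ M, c x = c y ∨ Disjoint (c x) (c y)) :
    ∃ q : ℕ, q * s ≤ Fintype.card V ∧
      (Finset.univ.filter (fun A : Finset V => A ⊆ M ∧ ∀ x ∈ A, ∀ y ∈ M, c x = c y → y ∈ A)).card ≤ 2 ^ q := by
  refine ⟨(M.image c).card, ?_, ?_⟩
  · have h1 : ((M.image c).biUnion id).card = ∑ t ∈ M.image c, t.card := by
      refine Finset.card_biUnion ?_
      intro a ha b hb hab
      grind
    calc (M.image c).card * s = ∑ t ∈ M.image c, s := by simp
      _ ≤ ∑ t ∈ M.image c, t.card := sum_le_sum fun t ht => by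
          grind
      _ ≤ _ := by rw [← h1]; exact card_le_univ _
  · rw [← Finset.card_powerset]
    refine Finset.card_le_card_of_injOn (fun A => A.image c) ?_ ?_
    · intro A hA
      grind
    · have key : ∀ A B : Finset V, (A ⊆ M ∧ ∀ x ∈ A, ∀ y ∈ M, c x = c y → y ∈ A) → (B ⊆ M ∧ ∀ x ∈ B, ∀ y ∈ M, c x = c y → y ∈ B) →
          A.image c = B.image c → A ⊆ B := by
        intro A B hA hB he x hx
        have : c x ∈ B.image c := by grind
        grind
      intro A hA B hB he
      grind
end
end GFF

namespace GFF
set_option linter.all false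

section
variable {V : Type} [Fintype V] {G : SimpleGraph V} {d : ℕ} {β : ℝ}

def ecomp (G : SimpleGraph V) (E : Set V) (x : V) : Set V :=
  {y | ∃ p : G.Walk x y, ∀ v ∈ p.support, v ∈ E}

lemma ecomp_self {E : Set V} {x : V} (hx : x ∈ E) : x ∈ ecomp G E x :=
  ⟨Walk.nil, fun v hv => by simp_all⟩

lemma ecomp_mem {E : Set V} {x y : V} (hy : y ∈ ecomp G E x) : x ∈ E ∧ y ∈ E := by
  obtain ⟨p, hp⟩ := hy
  simp_all

lemma ecomp_symm {E : Set V} {x y : V} (hy : y ∈ ecomp G E x) : x ∈ ecomp G E y := by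
  obtain ⟨p, hp⟩ := hy
  exact ⟨p.reverse, fun v hv => hp v (by simp_all)⟩

lemma ecomp_trans {E : Set V} {x y z : V} (hy : y ∈ ecomp G E x) (hz : z ∈ ecomp G E y) : z ∈ ecomp G E x := by
  obtain ⟨p, hp⟩ := hy
  obtain ⟨q, hq⟩ := hz
  refine ⟨p.append q, fun v hv => ?_⟩
  aesop

lemma ecomp_eq {E : Set V} {x y : V} (hy : y ∈ ecomp G E x) : ecomp G E x = ecomp G E y := by
  ext z
  exact ⟨fun h => ecomp_trans (ecomp_symm hy) h, fun h => ecomp_trans hy h⟩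

lemma ecomp_mono {E E' : Set V} (h : E ⊆ E') (x : V) : ecomp G E x ⊆ ecomp G E' x := by
  rintro y ⟨p, hp⟩
  exact ⟨p, fun v hv => h (hp v hv)⟩

def clIn (G : SimpleGraph V) (E W : Set V) : Prop := ∀ u ∈ W, ∀ v, G.Adj u v → v ∈ E → v ∈ W

lemma clIn_walk {E W : Set V} (hW : clIn G E W) {x y : V} (hx : x ∈ W) (hy : y ∈ ecomp G E x) : y ∈ W := by
  obtain ⟨p, hp⟩ := hy
  induction p with
  | nil => exact hx
  | cons hadj q ih =>
    aesop

lemma clIn_ecomp (E : Set V) (x : V) : clIn G E (ecomp G E x) := by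
  intro u hu v huv hv
  refine ecomp_trans hu ⟨huv.toWalk, fun w hw => ?_⟩
  simp at hw
  rcases hw with rfl | rfl
  · exact (ecomp_mem hu).2
  · exact hv

noncomputable def ME (G : SimpleGraph V) (s : ℕ) (E : Set V) : Finset V :=
  Finset.univ.filter (fun x => s < (ecomp G E x).ncard)

lemma ME_mem {s : ℕ} {E : Set V} {x : V} (hx : x ∈ ME G s E) : x ∈ E := by
  have h1 : s < (ecomp G E x).ncard := by simpa [ME] using hx
  obtain ⟨y, hy⟩ := Set.nonempty_of_ncard_ne_zero (s := ecomp G E x) (by omega)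
  exact (ecomp_mem hy).1

def BdP (G : SimpleGraph V) (s : ℕ) (τ : ℝ) (E1 E2 : Set V) : Prop :=
  ∃ W : Set V, clIn G E1 W ∧ τ ≤ ((ME G s E2).filter (fun x => x ∈ W)).card ∧ τ ≤ ((ME G s E2).filter (fun x => x ∉ W)).card

lemma giant_of [Nonempty V] {s : ℕ} {τ : ℝ} (hτ : 0 < τ) {E1 E2 : Set V} (hE : E2 ⊆ E1) (hB : ¬ BdP G s τ E1 E2) :
    ∃ x0, (((ME G s E2).filter (fun x => x ∉ ecomp G E1 x0)).card : ℝ) ≤ 3 * τ := by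
  by_contra hn
  push Not at hn
  unfold BdP at hB
  push Not at hB
  set M := ME G s E2
  have hsmall : ∀ x, ((M.filter (fun y => y ∈ ecomp G E1 x)).card : ℝ) < τ := by
    intro x
    by_contra hc
    have := hB _ (clIn_ecomp E1 x) (not_lt.1 hc)
    linarith [hn x]
  obtain ⟨W, ⟨w1, w2⟩, w3⟩ := (toFinite {W : Set V | clIn G E1 W ∧ ((M.filter (fun y => y ∈ W)).card : ℝ) < τ}).exists_maximal
    ⟨∅, by intro u hu; grind, by simp_all⟩
  have hM : ∀ W : Set V, (M.card : ℝ) = (M.filter (fun y => y ∈ W)).card + (M.filter (fun y => y ∉ W)).card := by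
    intro W
    exact_mod_cast (Finset.card_filter_add_card_filter_not (s := M) (fun y => y ∈ W)).symm
  obtain ⟨x1⟩ := ‹Nonempty V›
  have hMbig : 3 * τ < M.card := by
    refine (hn x1).trans_le ?_
    exact_mod_cast Finset.card_filter_le _ _
  by_cases hsub : ∀ x ∈ M, x ∈ W
  · have : M.filter (fun y => y ∈ W) = M := Finset.filter_true_of_mem hsub
    grind
  · push Not at hsub
    obtain ⟨x, hx, hxW⟩ := hsub
    obtain ⟨W', hW'⟩ : ∃ W' : Set V, W' = W ∪ ecomp G E1 x := ⟨_, rfl⟩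
    have hcl : clIn G E1 W' := by
      rw [hW']
      rintro u (hu | hu) v huv hv
      · aesop
      · exact Or.inr (clIn_ecomp E1 x u hu v huv hv)
    have hxx : x ∈ ecomp G E1 x := ecomp_self (hE (ME_mem hx))
    have hbig : τ ≤ ((M.filter (fun y => y ∈ W')).card : ℝ) := by
      by_contra hc
      have := w3 ⟨hcl, not_le.1 hc⟩ (by grind)
      grind
    have h1 := hB _ hcl hbig
    have h2 := hM W'
    have h3 : ((M.filter (fun y => y ∈ W')).card : ℝ) ≤ (M.filter (fun y => y ∈ W)).card + (M.filter (fun y => y ∈ ecomp G E1 x)).card := by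
      have : M.filter (fun y => y ∈ W') = M.filter (fun y => y ∈ W) ∪ M.filter (fun y => y ∈ ecomp G E1 x) := by
        grind
      rw [this]
      exact_mod_cast Finset.card_union_le _ _
    linarith [hsmall x]

noncomputable def PartE (G : SimpleGraph V) (s : ℕ) (E : Set V) : Finset (Finset V) :=
  Finset.univ.filter (fun A => A ⊆ ME G s E ∧ ∀ x ∈ A, ∀ y ∈ ME G s E, ecomp G E x = ecomp G E y → y ∈ A)

lemma PartE_card (G : SimpleGraph V) {s : ℕ} (hs : 0 < s) (E : Set V) : (PartE G s E).card ≤ 2 ^ (Fintype.card V / s) := by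
  obtain ⟨q, q1, q2⟩ := part_count (fun x => (ecomp G E x).toFinset) (ME G s E) s (by
      intro x hx
      rw [← ncard_eq_toFinset_card']
      have h1 : s < (ecomp G E x).ncard := by simpa [ME] using hx
      exact h1.le) (by
      intro x _ y _
      by_cases hd : Disjoint (ecomp G E x) (ecomp G E y)
      · simp_all
      · left
        rw [Set.not_disjoint_iff] at hd
        obtain ⟨z, hz1, hz2⟩ := hd
        rw [Set.toFinset_inj, ecomp_eq hz1, ecomp_eq hz2])
  have : (PartE G s E).card ≤ 2 ^ q := by
    aesop
  refine this.trans (Nat.pow_le_pow_right (by norm_num) ?_)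
  rw [Nat.le_div_iff_mul_le hs]; exact q1

lemma GH.bd_prob (hG : GH G d β) (m : V → Measure ℝ) [∀ x, IsProbabilityMeasure (m x)] {h1 h2 τ σ : ℝ} (h12 : h1 < h2)
    (hτ : 0 < τ) {s : ℕ} (hs : 0 < s) (W0 : Finset V) (hσ0 : 0 ≤ σ) (hσ1 : σ ≤ 1)
    (hσ : ∀ x ∉ W0, σ ≤ (m x).real (Ico h1 h2)) (hm1 : ∀ x, 0 < (m x).real (Ici h2)) (hm2 : ∀ x, 0 < (m x).real (Iio h2))
    (l k : ℕ) (hlk : ((l:ℝ) + 1) * (W0.card + (l + 1) * k) < τ ^ 2 / (Fintype.card V : ℝ) - (1 - β / 2) ^ l * (Fintype.card V : ℝ)) :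
    (Measure.pi m).real {θ | BdP G s τ {x | h1 ≤ θ x} {x | h2 ≤ θ x}} ≤
      2 ^ (Fintype.card V / s) * (1 - σ ^ (l+1)) ^ k := by
  have hNV := hG.conn.nonempty
  have hNp : (0:ℝ) < Fintype.card V := by positivity
  set J : Set V → V → Set ℝ := fun E x => if x ∈ E then Ici h2 else Iio h2 with hJ
  have Jmeas : ∀ E x, MeasurableSet (J E x) := by
    aesop
  have Jpos : ∀ E x, 0 < (m x).real (J E x) := by
    grind
  have Jiff : ∀ E (θ : V → ℝ), θ ∈ univ.pi (J E) ↔ {x | h2 ≤ θ x} = E := by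
    grind
  set D : Set V → Finset V → Set (V → ℝ) := fun E A => {θ | {x | h2 ≤ θ x} = E ∧ ∃ W : Set V, clIn G {x | h1 ≤ θ x} W ∧
    A = (ME G s E).filter (fun x => x ∈ W) ∧ τ ≤ A.card ∧ τ ≤ ((ME G s E).filter (fun x => x ∉ A)).card} with hD
  have q0 : 0 ≤ 1 - σ ^ (l+1) := by linarith [pow_le_one₀ (n := l+1) hσ0 hσ1]
  have Dbd : ∀ E A, (Measure.pi m).real (D E A) ≤ (1 - σ ^ (l+1)) ^ k * (Measure.pi m).real (univ.pi (J E)) := by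
    intro E A
    by_cases hne : τ ≤ A.card ∧ τ ≤ ((ME G s E).filter (fun x => x ∉ A)).card
    swap
    · have : D E A = ∅ := by
        grind
      rw [this]; simp; positivity
    set B := (ME G s E).filter (fun x => x ∉ A) with hB
    obtain ⟨F, f1, f2⟩ := hG.fam l A B W0 k (by
      refine hlk.trans_le ?_
      gcongr
      nlinarith)
    refine le_trans (measureReal_mono ?_) (Ev_bound m (measurableSet_Ici (a := h1)) F (J E) (Jmeas E) (Jpos E) hσ0 hσ1 (l+1) k ?_ f2)
    · rintro θ ⟨t1, W, t2, t3, t4⟩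
      refine ⟨?_, ?_⟩
      · grind
      · intro i hi
        by_contra hc
        push Not at hc
        obtain ⟨y, hy, hyW⟩ := (f1 i hi).2.2 W (fun x hx _ => by
            grind) (fun x hx y hy hxy => t2 x hx y hxy (hc y hy))
        grind
    · intro i hi
      refine ⟨(f1 i hi).1, fun x hx => ?_⟩
      have hxW : x ∉ W0 := Finset.disjoint_left.1 (f1 i hi).2.1 hx
      by_cases hxE : x ∈ E
      · have : J E x ∩ Ici h1 = J E x := by
          grind
        simp_all
      · have : J E x ∩ Ici h1 = Ico h1 h2 := by
          grind
        rw [this]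
        exact (mul_le_of_le_one_right hσ0 measureReal_le_one).trans (hσ x hxW)
  have hsub : {θ : V → ℝ | BdP G s τ {x | h1 ≤ θ x} {x | h2 ≤ θ x}} ⊆ ⋃ E ∈ (Finset.univ : Finset (Set V)), ⋃ A ∈ PartE G s E, D E A := by
    rintro θ ⟨W, w1, w2, w3⟩
    simp only [mem_iUnion]
    refine ⟨{x | h2 ≤ θ x}, Finset.mem_univ _, (ME G s {x | h2 ≤ θ x}).filter (fun x => x ∈ W), ?_, rfl, W, w1, rfl, w2, ?_⟩
    · unfold PartE
      rw [mem_filter]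
      refine ⟨Finset.mem_univ _, Finset.filter_subset _ _, ?_⟩
      intro x hx y hy hxy
      rw [mem_filter] at hx ⊢
      refine ⟨hy, clIn_walk w1 hx.2 ?_⟩
      have : y ∈ ecomp G {x | h2 ≤ θ x} x := by rw [hxy]; exact ecomp_self (ME_mem hy)
      exact ecomp_mono (fun z hz => h12.le.trans hz) x this
    simp_all
  have hsum : ∑ E : Set V, (Measure.pi m).real (univ.pi (J E)) ≤ 1 := by
    rw [← measureReal_biUnion_finset]
    · simp_all
    · intro E _ E' _ hEE
      grind
    · intro E _
      exact MeasurableSet.univ_pi (Jmeas E)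
  calc _ ≤ (Measure.pi m).real (⋃ E ∈ (Finset.univ : Finset (Set V)), ⋃ A ∈ PartE G s E, D E A) := measureReal_mono hsub (measure_ne_top _ _)
    _ ≤ ∑ E : Set V, (Measure.pi m).real (⋃ A ∈ PartE G s E, D E A) := measureReal_biUnion_finset_le _ _
    _ ≤ ∑ E : Set V, (2 ^ (Fintype.card V / s) * (1 - σ ^ (l+1)) ^ k) * (Measure.pi m).real (univ.pi (J E)) := by
        refine sum_le_sum fun E _ => ?_
        refine (measureReal_biUnion_finset_le _ _).trans ?_
        refine (sum_le_sum fun A _ => Dbd E A).trans ?_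
        rw [sum_const, nsmul_eq_mul, mul_assoc]
        refine mul_le_mul_of_nonneg_right ?_ (by positivity)
        exact_mod_cast PartE_card G hs E
    _ = (2 ^ (Fintype.card V / s) * (1 - σ ^ (l+1)) ^ k) * ∑ E : Set V, (Measure.pi m).real (univ.pi (J E)) := by rw [mul_sum]
    _ ≤ _ := mul_le_of_le_one_right (by positivity) hsum
end
end GFF

namespace GFF
set_option linter.all false

lemma GF.add {I J : Type*} [Fintype I] [Fintype J] {μ : Measure (I → ℝ)} {K : I → I → ℝ}
    {ν : Measure (J → ℝ)} {L : J → J → ℝ} (h : GF μ K) (h' : GF ν L) (B : I → J → ℝ) :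
    GF ((μ.prod ν).map (fun p i => p.1 i + ∑ j, B i j * p.2 j))
      (fun i i' => K i i' + ∑ j, ∑ j', B i j * B i' j' * L j j') := by
  have := h.1
  have := h'.1
  have e := (GF.prod h h').lin (fun i => (Sum.elim (fun i' => if i = i' then 1 else 0) (fun j => B i j) : I ⊕ J → ℝ))
  rw [Measure.map_map (measurable_pi_iff.2 fun i => measurable_sum _ fun j _ => (measurable_pi_apply j).const_mul _)
    (measurable_pi_iff.2 fun i => by rcases i with i | j <;> simp <;> fun_prop)] at e
  have e2 : ((fun (ω : I ⊕ J → ℝ) (j : I) => ∑ i, (Sum.elim (fun i' => if j = i' then 1 else 0) (fun j' => B j j') : I ⊕ J → ℝ) i * ω i) ∘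
      (fun p : (I → ℝ) × (J → ℝ) => (Sum.elim p.1 p.2 : I ⊕ J → ℝ))) = fun p i => p.1 i + ∑ j, B i j * p.2 j := by
    funext p i
    simp [sum_sum_type]
  rw [e2] at e
  refine e.congr fun i j => ?_
  simp [sum_sum_type]

lemma meas_thr2 {I : Type*} [Fintype I] (a b : ℝ) (P : Set I → Set I → Prop) :
    MeasurableSet {ω : I → ℝ | P {i | a ≤ ω i} {i | b ≤ ω i}} := by
  have : {ω : I → ℝ | P {i | a ≤ ω i} {i | b ≤ ω i}} = ⋃ S : Set I, ({ω | {i | a ≤ ω i} = S} ∩ {ω | P S {i | b ≤ ω i}}) := by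
    ext ω; simp
  rw [this]
  exact MeasurableSet.iUnion fun S => (measurableSet_thr a (fun S' => S' = S)).inter (measurableSet_thr b (fun S' => P S S'))

lemma gauss_unif {v : ℝ≥0} (hv : v ≠ 0) (Mo : ℝ) {h1 h2 : ℝ} (h12 : h1 < h2) :
    ∃ σ : ℝ, 0 < σ ∧ σ ≤ 1 ∧ ∀ a, |a| ≤ Mo → σ ≤ (gaussianReal a v).real (Ico h1 h2) := by
  set R := |h1| + |h2| + Mo with hR
  set c := (√(2 * Real.pi * v))⁻¹ * Real.exp (-R ^ 2 / (2 * v)) with hc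
  have hvp : (0:ℝ) < v := by positivity
  have hc0 : 0 < c := by
    positivity
  have key : ∀ a, |a| ≤ Mo → c * (h2 - h1) ≤ (gaussianReal a v).real (Ico h1 h2) := by
    intro a ha
    rw [measureReal_def, gaussianReal_apply_eq_integral _ hv, ENNReal.toReal_ofReal
      (integral_nonneg fun x => gaussianPDFReal_nonneg _ _ _)]
    have h3 := setIntegral_ge_of_const_le_real (μ := volume) (s := Ico h1 h2) (f := gaussianPDFReal a v) (c := c)
      measurableSet_Ico (by simp) ?_ (integrable_gaussianPDFReal a v).integrableOn
    · rwa [Real.volume_real_Ico_of_le h12.le] at h3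
    · intro x hx
      rw [hc, gaussianPDFReal]
      refine mul_le_mul_of_nonneg_left (exp_le_exp.2 (div_le_div_of_nonneg_right ?_ (by positivity))) (by positivity)
      · have h4 : |x - a| ≤ R := by
          grind
        have h5 : (x - a) ^ 2 ≤ R ^ 2 := sq_le_sq' (by grind) (abs_le.1 h4).2
        linarith
  refine ⟨min 1 (c * (h2 - h1)), ?_, min_le_left _ _, fun a ha => (min_le_right _ _).trans (key a ha)⟩
  positivity

section
variable {V : Type} [Fintype V] {G : SimpleGraph V} {d : ℕ} {β : ℝ}

lemma GH.decomp (hG : GH G d β) {μ : Measure (V → ℝ)} (hμ : GF μ (zG G d)) :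
    ∃ ν : Measure (V → ℝ), IsProbabilityMeasure ν ∧ (∀ x, Integrable (fun ω : V → ℝ => ω x ^ 2) ν ∧ ∫ ω, ω x ^ 2 ∂ν ≤ 1 / β) ∧
      (ν.prod (Measure.pi (fun _ : V => gaussianReal 0 (1/4)))).map (fun p x => p.1 x + p.2 x) =
      (μ.prod (Measure.pi (fun _ : Unit => gaussianReal 0 (1/4/(Fintype.card V : ℝ≥0))))).map (fun p x => p.1 x + p.2 ()) := by
  obtain ⟨ν, hν⟩ := GF.exists (fun x y => zG G d x y - 1/4*((if x=y then 1 else 0) - 1/(Fintype.card V:ℝ)))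
    (fun i j => by rw [hG.green_symm i j]; simp only [eq_comm]) hG.green_sub_psd
  refine ⟨ν, hν.1, fun x => ⟨(hν.sq x).1, ?_⟩, ?_⟩
  · rw [(hν.sq x).2]
    have h1 := (abs_le.1 (hG.green_abs x x)).2
    have : 1/(Fintype.card V:ℝ) ≤ 1 := by
      rw [div_le_one (by exact_mod_cast card_pos_iff.2 ⟨x⟩)]
      exact_mod_cast Nat.succ_le_of_lt (card_pos_iff.2 ⟨x⟩)
    simp only [if_true]
    linarith
  · have e1 := hν.add (GF.pi (I := V) (1/4)) (fun i j => if i = j then 1 else 0)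
    have e2 := hμ.add (GF.pi (I := Unit) (1/4/(Fintype.card V : ℝ≥0))) (fun _ _ => 1)
    simp only [ite_mul, one_mul, zero_mul, Finset.sum_ite_eq, Finset.mem_univ, if_true, Finset.univ_unique, Finset.sum_singleton] at e1 e2
    refine e1.unique (e2.congr fun i j => ?_)
    simp
    split_ifs with hij
    · ring
    · ring

lemma cond_bound {ν : Measure (V → ℝ)} [IsProbabilityMeasure ν] (v : ℝ≥0) {Q Bad : Set (V → ℝ)} (hQ : MeasurableSet Q)
    (hBad : MeasurableSet Bad) {κ : ℝ} (hκ : 0 ≤ κ)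
    (h : ∀ a, a ∉ Bad → (Measure.pi (fun x => gaussianReal (a x) v)).real Q ≤ κ) :
    ((ν.prod (Measure.pi (fun _ : V => gaussianReal 0 v))).map (fun p x => p.1 x + p.2 x)).real Q ≤ κ + ν.real Bad := by
  have hm : Measurable (fun (p : (V → ℝ) × (V → ℝ)) x => p.1 x + p.2 x) := by
    fun_prop
  have hpi : ∀ a : V → ℝ, (Measure.pi (fun _ : V => gaussianReal 0 v)).map (fun z x => a x + z x) = Measure.pi (fun x => gaussianReal (a x) v) := by
    intro a
    have := Measure.pi_map_pi (μ := fun _ : V => gaussianReal 0 v) (f := fun x z => a x + z) (fun x => by fun_prop)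
    rw [this]
    congr 1
    funext x
    rw [gaussianReal_map_const_add, zero_add]
  have e : ((ν.prod (Measure.pi (fun _ : V => gaussianReal 0 v))).map (fun p x => p.1 x + p.2 x)) Q ≤ ENNReal.ofReal κ + ν Bad := by
    rw [map_apply hm hQ, Measure.prod_apply (hm hQ)]
    have h1 : ∀ a, (Measure.pi (fun _ : V => gaussianReal 0 v)) (Prod.mk a ⁻¹' ((fun (p : (V → ℝ) × (V → ℝ)) x => p.1 x + p.2 x) ⁻¹' Q)) ≤
        ENNReal.ofReal κ + Bad.indicator 1 a := by
      intro a
      have h2 : (Measure.pi (fun _ : V => gaussianReal 0 v)) (Prod.mk a ⁻¹' ((fun (p : (V → ℝ) × (V → ℝ)) x => p.1 x + p.2 x) ⁻¹' Q))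
          = Measure.pi (fun x => gaussianReal (a x) v) Q := by
        rw [← hpi a, map_apply _ hQ]
        · rfl
        fun_prop
      rw [h2]
      by_cases ha : a ∈ Bad
      · rw [indicator_of_mem ha]
        exact prob_le_one.trans (by simp)
      · rw [indicator_of_notMem ha, add_zero, ← ofReal_measureReal]
        exact ENNReal.ofReal_le_ofReal (h a ha)
    refine (lintegral_mono h1).trans ?_
    rw [lintegral_add_left (by fun_prop), lintegral_const, measure_univ, mul_one, lintegral_indicator_one hBad]
  have : IsProbabilityMeasure ((ν.prod (Measure.pi (fun _ : V => gaussianReal 0 v))).map (fun p x => p.1 x + p.2 x)) :=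
    isProbabilityMeasure_map hm.aemeasurable
  have e3 := ENNReal.toReal_mono (by finiteness) e
  rw [ENNReal.toReal_add (by finiteness) (by finiteness), ENNReal.toReal_ofReal hκ] at e3
  exact e3

lemma bad_bound {ν : Measure (V → ℝ)} [IsProbabilityMeasure ν] {b A : ℝ} (hA : 0 < A)
    (h : ∀ x, Integrable (fun ω : V → ℝ => ω x ^ 2) ν ∧ ∫ ω, ω x ^ 2 ∂ν ≤ b) :
    MeasurableSet {ω : V → ℝ | A < ∑ x, ω x ^ 2} ∧ ν.real {ω : V → ℝ | A < ∑ x, ω x ^ 2} ≤ Fintype.card V * b / A := by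
  have hi : Integrable (fun ω : V → ℝ => ∑ x, ω x ^ 2) ν := integrable_finset_sum _ fun x _ => (h x).1
  constructor
  · exact measurableSet_lt measurable_const (measurable_sum _ fun i _ => (measurable_pi_apply i).pow_const 2)
  · have := mul_meas_ge_le_integral_of_nonneg (μ := ν) (ae_of_all _ fun ω => sum_nonneg fun x _ => sq_nonneg (ω x)) hi A
    rw [integral_finset_sum _ (fun x _ => (h x).1)] at this
    have h2 : ∑ x : V, ∫ ω, ω x ^ 2 ∂ν ≤ Fintype.card V * b := by
      refine (Finset.sum_le_card_nsmul _ _ b fun x _ => (h x).2).trans ?_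
      simp
    rw [le_div_iff₀ hA, mul_comm]
    refine le_trans ?_ (this.trans h2)
    have hsub : {ω : V → ℝ | A < ∑ x, ω x ^ 2} ⊆ {ω : V → ℝ | A ≤ ∑ x, ω x ^ 2} := fun ω hω => le_of_lt (show A < ∑ x, ω x ^ 2 from hω)
    exact mul_le_mul_of_nonneg_left (measureReal_mono hsub (measure_ne_top _ _)) hA.le

lemma zeta_half {ε : ℝ} (hε : 0 < ε) {n : ℝ≥0} (hn : (1:ℝ) ≤ n * ε ^ 2) :
    MeasurableSet {z : Unit → ℝ | |z ()| ≤ ε} ∧ 1/2 ≤ (Measure.pi (fun _ : Unit => gaussianReal 0 (1/4/n))).real {z : Unit → ℝ | |z ()| ≤ ε} := by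
  have hm : MeasurableSet {z : Unit → ℝ | |z ()| ≤ ε} := measurableSet_le (measurable_pi_apply ()).abs measurable_const
  refine ⟨hm, ?_⟩
  have hs := fun x => (GF.pi (I := Unit) (1/4/n)).sq x
  have hb := (bad_bound (V := Unit) (b := 1/4/n) (A := ε^2) (by positivity) (fun x => ⟨(hs x).1, by rw [(hs x).2]; simp⟩)).2
  have h0 : (0:ℝ) < n := by
    by_contra hc
    nlinarith [sq_nonneg ε, NNReal.coe_nonneg n]
  have hb2 : Fintype.card Unit * (1/4/(n:ℝ)) / ε^2 ≤ 1/4 := by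
    rw [Fintype.card_unit, Nat.cast_one, one_mul, div_div, div_le_iff₀ (by positivity)]
    linarith
  have hcompl := probReal_compl_eq_one_sub (μ := Measure.pi (fun _ : Unit => gaussianReal 0 (1/4/n))) hm
  have hsub : {z : Unit → ℝ | |z ()| ≤ ε}ᶜ ⊆ {z : Unit → ℝ | ε^2 < ∑ x, z x ^ 2} := by
    intro z hz
    simp at hz ⊢
    rw [← sq_abs (z ())]
    gcongr
  have := measureReal_mono (μ := Measure.pi (fun _ : Unit => gaussianReal 0 (1/4/n))) hsub (measure_ne_top _ _)
  linarith
end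
end GFF

namespace GFF
set_option linter.all false

section
variable {V : Type} [Fintype V] {G : SimpleGraph V} {d : ℕ} {β : ℝ}

lemma ME_mono {s : ℕ} {E E' : Set V} (h : E ⊆ E') : ME G s E ⊆ ME G s E' := by
  intro x hx
  simp only [ME, mem_filter, Finset.mem_univ, true_and] at hx ⊢
  exact hx.trans_le (ncard_le_ncard (ecomp_mono h x) (toFinite _))

lemma GH.giant_core (hG : GH G d β) {μ : Measure (V → ℝ)} (hμ : GF μ (zG G d)) {h ε δ w Mo σ : ℝ} (hε : 0 < ε) (hδ : 0 < δ)
    (hw : 0 < w) (hMo : 0 < Mo) (hσ0 : 0 ≤ σ) (hσ1 : σ ≤ 1) {s : ℕ} (hs : 0 < s) (l k : ℕ)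
    (hσ : ∀ a, |a| ≤ Mo → σ ≤ (gaussianReal a (1/4)).real (Ico (h+ε) (h+2*ε)))
    (hN : 1 ≤ (Fintype.card V : ℝ) * ε ^ 2)
    (hlk : ((l:ℝ)+1)*(w * Fintype.card V +(l+1)*k) < (δ * Fintype.card V)^2/(Fintype.card V:ℝ) - (1-β/2)^l*(Fintype.card V:ℝ)) :
    μ.real {ψ | ∀ x0, 3 * (δ * Fintype.card V) <
      (((ME G s {x | h + 3*ε ≤ ψ x}).filter (fun x => x ∉ ecomp G {x | h ≤ ψ x} x0)).card : ℝ)} ≤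
      2 * (2 ^ (Fintype.card V / s) * (1-σ^(l+1))^k + 1 / (β * w * Mo^2)) := by
  have hNV := hG.conn.nonempty
  have hNp : (0:ℝ) < Fintype.card V := by positivity
  have hpμ := hμ.1
  obtain ⟨ν, hν, hsq, hmap⟩ := hG.decomp hμ
  set Q : Set (V → ℝ) := {θ | BdP G s (δ * Fintype.card V) {x|h+ε≤θ x} {x|h+2*ε≤θ x}} with hQ
  have hQm : MeasurableSet Q := meas_thr2 _ _ _
  have hA : 0 < w * Fintype.card V * Mo^2 := by positivity
  obtain ⟨hBm, hBp⟩ := bad_bound (b := 1/β) hA hsq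
  have h1s : σ ^ (l+1) ≤ 1 := pow_le_one₀ hσ0 hσ1
  have hcb := cond_bound (ν := ν) (1/4) hQm hBm (κ := 2 ^ (Fintype.card V / s) * (1-σ^(l+1))^k)
    (mul_nonneg (by positivity) (pow_nonneg (by linarith) _)) (fun a ha => by
      simp only [mem_setOf_eq, not_lt] at ha
      set W0 := Finset.univ.filter (fun x => Mo < |a x|) with hW0
      have hc : (W0.card : ℝ) ≤ w * Fintype.card V := by
        have h3 : (W0.card : ℝ) * Mo^2 ≤ ∑ x, a x ^2 := by
          refine le_trans ?_ (sum_le_sum_of_subset_of_nonneg (Finset.subset_univ W0) fun x _ _ => sq_nonneg _)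
          rw [← nsmul_eq_mul]
          refine card_nsmul_le_sum _ _ _ fun x hx => ?_
          rw [← sq_abs (a x)]
          have := (mem_filter.1 hx).2
          gcongr
        exact le_of_mul_le_mul_right (h3.trans ha) (by positivity)
      refine hG.bd_prob (fun x => gaussianReal (a x) (1/4)) (by linarith) (by positivity) hs W0 hσ0 hσ1 (fun x hx => ?_)
        (fun x => ?_) (fun x => ?_) l k (lt_of_le_of_lt ?_ hlk)
      · grind
      · obtain ⟨t, ht, _, htt⟩ := gauss_unif (v := 1/4) (by norm_num) |a x| (show h+2*ε < h+2*ε+1 by linarith)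
        exact (ht.trans_le (htt _ le_rfl)).trans_le (measureReal_mono (fun y hy => hy.1) (measure_ne_top _ _))
      · obtain ⟨t, ht, _, htt⟩ := gauss_unif (v := 1/4) (by norm_num) |a x| (show h+2*ε-1 < h+2*ε by linarith)
        exact (ht.trans_le (htt _ le_rfl)).trans_le (measureReal_mono (fun y hy => hy.2) (measure_ne_top _ _))
      · gcongr)
  rw [hmap] at hcb
  have hbb : (Fintype.card V : ℝ) * (1/β) / (w * Fintype.card V * Mo^2) = 1 / (β * w * Mo^2) := by
    grind
  rw [hbb] at hBp
  obtain ⟨hzm, hz⟩ := zeta_half (n := (Fintype.card V : ℝ≥0)) hε (by simpa using hN)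
  set B := {ψ : V → ℝ | ∀ x0, 3 * (δ * Fintype.card V) <
      (((ME G s {x | h + 3*ε ≤ ψ x}).filter (fun x => x ∉ ecomp G {x | h ≤ ψ x} x0)).card : ℝ)} with hB
  have hm : Measurable (fun (p : (V → ℝ) × (Unit → ℝ)) (x : V) => p.1 x + p.2 ()) := by
    fun_prop
  have hsub : B ×ˢ {z : Unit → ℝ | |z ()| ≤ ε} ⊆ (fun (p : (V → ℝ) × (Unit → ℝ)) (x : V) => p.1 x + p.2 ()) ⁻¹' Q := by
    rintro ⟨ψ, ζ⟩ ⟨h1, h2⟩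
    simp only [mem_setOf_eq, hB] at h1 h2
    simp only [mem_preimage, hQ, mem_setOf_eq]
    by_contra hcon
    obtain ⟨x0, hx0⟩ := giant_of (by positivity) (fun x hx => by grind) hcon
    refine absurd (h1 x0) (not_lt.2 (le_trans ?_ hx0))
    have h2' := abs_le.1 h2
    refine Nat.cast_le.2 (Finset.card_le_card fun x hx => ?_)
    rw [mem_filter] at hx ⊢
    refine ⟨ME_mono (fun y hy => ?_) hx.1, fun hx' => hx.2 (ecomp_mono (fun y hy => ?_) _ hx')⟩
    · grind
    grind
  rw [map_measureReal_apply hm hQm] at hcb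
  have h5 := measureReal_mono hsub (measure_ne_top (μ.prod (Measure.pi (fun _ : Unit => gaussianReal 0 (1/4/(Fintype.card V : ℝ≥0))))) _)
  rw [measureReal_prod_prod] at h5
  have h6 : μ.real B * (1/2) ≤ μ.real B * (Measure.pi (fun _ : Unit => gaussianReal 0 (1/4/(Fintype.card V : ℝ≥0)))).real {z : Unit → ℝ | |z ()| ≤ ε} :=
    mul_le_mul_of_nonneg_left hz measureReal_nonneg
  linarith

lemma giant_num {q c' e : ℝ} (hq0 : 0 < q) (hq1 : q ≤ 1) (hc : 0 < c') (he : 0 < e) : ∃ s : ℕ, 0 < s ∧ ∃ N0 : ℕ, ∀ n : ℕ, N0 ≤ n →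
    (2:ℝ) ^ (n / s) * (1 - q) ^ ⌊c' * n⌋₊ ≤ e := by
  obtain ⟨s, hs⟩ := exists_nat_gt (2 / (q * c'))
  have hs0 : (0:ℝ) < s := lt_trans (by positivity) hs
  refine ⟨s, by exact_mod_cast hs0, ?_⟩
  obtain ⟨N0, hN0⟩ := exists_nat_gt ((q - Real.log e) / (q * c' / 2))
  refine ⟨N0, fun n hn => ?_⟩
  have hnr : (N0:ℝ) ≤ n := by exact_mod_cast hn
  have h1 : (2:ℝ) ^ (n / s) ≤ Real.exp ((n:ℝ) / s) := by
    calc (2:ℝ) ^ (n / s) ≤ (Real.exp 1) ^ (n / s) := by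
          gcongr
          linarith [add_one_le_exp (1:ℝ)]
      _ = Real.exp ((n / s : ℕ) : ℝ) := by rw [← exp_nat_mul, mul_one]
      _ ≤ _ := exp_le_exp.2 Nat.cast_div_le
  have h2 : (1 - q) ^ ⌊c' * n⌋₊ ≤ Real.exp (-q * ⌊c' * n⌋₊) := by
    calc (1 - q) ^ ⌊c' * n⌋₊ ≤ (Real.exp (-q)) ^ ⌊c' * n⌋₊ := by
          refine pow_le_pow_left₀ (by linarith) ?_ _
          linarith [add_one_le_exp (-q)]
      _ = _ := by rw [← exp_nat_mul, mul_comm]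
  have h3 : (n:ℝ) / s ≤ q * c' / 2 * n := by
    rw [div_le_iff₀ hs0]
    rw [div_lt_iff₀ (by positivity)] at hs
    have : (0:ℝ) ≤ n := by positivity
    nlinarith
  have h4 : c' * n - 1 ≤ ⌊c' * n⌋₊ := by linarith [Nat.lt_floor_add_one (c' * n)]
  rw [div_lt_iff₀ (by positivity)] at hN0
  have h5 : q * (c' * n - 1) ≤ q * ⌊c' * n⌋₊ := mul_le_mul_of_nonneg_left h4 hq0.le
  have h6 : (N0:ℝ) * (q * c' / 2) ≤ n * (q * c' / 2) := mul_le_mul_of_nonneg_right hnr (by positivity)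
  calc _ ≤ Real.exp ((n:ℝ) / s) * Real.exp (-q * ⌊c' * n⌋₊) := mul_le_mul h1 h2 (pow_nonneg (by linarith) _) (by positivity)
    _ = Real.exp ((n:ℝ)/s + (-q * ⌊c' * n⌋₊)) := by rw [Real.exp_add]
    _ ≤ Real.exp (Real.log e) := exp_le_exp.2 (by linarith)
    _ = e := Real.exp_log he

lemma giant {β : ℝ} (hb : 0 < β) (hb2 : β ≤ 2) (h : ℝ) {ε δ ε2 : ℝ} (hε : 0 < ε) (hδ : 0 < δ) (he2 : 0 < ε2) :
    ∃ s : ℕ, 0 < s ∧ ∃ N0 : ℕ, ∀ (V : Type) [Fintype V] (G : SimpleGraph V) (d : ℕ), GH G d β → N0 ≤ Fintype.card V →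
      ∀ μ : Measure (V → ℝ), GF μ (zG G d) →
    μ.real {ψ | ∀ x0, 3 * (δ * Fintype.card V) <
      (((ME G s {x | h + 3*ε ≤ ψ x}).filter (fun x => x ∉ ecomp G {x | h ≤ ψ x} x0)).card : ℝ)} ≤ ε2 := by
  obtain ⟨l, hl⟩ := exists_pow_lt_of_lt_one (show 0 < δ^2/4 by positivity) (show 1 - β/2 < 1 by linarith)
  obtain ⟨w, hw⟩ : ∃ w, w = δ^2/(8*((l:ℝ)+1)) := ⟨_, rfl⟩
  have hw0 : 0 < w := by rw [hw]; positivity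
  obtain ⟨c', hc'⟩ : ∃ c', c' = δ^2/(4*((l:ℝ)+1)^2) := ⟨_, rfl⟩
  have hc0 : 0 < c' := by rw [hc']; positivity
  obtain ⟨Mo, hMo⟩ : ∃ Mo, Mo = √(4/(β*w*ε2)) := ⟨_, rfl⟩
  have hMo0 : 0 < Mo := by rw [hMo]; positivity
  have hMo2 : Mo^2 = 4/(β*w*ε2) := by rw [hMo]; exact Real.sq_sqrt (by positivity)
  obtain ⟨σ, hσ0, hσ1, hσ⟩ := gauss_unif (v := 1/4) (by norm_num) Mo (show h+ε < h+2*ε by linarith)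
  obtain ⟨s, hs, N1, hN1⟩ := giant_num (q := σ^(l+1)) (by positivity) (pow_le_one₀ hσ0.le hσ1) hc0 (show 0 < ε2/4 by positivity)
  obtain ⟨N2, hN2⟩ := exists_nat_gt (1/ε^2)
  refine ⟨s, hs, max N1 N2, fun V _ G d hG hN μ hμ => ?_⟩
  have hNV := hG.conn.nonempty
  have hNp : (0:ℝ) < Fintype.card V := by exact_mod_cast Fintype.card_pos
  have hn2 : (N2:ℝ) ≤ Fintype.card V := by exact_mod_cast (le_max_right _ _).trans hN
  refine (hG.giant_core hμ hε hδ hw0 hMo0 hσ0.le hσ1 hs l ⌊c' * Fintype.card V⌋₊ hσ ?_ ?_).trans ?_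
  · rw [div_lt_iff₀ (by positivity)] at hN2
    nlinarith [sq_nonneg ε]
  · have h1 : (⌊c' * Fintype.card V⌋₊ : ℝ) ≤ c' * Fintype.card V := Nat.floor_le (by positivity)
    have h2 : ((l:ℝ)+1)*(w * Fintype.card V +(l+1)*⌊c' * Fintype.card V⌋₊) ≤ ((l:ℝ)+1)*(w * Fintype.card V +(l+1)*(c' * Fintype.card V)) := by gcongr
    have h3 : ((l:ℝ)+1)*(w * Fintype.card V +(l+1)*(c' * Fintype.card V)) = 3/8*δ^2*Fintype.card V := by
      rw [hw, hc']; field_simp; ring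
    have h4 : (δ * Fintype.card V)^2/(Fintype.card V:ℝ) = δ^2 * Fintype.card V := by field_simp
    have h5 : (1-β/2)^l*(Fintype.card V:ℝ) ≤ δ^2/4*(Fintype.card V:ℝ) := by gcongr
    have h6 : 0 < δ^2 * (Fintype.card V:ℝ) := by positivity
    rw [h4]
    linarith
  · have h1 := hN1 _ ((le_max_left _ _).trans hN)
    have h2 : 1 / (β * w * Mo^2) = ε2/4 := by rw [hMo2]; field_simp
    rw [h2]
    linarith

end
end GFF

namespace GFF
set_option linter.all false

section
local notation "δ(" x ")" => ((x:ℝ)-1)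
variable {d : ℕ} {V : ℕ → Type} [∀ n, Fintype (V n)] {G : ∀ n, SimpleGraph (V n)} {N : ℕ → ℕ} {α β : ℝ}
    {μ : ∀ n, Measure (V n → ℝ)} {T : Type} {Gt : SimpleGraph T} {o obar : T} {μT : Measure (T → ℝ)}
    {cov : ∀ n, V n → T → V n}
local notation "ρ(" n ")" => (rn d α β (N n))

def Aset {V : Type} (G : SimpleGraph V) (Gt : SimpleGraph T) (o obar : T) (π : T → V) (r : ℕ) (h b : ℝ) (x : V) : Set (V → ℝ) :=
  {ω | b ≤ ((levelComp G h ω x ∩ π '' spherePlus Gt o obar r).ncard : ℝ)}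

lemma Aset_meas {V : Type} [Fintype V] (G : SimpleGraph V) (Gt : SimpleGraph T) (o obar : T) (π : T → V) (r : ℕ) (h b : ℝ) (x : V) :
    MeasurableSet (Aset G Gt o obar π r h b x) :=
  measurableSet_thr h (fun E => b ≤ ((ecomp G E x ∩ π '' spherePlus Gt o obar r).ncard : ℝ))

lemma card_ind {Ω V : Type*} (S : Finset V) (U : V → Set Ω) (ω : Ω) :
    ((S.filter (fun x => ω ∈ U x)).card : ℝ) = ∑ x ∈ S, (U x).indicator (fun _ => (1:ℝ)) ω := by
  rw [card_filter]
  push_cast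
  refine sum_congr rfl fun x _ => ?_
  simp [indicator_apply]

lemma card_meas {Ω V : Type*} [MeasurableSpace Ω] (S : Finset V) (U : V → Set Ω) (hU : ∀ x, MeasurableSet (U x)) :
    Measurable (fun ω => ((S.filter (fun x => ω ∈ U x)).card : ℝ)) := by
  simp_rw [card_ind]
  exact measurable_sum _ fun x _ => measurable_const.indicator (hU x)

lemma card_int {Ω V : Type*} [MeasurableSpace Ω] (μ : Measure Ω) [IsProbabilityMeasure μ] (S : Finset V) (U : V → Set Ω) (hU : ∀ x, MeasurableSet (U x)) :
    Integrable (fun ω => ((S.filter (fun x => ω ∈ U x)).card : ℝ)) μ ∧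
    ∫ ω, ((S.filter (fun x => ω ∈ U x)).card : ℝ) ∂μ = ∑ x ∈ S, μ.real (U x) := by
  simp_rw [card_ind]
  have hi : ∀ x ∈ S, Integrable (fun ω => (U x).indicator (fun _ => (1:ℝ)) ω) μ := fun x _ => (integrable_const _).indicator (hU x)
  refine ⟨integrable_finset_sum _ hi, ?_⟩
  rw [integral_finset_sum _ hi]
  refine sum_congr rfl fun x _ => ?_
  rw [integral_indicator_const _ (hU x), smul_eq_mul, mul_one]

lemma card_markov {Ω V : Type*} [MeasurableSpace Ω] (μ : Measure Ω) [IsProbabilityMeasure μ] (S : Finset V) (U : V → Set Ω) (hU : ∀ x, MeasurableSet (U x)) (a : ℝ) :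
    a * μ.real {ω | a ≤ ((S.filter (fun x => ω ∈ U x)).card : ℝ)} ≤ ∑ x ∈ S, μ.real (U x) := by
  rw [← (card_int μ S U hU).2]
  exact mul_meas_ge_le_integral_of_nonneg (ae_of_all _ fun ω => Nat.cast_nonneg _) (card_int μ S U hU).1 a

lemma SQ.det (Q : SQ d V G N α β μ T Gt o obar μT cov) (n : ℕ) (ω : V n → ℝ) {h ε p δ b : ℝ} (hε : 0 < ε) (hp : 0 < p) {s : ℕ}
    (hs : s ≤ ρ(n)) (hb : b ≤ p / 4 * δ(d)^ρ(n)) (x0 : V n)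
    (hx0 : (((ME (G n) s {x | h + 3*ε ≤ ω x}).filter (fun x => x ∉ ecomp (G n) {x | h ≤ ω x} x0)).card : ℝ) ≤ 3 * (δ * N n)) :
    ((Finset.univ.filter (fun x => ω ∈ Mv Gt o (cov n x) (h+3*ε) s)).card : ℝ) ≤
      ((Finset.univ.filter (fun x => ω ∈ Aset (G n) Gt o obar (cov n x) ρ(n) h b x)).card : ℝ) +
      ((Finset.univ.filter (fun x => ¬ GoodB (G n) ρ(n) x)).card : ℝ) +
      ((Finset.univ.filter (fun x => GoodB (G n) ρ(n) x ∧ (((Sf Gt o obar (cov n x) ρ(n)).filter (fun y => ω ∈ Mv Gt o (cov n y) (h+3*ε) s)).card : ℝ) ≤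
      p / 2 * δ(d)^ρ(n))).card : ℝ) +
      (1 + 16/p) * (((Finset.univ.filter (fun x => ¬ GoodB (G n) ρ(n) x)).card : ℝ) + 3 * (δ * N n)) := by
  have hD : 0 < δ(d)^ρ(n) := pow_pos (by linarith [Q.d3]) _
  set r := ρ(n) with hr
  set D := δ(d)^r with hDD
  set M := Finset.univ.filter (fun x => ω ∈ Mv Gt o (cov n x) (h+3*ε) s) with hM
  set Bd := Finset.univ.filter (fun x => ¬ GoodB (G n) r x) with hBd
  set AA := Finset.univ.filter (fun x => ω ∈ Aset (G n) Gt o obar (cov n x) r h b x) with hAA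
  set U := Finset.univ.filter (fun x => GoodB (G n) r x ∧ (((Sf Gt o obar (cov n x) r).filter (fun y => ω ∈ Mv Gt o (cov n y) (h+3*ε) s)).card : ℝ) ≤
      p / 2 * D) with hU
  set Kc := ecomp (G n) {x | h ≤ ω x} x0 with hK
  obtain ⟨B, hB⟩ : ∃ B, B = M.filter (fun x => x ∉ Kc) := ⟨_, rfl⟩
  have hBc : (B.card : ℝ) ≤ Bd.card + 3 * (δ * N n) := by
    have h1 : B ⊆ Bd ∪ ((ME (G n) s {x | h + 3*ε ≤ ω x}).filter (fun x => x ∉ Kc)) := by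
      intro x hx
      rw [hB, mem_filter] at hx
      rw [Finset.mem_union]
      by_cases hg : GoodB (G n) r x
      · right
        rw [mem_filter]
        refine ⟨?_, hx.2⟩
        rw [ME, mem_filter]
        exact ⟨Finset.mem_univ _, (Q.cv n x).card_of hg hs (mem_filter.1 hx.1).2⟩
      grind
    have h2 : (B.card : ℝ) ≤ _ := Nat.cast_le.2 ((Finset.card_le_card h1).trans (Finset.card_union_le _ _))
    grind
  obtain ⟨Z, hZ⟩ : ∃ Z : Finset (V n), Z = Finset.univ.filter (fun x => p / 4 * D < (((Sf Gt o obar (cov n x) r).filter (fun y => y ∈ B)).card : ℝ)) := ⟨_, rfl⟩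
  have hZc : (Z.card : ℝ) ≤ 16 / p * B.card := by
    have h1 := Q.dc n r Z B
    have h2 : (Z.card : ℝ) * (p / 4 * D) ≤ ∑ x ∈ Z, (((Sf Gt o obar (cov n x) r).filter (fun y => y ∈ B)).card : ℝ) := by
      rw [← nsmul_eq_mul]
      refine card_nsmul_le_sum _ _ _ fun x hx => ?_
      grind
    have h3 := h2.trans h1
    have h4 : (Z.card : ℝ) * p ≤ 16 * B.card := by
      refine le_of_mul_le_mul_right ?_ hD
      linarith
    rw [div_mul_eq_mul_div, le_div_iff₀ hp]
    exact h4
  have hsub : M ⊆ AA ∪ Bd ∪ U ∪ B ∪ Z := by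
    intro x hx
    by_contra hcon
    simp only [Finset.mem_union, not_or] at hcon
    obtain ⟨⟨⟨⟨c1, c2⟩, c3⟩, c4⟩, c5⟩ := hcon
    have hg : GoodB (G n) r x := by grind
    have hxK : x ∈ Kc := by
      grind
    have h3 : p / 2 * D < (((Sf Gt o obar (cov n x) r).filter (fun y => ω ∈ Mv Gt o (cov n y) (h+3*ε) s)).card : ℝ) := by
      grind
    have h5 : (((Sf Gt o obar (cov n x) r).filter (fun y => y ∈ B)).card : ℝ) ≤ p / 4 * D := by
      grind
    have h6 : (((Sf Gt o obar (cov n x) r).filter (fun y => ω ∈ Mv Gt o (cov n y) (h+3*ε) s)).card : ℝ) ≤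
        (((Sf Gt o obar (cov n x) r).filter (fun y => y ∈ B)).card : ℝ) + (((Sf Gt o obar (cov n x) r).filter (fun y => y ∈ Kc)).card : ℝ) := by
      norm_cast
      refine le_trans (Finset.card_le_card ?_) (Finset.card_union_le _ _)
      grind
    refine c1 ?_
    rw [hAA, mem_filter]
    refine ⟨Finset.mem_univ _, ?_⟩
    change b ≤ _
    have h7 : ((Sf Gt o obar (cov n x) r).filter (fun y => y ∈ Kc)).card ≤ (levelComp (G n) h ω x ∩ cov n x '' spherePlus Gt o obar r).ncard := by
      rw [← ncard_coe_finset]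
      refine ncard_le_ncard ?_ (toFinite _)
      intro y hy
      rw [Finset.mem_coe, mem_filter, Sf, mem_toFinset] at hy
      refine ⟨?_, hy.1⟩
      change y ∈ ecomp (G n) {x | h ≤ ω x} x
      rw [← ecomp_eq hxK]
      exact hy.2
    have h8 : (((Sf Gt o obar (cov n x) r).filter (fun y => y ∈ Kc)).card : ℝ) ≤ _ := Nat.cast_le.2 h7
    linarith
  have hcard : M.card ≤ AA.card + Bd.card + U.card + B.card + Z.card := by
    refine (Finset.card_le_card hsub).trans ?_
    grind
  have hcard' : (M.card : ℝ) ≤ AA.card + Bd.card + U.card + B.card + Z.card := by exact_mod_cast hcard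
  have h9 : (1 + 16/p) * (B.card : ℝ) ≤ (1 + 16/p) * (Bd.card + 3 * (δ * N n)) := mul_le_mul_of_nonneg_left hBc (by positivity)
  linarith

lemma SQ.low (Q : SQ d V G N α β μ T Gt o obar μT cov) {h : ℝ} (hpos : 0 < etaJ d d h) {t : ℝ} (ht : 0 < t) :
    ∀ᶠ n in atTop, (μ n).real {ω | ((Finset.univ.filter (fun x => ω ∈ Aset (G n) Gt o obar (cov n x) ρ(n) h ((N n : ℝ) ^ (c0 d α β / 36)) x)).card : ℝ) <
      (etaJ d d h - t) * N n} ≤ t := by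
  obtain ⟨p, hp⟩ : ∃ p, p = etaJ d d h := ⟨_, rfl⟩
  rw [← hp] at hpos ⊢
  obtain ⟨ε0, hε0, hrc⟩ := etaJ_rc Q.th.hd d h (δ := min (t/2) (p/2)) (by positivity)
  obtain ⟨ε, hε, he3⟩ : ∃ ε > 0, 3 * ε = ε0 := ⟨ε0/3, by positivity, by ring⟩
  have hp3 := hrc (h + 3*ε) (by linarith) (by linarith)
  rw [← hp] at hp3
  obtain ⟨Kp, hKp⟩ : ∃ Kp, Kp = 1 + 32 / p := ⟨_, rfl⟩
  have hKp1 : 1 ≤ Kp := by rw [hKp]; have : 0 < 32/p := by positivity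
                           linarith
  obtain ⟨s, hs0, N0, hgi⟩ := giant Q.b0 Q.b2 h hε (δ := t/(24*Kp)) (ε2 := t/4) (by positivity) (by positivity)
  obtain ⟨p3, hp3d⟩ : ∃ p3, p3 = μT.real (reach Gt o univ (h+3*ε) s) := ⟨_, rfl⟩
  have hpr := Q.th.hμ.1
  have hp3e : etaJ d d (h+3*ε) ≤ p3 := by
    rw [hp3d, ← eta_eq Q.th (RS_univ (o := o) Q.th.ht), inf_iff Q.th (RS_univ (o := o) Q.th.ht)]
    refine measureReal_mono (fun ω hω => ?_) (measure_ne_top _ _)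
    have := mem_iInter.1 hω (s-1)
    rwa [Nat.sub_add_cancel hs0] at this
  have hp3h : p / 2 ≤ p3 := by linarith [min_le_right (t/2) (p/2)]
  have hp3t : p - t / 2 ≤ p3 := by linarith [min_le_left (t/2) (p/2)]
  have hp30 : 0 < p3 := by linarith
  have hinv : 1 + 16/p3 ≤ Kp := by
    rw [hKp]
    have : 16/p3 ≤ 32/p := by rw [div_le_div_iff₀ hp30 hpos]; linarith
    linarith
  filter_upwards [Q.cnt (h+3*ε) s (ε := t/8) (by positivity), Q.sph (h+3*ε) s (ε := t^2/64) (by positivity) hp3d hp30,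
    Q.bad (ε := t/(16*Kp)) (by positivity), Q.pow_ge (4/p3), Q.r_tend.eventually_ge_atTop s, Q.Nt.eventually_ge_atTop N0] with n h1 h2 h3 h4 h5 h6
  have hpn := (Q.gf n).isProb
  have hN : (0:ℝ) < N n := by exact_mod_cast Q.Npos n
  have h7 := hgi (V n) (G n) d (Q.gh n) (by rw [← Q.hN]; exact h6) (μ n) (Q.gf n)
  rw [← Q.hN] at h7
  set r := ρ(n) with hr
  set D := δ(d)^r with hD
  obtain ⟨Us, hUs⟩ : ∃ Us : V n → Set (V n → ℝ), Us = fun x => {ω | (((Sf Gt o obar (cov n x) r).filter (fun y => ω ∈ Mv Gt o (cov n y) (h+3*ε) s)).card : ℝ) ≤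
      p3 / 2 * D} := ⟨_, rfl⟩
  set B1 := {ω : V n → ℝ | ((Finset.univ.filter (fun x => ω ∈ Mv Gt o (cov n x) (h+3*ε) s)).card : ℝ) ≤
      (μT.real (reach Gt o univ (h+3*ε) s) - t/8) * N n} with hB1
  set B2 := {ψ : V n → ℝ | ∀ x0, 3 * (t/(24*Kp) * (N n : ℝ)) <
      (((ME (G n) s {x | h + 3*ε ≤ ψ x}).filter (fun x => x ∉ ecomp (G n) {x | h ≤ ψ x} x0)).card : ℝ)} with hB2
  set B3 := {ω : V n → ℝ | t/8 * N n ≤ ((Finset.univ.filter (fun x => GoodB (G n) r x ∧ ω ∈ Us x)).card : ℝ)} with hB3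
  have hm3 : (μ n).real B3 ≤ t/8 := by
    have hUm : ∀ x, MeasurableSet (Us x) := by
      intro x
      rw [hUs]
      exact measurableSet_le (card_meas _ (fun y => Mv Gt o (cov n y) (h+3*ε) s) fun y => Mv_meas Q.th _ _ _) measurable_const
    have k1 := card_markov (μ n) (Finset.univ.filter (fun x => GoodB (G n) r x)) Us hUm (t/8 * N n)
    simp only [Finset.filter_filter] at k1
    have k2 : ∑ x ∈ Finset.univ.filter (fun x => GoodB (G n) r x), (μ n).real (Us x) ≤ t^2/64 * N n := by rw [hUs]; exact h2
    have k3 : (t/8 * N n) * (μ n).real B3 ≤ (t/8 * N n) * (t/8) := by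
      refine (k1.trans k2).trans (le_of_eq ?_)
      ring
    exact le_of_mul_le_mul_left k3 (by positivity)
  have hsub : {ω | ((Finset.univ.filter (fun x => ω ∈ Aset (G n) Gt o obar (cov n x) r h ((N n : ℝ) ^ (c0 d α β / 36)) x)).card : ℝ) <
      (p - t) * N n} ⊆ B1 ∪ B2 ∪ B3 := by
    intro ω hω
    by_contra hc
    simp only [mem_union, not_or] at hc
    obtain ⟨⟨c1, c2⟩, c3⟩ := hc
    simp only [hB1, hB2, hB3, mem_setOf_eq, not_le, not_forall, not_lt] at c1 c2 c3
    obtain ⟨x0, c2⟩ := c2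
    rw [mem_setOf_eq] at hω
    rw [← hp3d] at c1
    have hdet := Q.det n ω hε hp30 (s := s) h5 (b := (N n : ℝ) ^ (c0 d α β / 36)) (by
      rw [div_mul_eq_mul_div, div_le_iff₀ hp30] at h4
      linarith) x0 c2
    rw [hUs] at c3
    simp only [mem_setOf_eq] at c3
    rw [← hr, ← hD] at hdet
    have e1 : (1 + 16/p3) * (((Finset.univ.filter (fun x => ¬ GoodB (G n) r x)).card : ℝ) + 3 * (t/(24*Kp) * N n)) ≤
       Kp * (t/(16*Kp) * N n + 3 * (t/(24*Kp) * N n)) := by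
      refine mul_le_mul hinv (by linarith) (by positivity) (by linarith)
    have e2 : Kp * (t/(16*Kp) * N n + 3 * (t/(24*Kp) * N n)) = (t/16 + t/8) * N n := by field_simp; ring
    have e3 : t/(16*Kp) * N n ≤ t/16 * N n := by
      gcongr
      linarith
    have e4 : (p - t/2) * N n ≤ p3 * N n := by gcongr
    linarith
  refine (measureReal_mono hsub (measure_ne_top _ _)).trans ?_
  refine (measureReal_union_le _ _).trans ?_
  have := measureReal_union_le (μ := μ n) B1 B2
  linarith
end
end GFF

namespace GFF
set_option linter.all false

section
local notation "𝟏" => (fun _ => (1:ℝ))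
variable {d : ℕ} {V : ℕ → Type} [∀ n, Fintype (V n)] {G : ∀ n, SimpleGraph (V n)} {N : ℕ → ℕ} {α β : ℝ}
    {μ : ∀ n, Measure (V n → ℝ)} {T : Type} {Gt : SimpleGraph T} {o obar : T} {μT : Measure (T → ℝ)}
    {cov : ∀ n, V n → T → V n}
local notation "ρ(" n ")" => (rn d α β (N n))

lemma SQ.up (Q : SQ d V G N α β μ T Gt o obar μT cov) {h : ℝ} {t : ℝ} (ht : 0 < t) :
    ∀ᶠ n in atTop, ∑ x, (μ n).real (Aset (G n) Gt o obar (cov n x) ρ(n) h ((N n : ℝ) ^ (c0 d α β / 36)) x) ≤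
      (etaJ d d h + t) * N n := by
  have hpr := Q.th.hμ.1
  have hR := RS_univ (o := o) Q.th.ht
  have h2 : Tendsto (fun n => μT.real (reach Gt o univ h (n+1))) atTop (nhds (etaJ d d h)) := by
    rw [← eta_eq Q.th hR, inf_iff Q.th hR]
    refine (ENNReal.tendsto_toReal (measure_ne_top _ _)).comp ?_
    refine tendsto_measure_iInter_atTop (fun n => (reach_meas Q.th _ h (n+1)).nullMeasurableSet) ?_
      ⟨0, measure_ne_top _ _⟩
    refine antitone_nat_of_succ_le fun n => ?_
    rintro ω ⟨z, h1, h2, h3⟩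
    exact ⟨par Gt o z, by rw [par_depth Q.th.ht, h1]; omega, hR.up z h2, (anc_iff.1 h3).2⟩
  obtain ⟨m, hm⟩ := (h2.eventually (ge_mem_nhds (show etaJ d d h < etaJ d d h + t/3 by linarith))).exists
  obtain ⟨D, hD⟩ := Q.loc h (m+1) (δ := t/3) (by positivity)
  filter_upwards [hD, Q.bad (ε := t/3) (by positivity), Q.r_tend.eventually_ge_atTop (m+1)] with n h1 h3 h4
  have hpn := (Q.gf n).isProb
  have hN : (0:ℝ) < N n := by exact_mod_cast Q.Npos n
  have hp0 := etaJ_nonneg (d := d) d h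
  have key : ∀ x, (μ n).real (Aset (G n) Gt o obar (cov n x) ρ(n) h ((N n : ℝ) ^ (c0 d α β / 36)) x) ≤
      (etaJ d d h + 2*t/3) + if ¬ GoodB (G n) ρ(n) x then 1 else 0 := by
    intro x
    by_cases hg : GoodB (G n) ρ(n) x
    · rw [if_neg (not_not.2 hg), add_zero]
      have hsub : Aset (G n) Gt o obar (cov n x) ρ(n) h ((N n : ℝ) ^ (c0 d α β / 36)) x ⊆ Mv Gt o (cov n x) h (m+1) := by
        intro ω hω
        have h5 : (0:ℝ) < ((levelComp (G n) h ω x ∩ cov n x '' spherePlus Gt o obar ρ(n)).ncard : ℝ) :=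
          lt_of_lt_of_le (by positivity) hω
        have h6 : (levelComp (G n) h ω x ∩ cov n x '' spherePlus Gt o obar ρ(n)).ncard ≠ 0 := by
          intro h0; rw [h0] at h5; simp at h5
        obtain ⟨y, hy, z, hz, rfl⟩ := Set.nonempty_of_ncard_ne_zero h6
        refine (Q.cv n x).reach_of hy ?_
        rw [((Q.cv n x).good hg).1 z hz.2.le, hz.2]
        exact h4
      have h7 := measureReal_mono hsub (measure_ne_top (μ n) _)
      grind
    · rw [if_pos hg]
      have : (μ n).real (Aset (G n) Gt o obar (cov n x) ρ(n) h ((N n : ℝ) ^ (c0 d α β / 36)) x) ≤ 1 := measureReal_le_one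
      linarith
  refine (sum_le_sum fun x _ => key x).trans ?_
  rw [sum_add_distrib, sum_const, card_univ, ← Q.hN, Finset.sum_boole, nsmul_eq_mul]
  linarith

lemma conc {Ω : Type*} [MeasurableSpace Ω] (μ : Measure Ω) [IsProbabilityMeasure μ] (X : Ω → ℝ) (hX : Measurable X)
    {N p t : ℝ} (hN : 0 < N) (hp0 : 0 ≤ p) (hp1 : p ≤ 1) (ht : 0 < t) (h0 : ∀ ω, 0 ≤ X ω) (h1 : ∀ ω, X ω ≤ N)
    (hlow : μ.real {ω | X ω < (p - t) * N} ≤ t) (hup : ∫ ω, X ω ∂μ ≤ (p + t) * N) :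
    (p - 2 * t) * N ≤ ∫ ω, X ω ∂μ ∧ variance X μ ≤ 5 * t * N ^ 2 := by
  set B := {ω | X ω < (p - t) * N} with hB
  have hBm : MeasurableSet B := measurableSet_lt hX measurable_const
  have hXi : Integrable X μ := Integrable.of_bound hX.aestronglyMeasurable N (ae_of_all _ fun ω => by
    rw [norm_eq_abs, abs_of_nonneg (h0 ω)]; exact h1 ω)
  have hBi : Integrable (B.indicator 𝟏) μ := (integrable_const _).indicator hBm
  have hBe : ∫ ω, B.indicator 𝟏 ω ∂μ = μ.real B := by
    rw [integral_indicator_const _ hBm, smul_eq_mul, mul_one]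
  have hdef : ∀ ω, p * N - X ω ≤ t * N + N * B.indicator 𝟏 ω := by
    intro ω
    by_cases hω : ω ∈ B
    · rw [indicator_of_mem hω]
      have : p * N ≤ N := by nlinarith
      have : 0 < t * N := by positivity
      grind
    · rw [indicator_of_notMem hω]
      grind
  constructor
  · have h3 : ∫ ω, (p * N - X ω) ∂μ ≤ ∫ ω, (t * N + N * B.indicator 𝟏 ω) ∂μ :=
      integral_mono ((integrable_const _).sub hXi) ((integrable_const _).add (hBi.const_mul _)) hdef
    rw [integral_sub (integrable_const _) hXi, integral_add (integrable_const _) (hBi.const_mul _), integral_const_mul N, hBe] at h3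
    simp at h3
    have h4 : N * μ.real B ≤ N * t := by gcongr
    linarith
  · rw [← variance_sub_const hX.aestronglyMeasurable (p * N)]
    refine (variance_le_expectation_sq (hX.sub_const _).aestronglyMeasurable).trans ?_
    have hpt : ∀ ω, (X ω - p * N)^2 ≤ N * ((X ω - p * N) + 2 * (t * N + N * B.indicator 𝟏 ω)) := by
      intro ω
      have hpN : 0 ≤ p * N := by positivity
      have hpN' : p * N ≤ N := by nlinarith
      have hi : 0 ≤ B.indicator 𝟏 ω := indicator_nonneg (fun _ _ => zero_le_one) _
      have ha : |X ω - p * N| ≤ N := abs_le.2 ⟨by grind, by grind⟩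
      have hb : |X ω - p * N| ≤ (X ω - p * N) + 2 * (t * N + N * B.indicator 𝟏 ω) := by
        refine abs_le.2 ⟨by grind, ?_⟩
        have : 0 ≤ t * N + N * B.indicator 𝟏 ω := by positivity
        linarith
      rw [← sq_abs, sq]
      exact mul_le_mul ha hb (abs_nonneg _) hN.le
    have hc : Integrable (fun ω => (X ω - p * N)) μ := hXi.sub (integrable_const _)
    have hd : Integrable (fun ω => 2 * (t * N + N * B.indicator 𝟏 ω)) μ := ((integrable_const _).add (hBi.const_mul _)).const_mul 2
    have h5 : ∫ ω, (X ω - p * N)^2 ∂μ ≤ ∫ ω, N * ((X ω - p * N) + 2 * (t * N + N * B.indicator 𝟏 ω)) ∂μ := by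
      refine integral_mono ?_ ((hc.add hd).const_mul N) hpt
      refine Integrable.of_bound ((hX.sub_const _).pow_const 2).aestronglyMeasurable (N^2) (ae_of_all _ fun ω => ?_)
      have hpN : 0 ≤ p * N := by positivity
      have hpN' : p * N ≤ N := by nlinarith
      rw [norm_eq_abs, abs_of_nonneg (sq_nonneg _)]
      exact sq_le_sq' (by grind) (by grind)
    rw [integral_const_mul N, integral_add hc hd, integral_sub hXi (integrable_const _), integral_const_mul 2,
      integral_add (integrable_const _) (hBi.const_mul _), integral_const_mul N, hBe] at h5
    simp at h5
    have h4 : N * μ.real B ≤ N * t := by gcongr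
    have h6 : ∫ ω, X ω ∂μ - p * N + 2 * (t * N + N * μ.real B) ≤ 5 * t * N := by linarith
    have h7 := mul_le_mul_of_nonneg_left h6 hN.le
    calc _ = ∫ ω, (X ω - p * N)^2 ∂μ := by simp
      _ ≤ _ := h5
      _ ≤ _ := h7
      _ = _ := by ring

end
end GFF

end

open MeasureTheory ProbabilityTheory Filter Set
open scoped ENNReal NNReal ENat Classical
/-- first and second moment bounds for the number of vertices in
mesoscopic components in the supercritical phase. -/
theorem supercritical_first_and_second_moment
    (d : ℕ) (hd : 3 ≤ d)
    (V : ℕ → Type) [∀ n, Fintype (V n)]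
    (G : ∀ n, SimpleGraph (V n)) (N : ℕ → ℕ) (α β : ℝ)
    (hα : 0 < α ∧ α ≤ 1) (hβ : 0 < β ∧ β ≤ 2)
    (hNmono : StrictMono N) (hNpos : ∀ n, 1 ≤ N n)
    (hcard : ∀ n, Nat.card (V n) = N n)
    (hconn : ∀ n, (G n).Connected)
    (hreg : ∀ n, GFF.IsReg (G n) d)
    (hcyc : ∀ n (x : V n),
      GFF.adjPairs (G n) (GFF.gball (G n) x ⌊α * Real.logb ((d : ℝ) - 1) (N n : ℝ)⌋₊) ≤
        2 * (GFF.gball (G n) x ⌊α * Real.logb ((d : ℝ) - 1) (N n : ℝ)⌋₊).ncard)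
    (hgap : ∀ n, GFF.SpectralGapLB (G n) d β)
    (μ : ∀ n, Measure (V n → ℝ))
    (hμ : ∀ n, GFF.IsGaussianField (μ n) (GFF.zGreen (G n) d (N n)))
    (T : Type) (Gt : SimpleGraph T) (o obar : T) (hobar : Gt.Adj o obar)
    (htree : GFF.IsRegTree Gt d)
    (μT : Measure (T → ℝ)) (hμT : GFF.IsGaussianField μT (GFF.treeGreen Gt d))
    (cov : ∀ n, V n → T → V n) (hcov : ∀ n x, GFF.IsCoverMap Gt (G n) o x (cov n x))
    (h : ℝ) (hh : h < GFF.hstar Gt o μT) :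
    ∃ c : ℝ, 0 < c ∧
      (GFF.etaPlus Gt o obar μT h ≤
          Filter.liminf
            (fun n => (N n : ℝ)⁻¹ * ∑ x : V n,
              (μ n {ω | (N n : ℝ) ^ c ≤
                ((GFF.levelComp (G n) h ω x ∩
                  cov n x '' GFF.spherePlus Gt o obar (GFF.rn d α β (N n))).ncard : ℝ)}).toReal)
            Filter.atTop ∧
        0 < GFF.etaPlus Gt o obar μT h) ∧
      Filter.Tendsto
        (fun n => ((N n : ℝ) ^ 2)⁻¹ *
          variance
            (fun ω => ∑ x : V n,
              if (N n : ℝ) ^ c ≤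
                  ((GFF.levelComp (G n) h ω x ∩
                    cov n x '' GFF.spherePlus Gt o obar (GFF.rn d α β (N n))).ncard : ℝ)
                then (1 : ℝ) else 0)
            (μ n))
        Filter.atTop (nhds 0) := by
  have e0 : ∀ n, N n = Fintype.card (V n) := fun n => by rw [← hcard, Nat.card_eq_fintype_card]
  have hgh : ∀ n, GFF.GH (G n) d β := fun n => ⟨hd, hconn n, hreg n, hgap n, hβ.1, hβ.2⟩
  have Q : GFF.SQ d V G N α β μ T Gt o obar μT cov :=
    { gh := hgh
      hN := e0
      Nt := hNmono.tendsto_atTop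
      a0 := hα.1
      a1 := hα.2
      cyc := hcyc
      gf := fun n => by
        have h1 : GFF.IsGaussianField (μ n) (GFF.zG (G n) d) := by
          have := hμ n
          rw [e0 n] at this
          exact this
        have h2 := h1.fin (J := V n) id Function.injective_id (fun c => (hgh n).green_psd c)
        have h3 : (μ n).map (fun ω : V n → ℝ => ω ∘ id) = μ n := Measure.map_id
        rw [h3] at h2
        exact h2
      th := ⟨hd, htree, hμT⟩
      cv := fun n x => ⟨htree, hd, hconn n, hreg n, hcov n x⟩
      ob := hobar }
  have hpos := GFF.etaJ_hstar Q.th h hh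
  have hpT := hμT.1
  have hplus : GFF.etaPlus Gt o obar μT h = GFF.etaJ d (d-1) h := GFF.eta_eq Q.th (GFF.RS_plus htree hd hobar) h
  have hp1 : GFF.etaJ d d h ≤ 1 := by
    rw [← GFF.eta_eq Q.th (GFF.RS_univ (o := o) htree) h]
    exact measureReal_le_one
  obtain ⟨p, hp⟩ : ∃ p, p = GFF.etaJ d d h := ⟨_, rfl⟩
  have key : ∀ t : ℝ, 0 < t → ∀ᶠ n in Filter.atTop,
      (p - 2 * t) * N n ≤ ∑ x : V n, (μ n).real (GFF.Aset (G n) Gt o obar (cov n x) (GFF.rn d α β (N n)) h ((N n : ℝ) ^ (GFF.c0 d α β / 36)) x) ∧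
      ∑ x : V n, (μ n).real (GFF.Aset (G n) Gt o obar (cov n x) (GFF.rn d α β (N n)) h ((N n : ℝ) ^ (GFF.c0 d α β / 36)) x) ≤ (p + t) * N n ∧
      variance (fun ω => ∑ x : V n, if ω ∈ GFF.Aset (G n) Gt o obar (cov n x) (GFF.rn d α β (N n)) h ((N n : ℝ) ^ (GFF.c0 d α β / 36)) x then (1:ℝ) else 0) (μ n)
        ≤ 5 * t * (N n : ℝ) ^ 2 := by
    intro t ht
    filter_upwards [Q.low hpos ht, Q.up (h := h) ht] with n h1 h2
    have hpn := (Q.gf n).isProb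
    have hN : (0:ℝ) < N n := by exact_mod_cast Q.Npos n
    rw [← hp] at h1 h2
    have hAm : ∀ x : V n, MeasurableSet (GFF.Aset (G n) Gt o obar (cov n x) (GFF.rn d α β (N n)) h ((N n : ℝ) ^ (GFF.c0 d α β / 36)) x) :=
      fun x => GFF.Aset_meas _ _ _ _ _ _ _ _ _
    have h3 := GFF.card_int (μ n) Finset.univ (fun x => GFF.Aset (G n) Gt o obar (cov n x) (GFF.rn d α β (N n)) h ((N n : ℝ) ^ (GFF.c0 d α β / 36)) x) hAm
    have h4 := GFF.conc (μ n) (fun ω => ((Finset.univ.filter (fun x => ω ∈ GFF.Aset (G n) Gt o obar (cov n x) (GFF.rn d α β (N n)) h ((N n : ℝ) ^ (GFF.c0 d α β / 36)) x)).card : ℝ))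
      (GFF.card_meas _ _ hAm) hN (hp ▸ hpos.le) (hp ▸ hp1) ht (fun ω => Nat.cast_nonneg _)
      (fun ω => by rw [e0 n]; exact Nat.cast_le.2 (Finset.card_le_univ _)) h1 (by rw [h3.2]; exact h2)
    rw [h3.2] at h4
    refine ⟨h4.1, h2, ?_⟩
    simp_rw [Finset.sum_boole]
    exact h4.2
  refine ⟨GFF.c0 d α β / 36, by have := Q.c0pos.1; positivity, ⟨?_, ?_⟩, ?_⟩
  · have hlim : Tendsto (fun n => (N n : ℝ)⁻¹ * ∑ x : V n,
              (μ n {ω | (N n : ℝ) ^ (GFF.c0 d α β / 36) ≤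
                ((GFF.levelComp (G n) h ω x ∩
                  cov n x '' GFF.spherePlus Gt o obar (GFF.rn d α β (N n))).ncard : ℝ)}).toReal) Filter.atTop (nhds p) := by
      rw [Metric.tendsto_atTop']
      intro e he
      obtain ⟨n0, hn0⟩ := Filter.eventually_atTop.1 (key (e/4) (by positivity))
      refine ⟨n0, fun n hn => ?_⟩
      obtain ⟨k1, k2, _⟩ := hn0 n hn.le
      have hN : (0:ℝ) < N n := by exact_mod_cast Q.Npos n
      change dist ((N n : ℝ)⁻¹ * ∑ x : V n, (μ n).real (GFF.Aset (G n) Gt o obar (cov n x) (GFF.rn d α β (N n)) h ((N n : ℝ) ^ (GFF.c0 d α β / 36)) x)) p < e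
      rw [inv_mul_eq_div, Real.dist_eq]
      have k3 := (le_div_iff₀ hN).2 k1
      have k4 := (div_le_iff₀ hN).2 k2
      exact abs_lt.2 ⟨by linarith, by linarith⟩
    rw [hlim.liminf_eq, hplus, hp]
    exact GFF.etaJ_mono (Nat.sub_le _ _) h
  · rw [hplus]
    exact GFF.etaJ_pos (by omega) h hpos
  · rw [Metric.tendsto_atTop']
    intro e he
    obtain ⟨n0, hn0⟩ := Filter.eventually_atTop.1 (key (e/6) (by positivity))
    refine ⟨n0, fun n hn => ?_⟩
    obtain ⟨_, _, k3⟩ := hn0 n hn.le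
    have hN : (0:ℝ) < N n := by exact_mod_cast Q.Npos n
    have k4 : variance
            (fun ω => ∑ x : V n,
              if (N n : ℝ) ^ (GFF.c0 d α β / 36) ≤
                  ((GFF.levelComp (G n) h ω x ∩
                    cov n x '' GFF.spherePlus Gt o obar (GFF.rn d α β (N n))).ncard : ℝ)
                then (1 : ℝ) else 0)
            (μ n) ≤ 5 * (e/6) * (N n : ℝ)^2 := by
      (convert k3 using 6; exact Iff.rfl)
    rw [Real.dist_eq, sub_zero, abs_of_nonneg (mul_nonneg (by positivity) (variance_nonneg _ _)), inv_mul_eq_div, div_lt_iff₀ (by positivity)]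
    have : 0 < e * (N n : ℝ)^2 := by positivity
    linarith
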